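/- arXiv:1901.07671 — 3 statements merged into one kernel-verified Lean document; each statement's English description precedes it below -/
import Mathlib

section
/- Let u be a non-constant solution of the Allen–Cahn equation −Δu = u − u³ on ℝ³ with u(x) < 0 whenever x₃ < 0 and with u(x) ≤ H(x₃) for all x ∈ ℝ³. Let A > 0 satisfy tanh(A/√2) ≥ √(2/3). For s > 0 and x₃ ∈ ℝ define K(s, x₃) = ∫_{x₁²+x₂²<s²} ( (∂₁u(x₁,x₂,x₃))² + (∂₂u(x₁,x₂,x₃))² ) dx₁ dx₂. Then there exist constants C > 0 and β > 0 such that K(s, x₃) ≤ C·(1 + K(s + β·ln s, −A)) for all s ≥ 1 and all x₃ ≤ −A. -/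
open scoped RealInnerProductSpace

noncomputable def laplacian {n : ℕ} (u : EuclideanSpace ℝ (Fin n) → ℝ)
    (x : EuclideanSpace ℝ (Fin n)) : ℝ :=
  ∑ i : Fin n, fderiv ℝ (fun y => fderiv ℝ u y (EuclideanSpace.single i 1)) x
    (EuclideanSpace.single i 1)

def IsACSolution {n : ℕ} (u : EuclideanSpace ℝ (Fin n) → ℝ) : Prop :=
  ContDiff ℝ 2 u ∧ ∀ x, -laplacian u x = u x - (u x) ^ 3

noncomputable def H (t : ℝ) : ℝ := Real.tanh (t / Real.sqrt 2)
/-- The point `(a, b, c)` of `ℝ³`. -/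
noncomputable def pt (a b c : ℝ) : EuclideanSpace ℝ (Fin 3) :=
  (WithLp.equiv 2 (Fin 3 → ℝ)).symm ![a, b, c]

/-- The `i`-th partial derivative of `u : ℝ³ → ℝ`. -/
noncomputable def pd (u : EuclideanSpace ℝ (Fin 3) → ℝ) (i : Fin 3)
    (x : EuclideanSpace ℝ (Fin 3)) : ℝ :=
  fderiv ℝ u x (EuclideanSpace.single i 1)

open MeasureTheory Filter Topology

abbrev E3 := EuclideanSpace ℝ (Fin 3)

noncomputable def ee (i : Fin 3) : E3 := EuclideanSpace.single i 1

noncomputable def dd (u : E3 → ℝ) (x v : E3) : ℝ :=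
  fderiv ℝ (fun y => fderiv ℝ u y v) x v

lemma lap_eq (u : E3 → ℝ) (x : E3) :
    laplacian u x = dd u x (ee 0) + dd u x (ee 1) + dd u x (ee 2) := by
  unfold laplacian dd ee
  rw [Fin.sum_univ_three]

lemma sdt {f f' : ℝ → ℝ} {d : ℝ} (hm : IsLocalMax f 0) (h1 : ∀ τ, HasDerivAt f (f' τ) τ)
    (h2 : HasDerivAt f' d 0) : f' 0 = 0 ∧ d ≤ 0 := by
  have h0 : f' 0 = 0 := hm.hasDerivAt_eq_zero (h1 0)
  refine ⟨h0, ?_⟩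
  by_contra hd
  push Not at hd
  have hdf : deriv f = f' := funext fun τ => (h1 τ).deriv
  have hmin : IsLocalMin f 0 := by
    apply isLocalMin_of_deriv_deriv_pos
    · rw [hdf, h2.deriv]; exact hd
    · rw [hdf, h0]
    · exact (h1 0).continuousAt
  have hc : f =ᶠ[𝓝 0] fun _ => f 0 := by
    filter_upwards [hm, hmin] with τ a b
    exact le_antisymm a b
  have hc1 : deriv f =ᶠ[𝓝 0] deriv (fun _ => f 0) := hc.deriv
  have hc2 := hc1.deriv_eq
  rw [hdf, h2.deriv] at hc2
  simp at hc2
  linarith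

lemma line_fderiv {u : E3 → ℝ} (hu : Differentiable ℝ u) (x v : E3) (τ : ℝ) :
    HasDerivAt (fun τ : ℝ => u (x + τ • v)) (fderiv ℝ u (x + τ • v) v) τ := by
  have h1 : HasDerivAt (fun τ : ℝ => x + τ • v) v τ := by
    simpa using ((hasDerivAt_id τ).smul_const v).const_add x
  exact (hu (x + τ • v)).hasFDerivAt.comp_hasDerivAt τ h1

lemma cd1 {u : E3 → ℝ} (hu : ContDiff ℝ 2 u) (v : E3) :
    ContDiff ℝ 1 (fun y => fderiv ℝ u y v) :=
  (hu.fderiv_right (m := 1) (by norm_num)).clm_apply contDiff_const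

lemma line_dd {u : E3 → ℝ} (hu : ContDiff ℝ 2 u) (x v : E3) (τ : ℝ) :
    HasDerivAt (fun τ : ℝ => fderiv ℝ u (x + τ • v) v) (dd u (x + τ • v) v) τ :=
  line_fderiv ((cd1 hu v).differentiable (by norm_num)) x v τ

lemma dd_cont {u : E3 → ℝ} (hu : ContDiff ℝ 2 u) (v : E3) : Continuous (fun x => dd u x v) :=
  ((cd1 hu v).continuous_fderiv (by norm_num)).clm_apply continuous_const

lemma dd_smul (u : E3 → ℝ) (hu : ContDiff ℝ 2 u) (x v : E3) (c : ℝ) :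
    dd u x (c • v) = c ^ 2 * dd u x v := by
  unfold dd
  have : (fun y => fderiv ℝ u y (c • v)) = fun y => c • fderiv ℝ u y v := by
    funext y; simp
  rw [this, fderiv_fun_const_smul (((cd1 hu v).differentiable (by norm_num)) x)]
  simp; ring

lemma ee_apply (i j : Fin 3) : ee i j = if j = i then 1 else 0 := by
  simp [ee]

lemma box_max (a b : Fin 3 → ℝ) (Z : E3 → ℝ) (hZ : Continuous Z)
    (hint : ∀ p : E3, (∀ i, a i < p i ∧ p i < b i) → 0 < Z p →
      (∀ i, IsLocalMax (fun τ : ℝ => Z (p + τ • ee i)) 0) → False)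
    (hbd : ∀ p : E3, (∀ i, a i ≤ p i ∧ p i ≤ b i) → (∃ i, p i = a i ∨ p i = b i) → Z p ≤ 0)
    (p : E3) (hp : ∀ i, a i ≤ p i ∧ p i ≤ b i) : Z p ≤ 0 := by
  set S : Set E3 := {x | ∀ i, a i ≤ x i ∧ x i ≤ b i} with hS
  have hcS : IsCompact S := by
    have h1 : IsCompact (Set.Icc a b) := isCompact_Icc
    have h2 := (EuclideanSpace.equiv (Fin 3) ℝ).symm.toHomeomorph.isCompact_image.2 h1
    convert h2 using 1
    ext x
    constructor
    · intro hx
      refine ⟨(EuclideanSpace.equiv (Fin 3) ℝ) x, ⟨fun i => (hx i).1, fun i => (hx i).2⟩, ?_⟩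
      simp
    · rintro ⟨y, hy, rfl⟩ i
      exact ⟨hy.1 i, hy.2 i⟩
  obtain ⟨m, hmS, hm⟩ := hcS.exists_isMaxOn ⟨p, hp⟩ hZ.continuousOn
  refine (hm hp).trans ?_
  by_contra hpos
  push Not at hpos
  by_cases hb : ∃ i, m i = a i ∨ m i = b i
  · exact absurd (hbd m hmS hb) (not_le.2 hpos)
  push Not at hb
  have hmi : ∀ i, a i < m i ∧ m i < b i := fun i =>
    ⟨lt_of_le_of_ne (hmS i).1 (hb i).1.symm, lt_of_le_of_ne (hmS i).2 (hb i).2⟩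
  refine hint m hmi hpos fun i => ?_
  have hO : IsOpen {x : E3 | ∀ i, a i < x i ∧ x i < b i} := by
    have : {x : E3 | ∀ i, a i < x i ∧ x i < b i} = ⋂ i, {x : E3 | a i < x i ∧ x i < b i} := by
      ext; simp
    rw [this]
    refine isOpen_iInter_of_finite fun i => ?_
    have hci : Continuous fun x : E3 => x i := by fun_prop
    exact (isOpen_lt continuous_const hci).inter (isOpen_lt hci continuous_const)
  have hcl : ContinuousAt (fun τ : ℝ => m + τ • ee i) 0 := by fun_prop
  have : ∀ᶠ τ : ℝ in 𝓝 0, (m + τ • ee i) ∈ {x : E3 | ∀ i, a i < x i ∧ x i < b i} := by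
    apply hcl.eventually_mem
    apply hO.mem_nhds
    simpa using hmi
  filter_upwards [this] with τ hτ
  have := hm (show m + τ • ee i ∈ S from fun j => ⟨(hτ j).1.le, (hτ j).2.le⟩)
  simpa using this

/-- Lower bound. -/
lemma lower {u : E3 → ℝ} (hu : IsACSolution u) (c : E3) : -1 ≤ u c := by
  by_contra hlt
  push Not at hlt
  have key : ∀ R : ℝ, 0 < R → (-u c - 1) * R ^ 2 ≤ 3 * R := by
    intro R hR
    set Z : E3 → ℝ := fun x => (-u x - 1) * (R ^ 2 - ‖x - c‖ ^ 2) with hZ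
    have huc : Continuous u := hu.1.continuous
    have hZc : Continuous Z := by fun_prop
    obtain ⟨m, hmS, hm⟩ := (isCompact_closedBall c R).exists_isMaxOn
      ⟨c, Metric.mem_closedBall_self hR.le⟩ hZc.continuousOn
    have hcm : Z c ≤ Z m := hm (Metric.mem_closedBall_self hR.le)
    have hZcv : Z c = (-u c - 1) * R ^ 2 := by simp [hZ]
    rw [← hZcv]
    refine hcm.trans ?_
    have hZcp : 0 < Z c := by
      rw [hZcv]; apply mul_pos; linarith; positivity
    have hZm : 0 < Z m := hZcp.trans_le hcm
    have hq0 : 0 ≤ R ^ 2 - ‖m - c‖ ^ 2 := by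
      have : ‖m - c‖ ≤ R := by simpa [dist_eq_norm] using hmS
      nlinarith [norm_nonneg (m - c)]
    have hq : 0 < R ^ 2 - ‖m - c‖ ^ 2 := by
      rcases hq0.eq_or_lt with h | h
      · simp only [hZ] at hZm; rw [← h] at hZm; simp at hZm
      · exact h
    have hv : 0 < -u m - 1 := by
      by_contra hh
      push Not at hh
      have := mul_nonpos_of_nonpos_of_nonneg hh hq.le
      exact absurd hZm (not_lt.2 this)
    have hball : ‖m - c‖ < R := by
      by_contra hh
      push Not at hh
      nlinarith
    have hloc : ∀ i, IsLocalMax (fun τ : ℝ => Z (m + τ • ee i)) 0 := by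
      intro i
      have hcl : ContinuousAt (fun τ : ℝ => m + τ • ee i) 0 := by fun_prop
      have : ∀ᶠ τ : ℝ in 𝓝 0, (m + τ • ee i) ∈ Metric.ball c R := by
        apply hcl.eventually_mem
        apply Metric.isOpen_ball.mem_nhds
        simpa [dist_eq_norm] using hball
      filter_upwards [this] with τ hτ
      have := hm (Metric.ball_subset_closedBall hτ)
      simpa using this
    set y := m - c with hy
    set q := R ^ 2 - ‖y‖ ^ 2 with hqd
    have hline : ∀ i (τ : ℝ), Z (m + τ • ee i) =
        (-u (m + τ • ee i) - 1) * (q - 2 * τ * y i - τ ^ 2) := by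
      intro i τ
      simp only [hZ]
      congr 1
      have : m + τ • ee i - c = y + τ • ee i := by rw [hy]; abel
      rw [this, hqd, EuclideanSpace.real_norm_sq_eq, EuclideanSpace.real_norm_sq_eq,
        Fin.sum_univ_three, Fin.sum_univ_three]
      fin_cases i <;> simp [ee_apply] <;> ring
    have hder : ∀ i, -(fderiv ℝ u m (ee i)) * q - (-u m - 1) * (2 * y i) = 0 ∧
        -(dd u m (ee i)) * q + 4 * y i * fderiv ℝ u m (ee i) - 2 * (-u m - 1) ≤ 0 := by
      intro i
      have hl := hloc i
      simp only [hline] at hl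
      have hd1 : ∀ τ : ℝ, HasDerivAt (fun τ : ℝ => q - 2 * τ * y i - τ ^ 2) (-2 * y i - 2 * τ) τ := by
        intro τ
        have := ((((hasDerivAt_id τ).const_mul 2).mul_const (y i)).const_sub q).sub
          ((hasDerivAt_id τ).pow 2)
        refine this.congr_deriv ?_
        simp
      have hd2 : HasDerivAt (fun τ : ℝ => -2 * y i - 2 * τ) (-2) 0 := by
        have := ((hasDerivAt_id (0:ℝ)).const_mul 2).const_sub (-2 * y i)
        refine this.congr_deriv ?_
        simp
      have h1 := fun τ => ((line_fderiv (hu.1.differentiable (by norm_num)) m (ee i) τ).neg.sub_const 1).mul (hd1 τ)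
      have h2 := (((line_dd hu.1 m (ee i) 0).neg).mul (hd1 0)).add
        (((line_fderiv (hu.1.differentiable (by norm_num)) m (ee i) 0).neg.sub_const 1).mul hd2)
      have h2' := ((line_dd hu.1 m (ee i) 0).neg).mul (hd1 0)
      have h2'' := (((line_fderiv (hu.1.differentiable (by norm_num)) m (ee i) 0).neg.sub_const 1).mul hd2)
      have := sdt hl h1 (h2'.add h2'')
      simp at this
      constructor <;> nlinarith [this.1, this.2]
    have hL := hu.2 m
    rw [lap_eq] at hL
    have hsum := add_le_add (add_le_add (hder 0).2 (hder 1).2) (hder 2).2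
    have hy2 : ‖y‖ ^ 2 = y 0 ^ 2 + y 1 ^ 2 + y 2 ^ 2 := by
      rw [EuclideanSpace.real_norm_sq_eq, Fin.sum_univ_three]
    set w := -u m - 1 with hw
    have hum : u m = -w - 1 := by rw [hw]; ring
    have e0 : fderiv ℝ u m (ee 0) * q = - w * (2 * y 0) := by linarith [(hder 0).1]
    have e1 : fderiv ℝ u m (ee 1) * q = - w * (2 * y 1) := by linarith [(hder 1).1]
    have e2 : fderiv ℝ u m (ee 2) * q = - w * (2 * y 2) := by linarith [(hder 2).1]
    have hmain : (w * (w + 1) * (w + 2)) * q ^ 2 ≤ 8 * w * ‖y‖ ^ 2 + 6 * w * q := by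
      have h3 : -(dd u m (ee 0) + dd u m (ee 1) + dd u m (ee 2)) = w * (w + 1) * (w + 2) := by
        rw [hL, hum]; ring
      have h4 : (w * (w + 1) * (w + 2)) * q + 4 * (y 0 * fderiv ℝ u m (ee 0)
        + y 1 * fderiv ℝ u m (ee 1) + y 2 * fderiv ℝ u m (ee 2)) - 6 * w ≤ 0 := by
        rw [← h3]; linarith
      have h5 := mul_le_mul_of_nonneg_right h4 hq.le
      have h6 : ((w * (w + 1) * (w + 2)) * q + 4 * (y 0 * fderiv ℝ u m (ee 0)
        + y 1 * fderiv ℝ u m (ee 1) + y 2 * fderiv ℝ u m (ee 2)) - 6 * w) * q =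
        (w * (w + 1) * (w + 2)) * q ^ 2 + 4 * (y 0 * (fderiv ℝ u m (ee 0) * q)
        + y 1 * (fderiv ℝ u m (ee 1) * q) + y 2 * (fderiv ℝ u m (ee 2) * q)) - 6 * w * q := by ring
      rw [h6, e0, e1, e2] at h5
      rw [hy2]; linarith
    have hmain2 : (w + 1) * (w + 2) * q ^ 2 ≤ 8 * ‖y‖ ^ 2 + 6 * q := by
      have : w * ((w + 1) * (w + 2) * q ^ 2) ≤ w * (8 * ‖y‖ ^ 2 + 6 * q) := by linarith
      exact le_of_mul_le_mul_left this hv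
    have h8 : (w * q) ^ 2 ≤ (3 * R) ^ 2 := by
      have : 8 * ‖y‖ ^ 2 + 6 * q ≤ 8 * R ^ 2 := by
        have : ‖y‖ ^ 2 = R ^ 2 - q := by rw [hqd]; ring
        rw [this]; linarith
      nlinarith [mul_pos hv (pow_pos hq 2), pow_pos hq 2, sq_nonneg R]
    exact (le_abs_self _).trans (abs_le_of_sq_le_sq h8 (by positivity))
  have hδ : 0 < -u c - 1 := by linarith
  have := key (4 / (-u c - 1)) (by positivity)
  have h2 : (-u c - 1) * (4 / (-u c - 1)) ^ 2 = 16 / (-u c - 1) := by field_simp; norm_num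
  rw [h2] at this
  have h3 : 3 * (4 / (-u c - 1)) = 12 / (-u c - 1) := by ring
  rw [h3, div_le_div_iff_of_pos_right hδ] at this
  norm_num at this

lemma tanh_mono {x y : ℝ} (h : x ≤ y) : Real.tanh x ≤ Real.tanh y := by
  rw [Real.tanh_eq_sinh_div_cosh, Real.tanh_eq_sinh_div_cosh,
    div_le_div_iff₀ (Real.cosh_pos x) (Real.cosh_pos y)]
  have h1 : Real.sinh (x - y) ≤ 0 := by rw [Real.sinh_nonpos_iff]; linarith
  rw [Real.sinh_sub] at h1
  linarith

lemma cub {a : ℝ} (h1 : -1 ≤ a) (h2 : a ≤ 1) : -1 ≤ a - a ^ 3 ∧ a - a ^ 3 ≤ 1 := by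
  have hs : a ^ 2 ≤ 1 := by nlinarith
  have e : a - a ^ 3 = a * (1 - a ^ 2) := by ring
  have : |a * (1 - a ^ 2)| ≤ 1 := by
    rw [abs_mul]
    exact mul_le_one₀ (abs_le.2 ⟨h1, h2⟩) (abs_nonneg _)
      (abs_le.2 ⟨by linarith, by nlinarith [sq_nonneg a]⟩)
  rw [e]; exact abs_le.1 this

/-- Gradient bound. -/
lemma grad_bd {u : E3 → ℝ} (hu : IsACSolution u) (hup : ∀ x, u x ≤ 1) (i : Fin 3) (c : E3)
    (h : ℝ) (h0 : 0 ≤ h) (h1 : h ≤ 1) : u (c + h • ee i) - u (c - h • ee i) ≤ 12 * h := by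
  have hlo := lower hu
  have huc : Continuous u := hu.1.continuous
  set Z : E3 → ℝ := fun x => u (c + x) - u (c + (x - (2 * x i) • ee i)) -
    (2 * (x 0 ^ 2 + x 1 ^ 2 + x 2 ^ 2) + 12 * x i - 8 * x i ^ 2) with hZ
  have hZc : Continuous Z := by fun_prop
  have hmain := box_max (fun j => if j = i then 0 else -1) (fun _ => 1) Z hZc ?_ ?_ (h • ee i) ?_
  · simp only [hZ] at hmain
    have e1 : h • ee i - (2 * (h • ee i) i) • ee i = - (h • ee i) := by
      have : (h • ee i) i = h := by simp [ee_apply]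
      rw [this, two_mul, add_smul]; abel
    have e2 : (h • ee i) 0 ^ 2 + (h • ee i) 1 ^ 2 + (h • ee i) 2 ^ 2 = h ^ 2 := by
      fin_cases i <;> simp [ee_apply]
    have e3 : (h • ee i) i = h := by simp [ee_apply]
    rw [e1, e2, e3, ← sub_eq_add_neg] at hmain
    nlinarith
  · intro p hp hpos hloc
    set σ : Fin 3 → ℝ := fun j => if j = i then -1 else 1 with hσ
    have hσ2 : ∀ j, σ j ^ 2 = 1 := by intro j; simp only [hσ]; split_ifs <;> norm_num
    set y1 := c + p
    set y2 := c + (p - (2 * p i) • ee i)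
    set b : Fin 3 → ℝ := fun j => 4 * p j + (if j = i then 12 - 16 * p i else 0) with hb
    set k : Fin 3 → ℝ := fun j => if j = i then -6 else 2 with hk
    set ψ0 := 2 * (p 0 ^ 2 + p 1 ^ 2 + p 2 ^ 2) + 12 * p i - 8 * p i ^ 2 with hψ0
    have hline : ∀ j (τ : ℝ), Z (p + τ • ee j) = u (y1 + τ • ee j) - u (y2 + τ • (σ j • ee j))
        - (ψ0 + τ * b j + k j * τ ^ 2) := by
      intro j τ
      simp only [hZ]
      congr 1
      · congr 2
        · simp only [y1]; abel
        · simp only [y2, hσ]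
          by_cases hji : j = i
          · subst hji
            have : (p + τ • ee j) j = p j + τ := by simp [ee_apply]
            rw [this]
            simp only [if_true]
            module
          · have : (p + τ • ee j) i = p i := by simp [ee_apply, Ne.symm hji]
            rw [this]
            simp only [hji, if_false]
            module
      · simp only [hψ0, hb, hk]
        fin_cases i <;> fin_cases j <;> simp [ee_apply] <;> ring
    have hder : ∀ j, dd u y1 (ee j) - dd u y2 (ee j) - 2 * k j ≤ 0 := by
      intro j
      have hl := hloc j
      simp only [hline] at hl
      have hdu : Differentiable ℝ u := hu.1.differentiable (by norm_num)
      have hd1 : ∀ τ : ℝ, HasDerivAt (fun τ : ℝ => ψ0 + τ * b j + k j * τ ^ 2) (b j + k j * (2 * τ)) τ := by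
        intro τ
        have := (((hasDerivAt_id τ).mul_const (b j)).const_add ψ0).add
          (((hasDerivAt_id τ).pow 2).const_mul (k j))
        refine this.congr_deriv ?_
        simp
      have hd2 : HasDerivAt (fun τ : ℝ => b j + k j * (2 * τ)) (2 * k j) 0 := by
        have := (((hasDerivAt_id (0:ℝ)).const_mul 2).const_mul (k j)).const_add (b j)
        refine this.congr_deriv ?_
        simp; ring
      have := (sdt hl (fun τ => ((line_fderiv hdu y1 (ee j) τ).sub
        (line_fderiv hdu y2 (σ j • ee j) τ)).sub (hd1 τ))
        (((line_dd hu.1 y1 (ee j) 0).sub (line_dd hu.1 y2 (σ j • ee j) 0)).sub hd2)).2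
      rw [dd_smul u hu.1, hσ2] at this
      simpa using this
    have hk3 : k 0 + k 1 + k 2 = -2 := by
      simp only [hk]
      rcases (by fin_cases i <;> simp : i = 0 ∨ i = 1 ∨ i = 2) with h | h | h <;>
        simp [h] <;> norm_num
    have hL1 := hu.2 y1
    have hL2 := hu.2 y2
    rw [lap_eq] at hL1 hL2
    have b1 := hder 0
    have b2 := hder 1
    have b3 := hder 2
    have f1 := (cub (hlo y1) (hup y1)).2
    have f2 := (cub (hlo y2) (hup y2)).1
    linarith
  · rintro p hp ⟨j, hj⟩
    simp only [hZ]
    have hi := hp i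
    simp only [if_true] at hi
    by_cases hji : j = i ∧ p i = 0
    · obtain ⟨rfl, h0⟩ := hji
      rw [h0]
      simp
      nlinarith [sq_nonneg (p 0), sq_nonneg (p 1), sq_nonneg (p 2)]
    · have hj1 : p j ^ 2 = 1 := by
        rcases hj with hj | hj
        · by_cases hji2 : j = i
          · exfalso; apply hji; refine ⟨hji2, ?_⟩; rw [if_pos hji2] at hj; rw [← hji2]; exact hj
          · rw [if_neg hji2] at hj; rw [hj]; norm_num
        · rw [hj]; norm_num
      have g1 := hup (c + p)
      have g2 := hlo (c + (p - (2 * p i) • ee i))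
      suffices hs : 2 ≤ 2 * (p 0 ^ 2 + p 1 ^ 2 + p 2 ^ 2) + 12 * p i - 8 * p i ^ 2 by linarith
      by_cases hji2 : j = i
      · subst hji2
        have : p j = 1 := by nlinarith [hi.1]
        nlinarith [sq_nonneg (p 0), sq_nonneg (p 1), sq_nonneg (p 2)]
      · have : p i ^ 2 + p j ^ 2 ≤ p 0 ^ 2 + p 1 ^ 2 + p 2 ^ 2 := by
          fin_cases i <;> fin_cases j <;> simp at hji2 ⊢ <;>
            nlinarith [sq_nonneg (p 0), sq_nonneg (p 1), sq_nonneg (p 2)]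
        nlinarith [hi.1, hi.2]
  · intro j
    by_cases hji : j = i <;> simp [hji, ee_apply, h0, h1]

noncomputable def io (y : ℝ × ℝ) : E3 := pt y.1 y.2 0

def Dk (s : ℝ) : Set (ℝ × ℝ) := {p : ℝ × ℝ | p.1 ^ 2 + p.2 ^ 2 < s ^ 2}

lemma pt_0 (a b c : ℝ) : pt a b c 0 = a := by simp [pt]
lemma pt_1 (a b c : ℝ) : pt a b c 1 = b := by simp [pt]
lemma pt_2 (a b c : ℝ) : pt a b c 2 = c := by simp [pt]

lemma io_cont : Continuous io := by
  unfold io pt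
  refine (PiLp.continuous_toLp 2 _).comp ?_
  refine continuous_pi fun i => ?_
  fin_cases i <;> simp <;> fun_prop

lemma pt_io (a b c : ℝ) : pt a b c = pt 0 0 c + io (a, b) := by
  ext i
  fin_cases i <;> simp [pt, io]

lemma Dk_open (s : ℝ) : IsOpen (Dk s) :=
  isOpen_lt (by fun_prop) continuous_const

lemma Dk_sub {s : ℝ} (hs : 0 ≤ s) : Dk s ⊆ Set.Icc (-s) s ×ˢ Set.Icc (-s) s := by
  intro y hy
  have hy' : y.1 ^ 2 + y.2 ^ 2 < s ^ 2 := hy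
  have h1 : y.1 ^ 2 ≤ s ^ 2 := by nlinarith [sq_nonneg y.2]
  have h2 : y.2 ^ 2 ≤ s ^ 2 := by nlinarith [sq_nonneg y.1]
  exact ⟨abs_le.1 (abs_le_of_sq_le_sq h1 hs), abs_le.1 (abs_le_of_sq_le_sq h2 hs)⟩

lemma Dk_vol {s : ℝ} (hs : 0 ≤ s) : volume (Dk s) ≤ ENNReal.ofReal (4 * s ^ 2) := by
  refine (measure_mono (Dk_sub hs)).trans ?_
  rw [Measure.volume_eq_prod, Measure.prod_prod, Real.volume_Icc,
    ← ENNReal.ofReal_mul (by linarith)]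
  apply ENNReal.ofReal_le_ofReal
  nlinarith

lemma Dk_fin {s : ℝ} (hs : 0 ≤ s) : volume (Dk s) < ⊤ :=
  (Dk_vol hs).trans_lt ENNReal.ofReal_lt_top

lemma Dk_int {s : ℝ} (hs : 0 ≤ s) {f : ℝ × ℝ → ℝ} (hf : Continuous f) :
    IntegrableOn f (Dk s) := by
  have hK : IsCompact (Set.Icc (-s) s ×ˢ Set.Icc (-s) s) := isCompact_Icc.prod isCompact_Icc
  exact (hf.continuousOn.integrableOn_compact hK).mono_set (Dk_sub hs)

lemma param {s : ℝ} (hs : 0 ≤ s) {G G' : E3 → ℝ} (hG : Continuous G) (hG' : Continuous G')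
    (x v : E3) (hd : ∀ x (τ : ℝ), HasDerivAt (fun τ : ℝ => G (x + τ • v)) (G' (x + τ • v)) τ)
    (τ : ℝ) :
    HasDerivAt (fun τ : ℝ => ∫ y in Dk s, G (x + τ • v + io y))
      (∫ y in Dk s, G' (x + τ • v + io y)) τ := by
  have hio := io_cont
  have hK : IsCompact (Metric.closedBall τ 1 ×ˢ (Set.Icc (-s) s ×ˢ Set.Icc (-s) s)) :=
    (isCompact_closedBall τ 1).prod (isCompact_Icc.prod isCompact_Icc)
  have hc : Continuous (fun q : ℝ × (ℝ × ℝ) => G' (x + q.1 • v + io q.2)) := by fun_prop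
  obtain ⟨M, hM⟩ := hK.exists_bound_of_continuousOn hc.continuousOn
  refine (hasDerivAt_integral_of_dominated_loc_of_deriv_le (μ := volume.restrict (Dk s))
    (bound := fun _ => M) (F := fun τ y => G (x + τ • v + io y))
    (F' := fun τ y => G' (x + τ • v + io y))
    (Metric.ball_mem_nhds τ one_pos) ?_ ?_ ?_ ?_ ?_ ?_).2
  · refine Eventually.of_forall fun r => ?_
    have : Continuous fun y => G (x + r • v + io y) := by fun_prop
    exact this.aestronglyMeasurable
  · have : Continuous fun y => G (x + τ • v + io y) := by fun_prop
    exact Dk_int hs this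
  · have : Continuous fun y => G' (x + τ • v + io y) := by fun_prop
    exact this.aestronglyMeasurable
  · refine (ae_restrict_iff' (Dk_open s).measurableSet).2 (Eventually.of_forall fun y hy r hr => ?_)
    exact hM (r, y) ⟨Metric.ball_subset_closedBall hr, Dk_sub hs hy⟩
  · exact Dk_int hs continuous_const
  · refine Eventually.of_forall fun y r _ => ?_
    have := hd (x + io y) r
    have e : ∀ r : ℝ, x + io y + r • v = x + r • v + io y := fun r => by abel
    simpa only [e] using this

lemma transl {g : E3 → ℝ} (hg : Continuous g) (h0 : ∀ x, 0 ≤ g x) {s l : ℝ}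
    (hs : 0 ≤ s) (hl : 0 ≤ l) (p : E3) (hp0 : |p 0| ≤ 2 * l) (hp1 : |p 1| ≤ 2 * l) :
    ∫ y in Dk s, g (p + io y) ≤ ∫ y in Dk (s + 4 * l), g (pt 0 0 (p 2) + io y) := by
  have hio := io_cont
  have hemb : MeasurableEmbedding (fun y : ℝ × ℝ => y + (p 0, p 1)) :=
    measurableEmbedding_addRight (p 0, p 1)
  have h1 := (measurePreserving_add_right (volume : Measure (ℝ × ℝ)) (p 0, p 1)).setIntegral_preimage_emb
    hemb (fun y => g (pt 0 0 (p 2) + io y)) (Dk (s + 4 * l))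
  rw [← h1]
  have e : ∀ y : ℝ × ℝ, pt 0 0 (p 2) + io (y + (p 0, p 1)) = p + io y := by
    intro y
    ext i
    fin_cases i <;> simp [pt, io] <;> ring
  simp only [e]
  apply setIntegral_mono_set
  · have h2 := (measurePreserving_add_right (volume : Measure (ℝ × ℝ)) (p 0, p 1)).integrableOn_comp_preimage
      hemb (f := fun y => g (pt 0 0 (p 2) + io y)) (s := Dk (s + 4 * l))
    have h3 := h2.2 (Dk_int (by linarith) (by fun_prop))
    have e2 : ((fun y => g (pt 0 0 (p 2) + io y)) ∘ fun y : ℝ × ℝ => y + (p 0, p 1)) =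
      fun y => g (p + io y) := by
      funext y; simp [e]
    rw [e2] at h3
    exact h3
  · exact Eventually.of_forall fun y => h0 _
  · refine LE.le.eventuallyLE ?_
    intro y hy
    have hy' : y.1 ^ 2 + y.2 ^ 2 < s ^ 2 := hy
    show (y.1 + p 0) ^ 2 + (y.2 + p 1) ^ 2 < (s + 4 * l) ^ 2
    have a0 : p 0 ^ 2 ≤ 4 * l ^ 2 := by
      have := sq_le_sq' (abs_le.1 hp0).1 (abs_le.1 hp0).2; nlinarith
    have a1 : p 1 ^ 2 ≤ 4 * l ^ 2 := by
      have := sq_le_sq' (abs_le.1 hp1).1 (abs_le.1 hp1).2; nlinarith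
    have hcs : (y.1 * p 0 + y.2 * p 1) ^ 2 ≤ (s * (4 * l)) ^ 2 := by
      have c1 : (y.1 * p 0 + y.2 * p 1) ^ 2 ≤ (y.1 ^ 2 + y.2 ^ 2) * (p 0 ^ 2 + p 1 ^ 2) := by
        nlinarith [sq_nonneg (y.1 * p 1 - y.2 * p 0)]
      have c2 : (y.1 ^ 2 + y.2 ^ 2) * (p 0 ^ 2 + p 1 ^ 2) ≤ s ^ 2 * (16 * l ^ 2) :=
        mul_le_mul hy'.le (by nlinarith [sq_nonneg l]) (by positivity) (by positivity)
      nlinarith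
    have hcs2 := (le_abs_self _).trans (abs_le_of_sq_le_sq hcs (by positivity))
    nlinarith [sq_nonneg l]

lemma main3 {g : E3 → ℝ} (hg : ContDiff ℝ 2 g) (h0 : ∀ x, 0 ≤ g x) (h36 : ∀ x, g x ≤ 36)
    (A : ℝ) (hsub : ∀ x : E3, x 2 ≤ -A →
      2 * g x ≤ dd g x (ee 0) + dd g x (ee 1) + dd g x (ee 2))
    {s : ℝ} (hs : 1 ≤ s) {t : ℝ} (ht : t ≤ -A) :
    ∫ y in Dk s, g (pt 0 0 t + io y) ≤
      (∫ y in Dk (s + 4 * Real.log s), g (pt 0 0 (-A) + io y)) + 576 := by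
  have hs0 : 0 ≤ s := by linarith
  have hio := io_cont
  have hgc := hg.continuous
  set l := Real.log s with hl
  have hl0 : 0 ≤ l := Real.log_nonneg hs
  set Φ : E3 → ℝ := fun x => ∫ y in Dk s, g (x + io y) with hΦ
  set M1 := ∫ y in Dk (s + 4 * l), g (pt 0 0 (-A) + io y) with hM1
  have hM1n : 0 ≤ M1 := integral_nonneg fun y => h0 _
  set M2 : ℝ := 144 * s ^ 2 with hM2
  have hΦM2 : ∀ x, Φ x ≤ M2 := by
    intro x
    have h1 : Φ x ≤ ∫ y in Dk s, (36 : ℝ) :=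
      integral_mono (Dk_int hs0 (by fun_prop)) (Dk_int hs0 continuous_const) fun y => h36 _
    refine h1.trans ?_
    rw [setIntegral_const, smul_eq_mul]
    have : volume.real (Dk s) ≤ 4 * s ^ 2 :=
      ENNReal.toReal_le_of_le_ofReal (by positivity) (Dk_vol hs0)
    linarith
  have hΦc : Continuous Φ := by
    refine continuous_of_dominated (bound := fun _ => (36 : ℝ)) ?_ ?_ ?_ ?_
    · intro x
      have : Continuous fun y => g (x + io y) := by fun_prop
      exact this.aestronglyMeasurable
    · intro x
      refine Eventually.of_forall fun y => ?_
      rw [Real.norm_eq_abs, abs_of_nonneg (h0 _)]; exact h36 _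
    · exact Dk_int hs0 continuous_const
    · refine Eventually.of_forall fun y => ?_
      fun_prop
  set κ := M2 / Real.cosh (2 * l) with hκ
  have hκ0 : 0 ≤ κ := by
    have := Real.cosh_pos (2 * l)
    positivity
  have hκc : κ * Real.cosh (2 * l) = M2 := by
    rw [hκ]; field_simp [(Real.cosh_pos (2 * l)).ne']
  have hκb : 2 * κ ≤ 576 := by
    have hch : s ^ 2 / 2 ≤ Real.cosh (2 * l) := by
      have : Real.exp (2 * l) = s ^ 2 := by
        rw [mul_comm, Real.exp_mul, hl, Real.exp_log (by linarith)]; norm_cast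
      rw [Real.cosh_eq, this]
      have := Real.exp_pos (-(2 * l))
      linarith
    have : κ ≤ 288 := by
      rw [hκ, div_le_iff₀ (Real.cosh_pos _)]
      nlinarith
    linarith
  have key : ∀ ε : ℝ, 0 < ε → Φ (pt 0 0 t) ≤ M1 + 2 * κ + ε * (-A - t) := by
    intro ε hε
    set T := min t (-A - M2 / ε) with hT
    have hT1 : T ≤ t := min_le_left _ _
    have hT2 : M2 ≤ ε * (-A - T) := by
      have : T ≤ -A - M2 / ε := min_le_right _ _
      have h2 : M2 / ε ≤ -A - T := by linarith
      rw [div_le_iff₀ hε] at h2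
      linarith
    set Z : E3 → ℝ := fun x => Φ x -
      (M1 + κ * Real.cosh (x 0) + κ * Real.cosh (x 1) + ε * (-A - x 2)) with hZ
    have hZc : Continuous Z := by
      have := Real.continuous_cosh
      fun_prop
    have hmain := box_max ![-(2 * l), -(2 * l), T] ![2 * l, 2 * l, -A] Z hZc ?_ ?_ (pt 0 0 t) ?_
    · simp only [hZ, pt_0, pt_1, pt_2, Real.cosh_zero] at hmain
      linarith
    · intro p hp hpos hloc
      have hp2 : p 2 < -A := by simpa using (hp 2).2
      have hdg : Differentiable ℝ g := hg.differentiable (by norm_num)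
      have hP1 : ∀ i (τ : ℝ), HasDerivAt (fun τ : ℝ => Φ (p + τ • ee i))
          (∫ y in Dk s, fderiv ℝ g (p + τ • ee i + io y) (ee i)) τ := fun i τ =>
        param hs0 hgc (cd1 hg (ee i)).continuous p (ee i) (fun x τ => line_fderiv hdg x (ee i) τ) τ
      have hP2 : ∀ i (τ : ℝ), HasDerivAt
          (fun τ : ℝ => ∫ y in Dk s, fderiv ℝ g (p + τ • ee i + io y) (ee i))
          (∫ y in Dk s, dd g (p + τ • ee i + io y) (ee i)) τ := fun i τ =>
        param hs0 (cd1 hg (ee i)).continuous (dd_cont hg (ee i)) p (ee i)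
          (fun x τ => line_dd hg x (ee i) τ) τ
      have hch : ∀ a τ : ℝ, HasDerivAt (fun τ : ℝ => κ * Real.cosh (a + τ)) (κ * Real.sinh (a + τ)) τ := by
        intro a τ
        have := (((hasDerivAt_id τ).const_add a).cosh).const_mul κ
        refine this.congr_deriv ?_
        simp
      have hsh : ∀ a τ : ℝ, HasDerivAt (fun τ : ℝ => κ * Real.sinh (a + τ)) (κ * Real.cosh (a + τ)) τ := by
        intro a τ
        have := (((hasDerivAt_id τ).const_add a).sinh).const_mul κ
        refine this.congr_deriv ?_
        simp
      have d0 : (∫ y in Dk s, dd g (p + io y) (ee 0)) - κ * Real.cosh (p 0) ≤ 0 := by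
        have hl0 := hloc 0
        have e : ∀ τ : ℝ, Z (p + τ • ee 0) = Φ (p + τ • ee 0) - (κ * Real.cosh (p 0 + τ) +
          (M1 + κ * Real.cosh (p 1) + ε * (-A - p 2))) := by
          intro τ; simp [hZ, ee_apply]; ring
        simp only [e] at hl0
        have := (sdt hl0 (fun τ => (hP1 0 τ).sub ((hch (p 0) τ).add_const _))
          ((hP2 0 0).sub (hsh (p 0) 0))).2
        simpa using this
      have d1 : (∫ y in Dk s, dd g (p + io y) (ee 1)) - κ * Real.cosh (p 1) ≤ 0 := by
        have hl0 := hloc 1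
        have e : ∀ τ : ℝ, Z (p + τ • ee 1) = Φ (p + τ • ee 1) - (κ * Real.cosh (p 1 + τ) +
          (M1 + κ * Real.cosh (p 0) + ε * (-A - p 2))) := by
          intro τ; simp [hZ, ee_apply]; ring
        simp only [e] at hl0
        have := (sdt hl0 (fun τ => (hP1 1 τ).sub ((hch (p 1) τ).add_const _))
          ((hP2 1 0).sub (hsh (p 1) 0))).2
        simpa using this
      have d2 : (∫ y in Dk s, dd g (p + io y) (ee 2)) ≤ 0 := by
        have hl0 := hloc 2
        have e : ∀ τ : ℝ, Z (p + τ • ee 2) = Φ (p + τ • ee 2) - ((-ε) * τ +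
          (M1 + κ * Real.cosh (p 0) + κ * Real.cosh (p 1) + ε * (-A - p 2))) := by
          intro τ; simp [hZ, ee_apply]; ring
        simp only [e] at hl0
        have hlin : ∀ τ : ℝ, HasDerivAt (fun τ : ℝ => (-ε) * τ) (-ε) τ := by
          intro τ
          simpa using (hasDerivAt_id τ).const_mul (-ε)
        have := (sdt hl0 (fun τ => (hP1 2 τ).sub ((hlin τ).add_const _))
          ((hP2 2 0).sub_const (-ε))).2
        simpa using this
      have hI : ∀ i, IntegrableOn (fun y => dd g (p + io y) (ee i)) (Dk s) := by
        intro i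
        have := dd_cont hg (ee i)
        exact Dk_int hs0 (by fun_prop)
      have hlap : 2 * Φ p ≤ (∫ y in Dk s, dd g (p + io y) (ee 0)) +
          (∫ y in Dk s, dd g (p + io y) (ee 1)) + ∫ y in Dk s, dd g (p + io y) (ee 2) := by
        have h01 : IntegrableOn (fun y => dd g (p + io y) (ee 0) + dd g (p + io y) (ee 1)) (Dk s) :=
          (hI 0).add (hI 1)
        rw [← integral_add (hI 0) (hI 1), ← integral_add h01 (hI 2),
          ← integral_const_mul]
        refine integral_mono (Dk_int hs0 (by fun_prop)) (h01.add (hI 2)) fun y => ?_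
        have := hsub (p + io y) (by simp [io, pt_2]; exact hp2.le)
        simpa using this
      simp only [hZ] at hpos
      have : 0 ≤ ε * (-A - p 2) := mul_nonneg hε.le (by linarith)
      have hc0 := mul_nonneg hκ0 (Real.cosh_pos (p 0)).le
      have hc1 := mul_nonneg hκ0 (Real.cosh_pos (p 1)).le
      linarith
    · intro p hp hb
      have q0 : -(2 * l) ≤ p 0 ∧ p 0 ≤ 2 * l := by simpa using hp 0
      have q1 : -(2 * l) ≤ p 1 ∧ p 1 ≤ 2 * l := by simpa using hp 1
      have q2 : T ≤ p 2 ∧ p 2 ≤ -A := by simpa using hp 2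
      have hc0 := mul_nonneg hκ0 (Real.cosh_pos (p 0)).le
      have hc1 := mul_nonneg hκ0 (Real.cosh_pos (p 1)).le
      have hε2 : 0 ≤ ε * (-A - p 2) := mul_nonneg hε.le (by linarith)
      have hM := hΦM2 p
      simp only [hZ]
      obtain ⟨i, hi⟩ := hb
      rcases (by fin_cases i <;> simp : i = 0 ∨ i = 1 ∨ i = 2) with rfl | rfl | rfl
      · have : Real.cosh (p 0) = Real.cosh (2 * l) := by
          rcases hi with hi | hi
          · have : p 0 = -(2 * l) := by simpa using hi
            rw [this, Real.cosh_neg]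
          · have : p 0 = 2 * l := by simpa using hi
            rw [this]
        rw [this, hκc]; linarith
      · have : Real.cosh (p 1) = Real.cosh (2 * l) := by
          rcases hi with hi | hi
          · have : p 1 = -(2 * l) := by simpa using hi
            rw [this, Real.cosh_neg]
          · have : p 1 = 2 * l := by simpa using hi
            rw [this]
        rw [this, hκc]; linarith
      · rcases hi with hi | hi
        · have : p 2 = T := by simpa using hi
          rw [this] at hε2 ⊢
          linarith
        · have h2 : p 2 = -A := by simpa using hi
          have := transl hgc h0 hs0 hl0 p (abs_le.2 q0) (abs_le.2 q1)
          rw [h2] at this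
          have h3 : Φ p ≤ M1 := this
          linarith
    · intro i
      fin_cases i
      · simp [pt_0, hl0]
      · simp [pt_1, hl0]
      · simp [pt_2, hT1, ht]
  have hfin : Φ (pt 0 0 t) ≤ M1 + 2 * κ := by
    refine le_of_forall_pos_le_add fun δ hδ => ?_
    have hpos : 0 < -A - t + 1 := by linarith
    have := key (δ / (-A - t + 1)) (by positivity)
    have h2 : δ / (-A - t + 1) * (-A - t) ≤ δ := by
      rw [div_mul_eq_mul_div, div_le_iff₀ hpos]; nlinarith
    linarith
  have : Φ (pt 0 0 t) ≤ M1 + 576 := by linarith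
  exact this

lemma dd_of_line {g : E3 → ℝ} (hg : ContDiff ℝ 2 g) (x v : E3) {f' : ℝ → ℝ} {d : ℝ}
    (h1 : ∀ τ : ℝ, HasDerivAt (fun τ : ℝ => g (x + τ • v)) (f' τ) τ) (h2 : HasDerivAt f' d 0) :
    dd g x v = d := by
  have e : f' = fun τ : ℝ => fderiv ℝ g (x + τ • v) v := funext fun τ =>
    (h1 τ).unique (line_fderiv (hg.differentiable (by norm_num)) x v τ)
  have h3 := line_dd hg x v 0
  rw [← e] at h3
  simpa using h3.unique h2

lemma dd_sq {W : E3 → ℝ} (hW : ContDiff ℝ 2 W) (h : ℝ) (x v : E3) :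
    dd (fun x => (W x / h) ^ 2) x v =
      2 * (fderiv ℝ W x v / h) ^ 2 + 2 * (W x / h) * (dd W x v / h) := by
  have hdW : Differentiable ℝ W := hW.differentiable (by norm_num)
  refine dd_of_line (f' := fun τ : ℝ => 2 * (W (x + τ • v) / h) * (fderiv ℝ W (x + τ • v) v / h))
    ((hW.div_const h).pow 2) x v ?_ ?_
  · intro τ
    have := ((line_fderiv hdW x v τ).div_const h).pow 2
    refine this.congr_deriv ?_
    simp
  · have := ((((line_fderiv hdW x v 0).div_const h).const_mul 2).mul
      ((line_dd hW x v 0).div_const h))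
    refine this.congr_deriv ?_
    simp
    ring

lemma dd_diff {u : E3 → ℝ} (hu : ContDiff ℝ 2 u) (a x v : E3) :
    dd (fun x => u (x + a) - u x) x v = dd u (x + a) v - dd u x v := by
  have hdu : Differentiable ℝ u := hu.differentiable (by norm_num)
  have e : ∀ τ : ℝ, x + τ • v + a = (x + a) + τ • v := fun τ => by abel
  have hC : ContDiff ℝ 2 (fun x => u (x + a) - u x) :=
    (hu.comp (contDiff_id.add contDiff_const)).sub hu
  refine dd_of_line (f' := fun τ : ℝ => fderiv ℝ u ((x + a) + τ • v) v - fderiv ℝ u (x + τ • v) v)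
    hC x v ?_ ?_
  · intro τ
    simp only [e]
    exact (line_fderiv hdu (x + a) v τ).sub (line_fderiv hdu x v τ)
  · have := (line_dd hu (x + a) v 0).sub (line_dd hu x v 0)
    refine this.congr_deriv ?_
    simp

lemma neg_sol {u : E3 → ℝ} (hu : IsACSolution u) : IsACSolution (fun x => - u x) := by
  refine ⟨hu.1.neg, fun x => ?_⟩
  have := hu.2 x
  have e : laplacian (fun x => - u x) x = - laplacian u x := by
    unfold laplacian
    rw [← Finset.sum_neg_distrib]
    refine Finset.sum_congr rfl fun i _ => ?_
    have : (fun y => fderiv ℝ (fun x => - u x) y (EuclideanSpace.single i 1)) =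
      fun y => - fderiv ℝ u y (EuclideanSpace.single i 1) := by
      funext y; simp [fderiv_fun_neg]
    rw [this, fderiv_fun_neg]; simp
  rw [e]
  linear_combination - this

lemma lip {u : E3 → ℝ} (hu : IsACSolution u) (hup : ∀ x, u x ≤ 1) (i : Fin 3) (x : E3)
    {h : ℝ} (h0 : 0 < h) (h1 : h ≤ 1) : ((u (x + h • ee i) - u x) / h) ^ 2 ≤ 36 := by
  have e1 : x + (h / 2) • ee i + (h / 2) • ee i = x + h • ee i := by module
  have e2 : x + (h / 2) • ee i - (h / 2) • ee i = x := by abel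
  have a1 := grad_bd hu hup i (x + (h / 2) • ee i) (h / 2) (by linarith) (by linarith)
  have a2 := grad_bd (neg_sol hu) (fun x => by linarith [lower hu x]) i (x + (h / 2) • ee i)
    (h / 2) (by linarith) (by linarith)
  rw [e1, e2] at a1 a2
  rw [div_pow, div_le_iff₀ (by positivity)]
  have : (u (x + h • ee i) - u x) ^ 2 ≤ (6 * h) ^ 2 := sq_le_sq' (by linarith) (by linarith)
  linarith

lemma one_dir {u : E3 → ℝ} (hu : IsACSolution u) (hH : ∀ x : E3, u x ≤ H (x 2))
    (A : ℝ) (htanh : Real.sqrt (2 / 3) ≤ Real.tanh (A / Real.sqrt 2))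
    (i : Fin 3) (hi : i ≠ 2) {s : ℝ} (hs : 1 ≤ s) {t : ℝ} (ht : t ≤ -A) :
    ∫ y in Dk s, (pd u i (pt 0 0 t + io y)) ^ 2 ≤
      (∫ y in Dk (s + 4 * Real.log s), (pd u i (pt 0 0 (-A) + io y)) ^ 2) + 576 := by
  have hio := io_cont
  have huc := hu.1.continuous
  have hup : ∀ x, u x ≤ 1 := fun x => (hH x).trans (Real.tanh_lt_one _).le
  have hs0 : 0 ≤ s := by linarith
  have hl0 : 0 ≤ Real.log s := Real.log_nonneg hs
  have hlow : ∀ x : E3, x 2 ≤ -A → u x ≤ -Real.sqrt (2 / 3) := by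
    intro x hx
    refine (hH x).trans ?_
    have h2 : 0 < Real.sqrt 2 := by positivity
    have : H (x 2) ≤ Real.tanh (-(A / Real.sqrt 2)) := by
      apply tanh_mono
      rw [← neg_div]
      gcongr
    rw [Real.tanh_neg] at this
    linarith
  have hsq : Real.sqrt (2 / 3) ^ 2 = 2 / 3 := Real.sq_sqrt (by norm_num)
  have hsqp : 0 ≤ Real.sqrt (2 / 3) := Real.sqrt_nonneg _
  have hstep : ∀ h : ℝ, 0 < h → h ≤ 1 →
      ∫ y in Dk s, ((u (pt 0 0 t + io y + h • ee i) - u (pt 0 0 t + io y)) / h) ^ 2 ≤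
      (∫ y in Dk (s + 4 * Real.log s),
        ((u (pt 0 0 (-A) + io y + h • ee i) - u (pt 0 0 (-A) + io y)) / h) ^ 2) + 576 := by
    intro h hp h1
    have hC : ContDiff ℝ 2 (fun x => u (x + h • ee i) - u x) :=
      (hu.1.comp (contDiff_id.add contDiff_const)).sub hu.1
    refine main3 (g := fun x => ((u (x + h • ee i) - u x) / h) ^ 2) ((hC.div_const h).pow 2)
      (fun x => sq_nonneg _) (fun x => lip hu hup i x hp h1) A ?_ hs ht
    intro x hx
    have k0 := dd_sq hC h x (ee 0)
    have k1 := dd_sq hC h x (ee 1)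
    have k2 := dd_sq hC h x (ee 2)
    rw [dd_diff hu.1] at k0 k1 k2
    rw [k0, k1, k2]
    have L1 := hu.2 (x + h • ee i)
    have L0 := hu.2 x
    rw [lap_eq] at L1 L0
    have hx' : (x + h • ee i) 2 ≤ -A := by
      simp [ee_apply, hi.symm]; exact hx
    have b1 := hlow _ hx'
    have b0 := hlow _ hx
    set p := u (x + h • ee i)
    set q := u x
    have hc : 2 ≤ p ^ 2 + p * q + q ^ 2 := by
      nlinarith [mul_nonneg (show 0 ≤ -p - Real.sqrt (2/3) by linarith) hsqp,
        mul_nonneg (show 0 ≤ -q - Real.sqrt (2/3) by linarith) hsqp,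
        mul_nonneg (show 0 ≤ -p - Real.sqrt (2/3) by linarith) (show 0 ≤ -q - Real.sqrt (2/3) by linarith),
        sq_nonneg (p + Real.sqrt (2/3)), sq_nonneg (q + Real.sqrt (2/3))]
    have hsum : 2 * ((p - q) / h) * ((dd u (x + h • ee i) (ee 0) - dd u x (ee 0)) / h) +
        2 * ((p - q) / h) * ((dd u (x + h • ee i) (ee 1) - dd u x (ee 1)) / h) +
        2 * ((p - q) / h) * ((dd u (x + h • ee i) (ee 2) - dd u x (ee 2)) / h) =
        2 * ((p - q) / h) ^ 2 * (p ^ 2 + p * q + q ^ 2 - 1) := by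
      have : dd u (x + h • ee i) (ee 0) - dd u x (ee 0) + (dd u (x + h • ee i) (ee 1) - dd u x (ee 1))
        + (dd u (x + h • ee i) (ee 2) - dd u x (ee 2)) = (p - q) * (p ^ 2 + p * q + q ^ 2 - 1) := by
        linear_combination L0 - L1
      linear_combination (2 * ((p - q) / h) / h) * this
    have hge : 2 * ((p - q) / h) ^ 2 ≤ 2 * ((p - q) / h) ^ 2 * (p ^ 2 + p * q + q ^ 2 - 1) :=
      le_mul_of_one_le_right (by positivity) (by linarith)
    have n0 := sq_nonneg (fderiv ℝ (fun x => u (x + h • ee i) - u x) x (ee 0) / h)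
    have n1 := sq_nonneg (fderiv ℝ (fun x => u (x + h • ee i) - u x) x (ee 1) / h)
    have n2 := sq_nonneg (fderiv ℝ (fun x => u (x + h • ee i) - u x) x (ee 2) / h)
    show 2 * ((p - q) / h) ^ 2 ≤ _
    linarith
  have hlim : ∀ r : ℝ, 0 ≤ r → ∀ z : E3, Tendsto (fun n : ℕ => ∫ y in Dk r,
      ((u (z + io y + (1 / ((n : ℝ) + 1)) • ee i) - u (z + io y)) / (1 / ((n : ℝ) + 1))) ^ 2) atTop
      (𝓝 (∫ y in Dk r, (pd u i (z + io y)) ^ 2)) := by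
    intro r hr z
    refine tendsto_integral_of_dominated_convergence (fun _ => (36 : ℝ)) ?_ ?_ ?_ ?_
    · intro n
      have : Continuous fun y => ((u (z + io y + (1 / ((n : ℝ) + 1)) • ee i) - u (z + io y)) /
        (1 / ((n : ℝ) + 1))) ^ 2 := by fun_prop
      exact this.aestronglyMeasurable
    · exact Dk_int hr continuous_const
    · intro n
      refine Eventually.of_forall fun y => ?_
      rw [Real.norm_eq_abs, abs_of_nonneg (sq_nonneg _)]
      refine lip hu hup i _ (by positivity) ?_
      rw [div_le_one (by positivity)]
      linarith [(Nat.cast_nonneg n : (0 : ℝ) ≤ n)]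
    · refine Eventually.of_forall fun y => ?_
      have hd := (line_fderiv (hu.1.differentiable (by norm_num)) (z + io y) (ee i) 0).tendsto_slope_zero
      have hn : Tendsto (fun n : ℕ => 1 / ((n : ℝ) + 1)) atTop (𝓝[≠] 0) := by
        refine tendsto_nhdsWithin_iff.2 ⟨tendsto_one_div_add_atTop_nhds_zero_nat, ?_⟩
        refine Eventually.of_forall fun n => ?_
        have : (0 : ℝ) < 1 / ((n : ℝ) + 1) := by positivity
        exact this.ne'
      have := (hd.comp hn).pow 2
      simp only [zero_smul, add_zero, zero_add, Function.comp_def, smul_eq_mul] at this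
      refine this.congr fun n => ?_
      rw [mul_comm, ← div_eq_mul_inv]
  refine le_of_tendsto_of_tendsto' (hlim s hs0 (pt 0 0 t))
    ((hlim (s + 4 * Real.log s) (by linarith) (pt 0 0 (-A))).add_const 576) fun n => ?_
  refine hstep _ (by positivity) ?_
  rw [div_le_one (by positivity)]
  linarith [(Nat.cast_nonneg n : (0 : ℝ) ≤ n)]

theorem horizontal_energy_bound (u : EuclideanSpace ℝ (Fin 3) → ℝ)
    (hu : IsACSolution u) (hnc : ¬ ∃ c : ℝ, ∀ x, u x = c)
    (hneg : ∀ x : EuclideanSpace ℝ (Fin 3), x 2 < 0 → u x < 0)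
    (hH : ∀ x : EuclideanSpace ℝ (Fin 3), u x ≤ H (x 2))
    (A : ℝ) (hA : 0 < A) (htanh : Real.sqrt (2 / 3) ≤ Real.tanh (A / Real.sqrt 2))
    (K : ℝ → ℝ → ℝ)
    (hK : ∀ s t : ℝ, K s t = ∫ p in {p : ℝ × ℝ | p.1 ^ 2 + p.2 ^ 2 < s ^ 2},
      ((pd u 0 (pt p.1 p.2 t)) ^ 2 + (pd u 1 (pt p.1 p.2 t)) ^ 2)) :
    ∃ C : ℝ, 0 < C ∧ ∃ β : ℝ, 0 < β ∧
      ∀ s : ℝ, 1 ≤ s → ∀ t : ℝ, t ≤ -A →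
        K s t ≤ C * (1 + K (s + β * Real.log s) (-A)) := by
  have hio := io_cont
  have hKs : ∀ s t : ℝ, 0 ≤ s → K s t = (∫ y in Dk s, (pd u 0 (pt 0 0 t + io y)) ^ 2) +
      ∫ y in Dk s, (pd u 1 (pt 0 0 t + io y)) ^ 2 := by
    intro s t hs
    have hc : ∀ i, Continuous fun y => (pd u i (pt 0 0 t + io y)) ^ 2 := by
      intro i
      have : Continuous (pd u i) := (cd1 hu.1 (ee i)).continuous
      fun_prop
    rw [hK, ← integral_add (Dk_int hs (hc 0)) (Dk_int hs (hc 1))]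
    refine setIntegral_congr_fun (Dk_open s).measurableSet fun y _ => ?_
    simp only [pt_io y.1 y.2 t]
  refine ⟨1152, by norm_num, 4, by norm_num, fun s hs t ht => ?_⟩
  have hl0 : 0 ≤ Real.log s := Real.log_nonneg hs
  have d0 := one_dir hu hH A htanh 0 (by decide) hs ht
  have d1 := one_dir hu hH A htanh 1 (by decide) hs ht
  have hn : 0 ≤ K (s + 4 * Real.log s) (-A) := by
    rw [hK]
    exact integral_nonneg fun y => by positivity
  have h1 := hKs s t (by linarith)
  have h2 := hKs (s + 4 * Real.log s) (-A) (by linarith)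
  linarith
end

section
/- Let u be a non-constant solution of the Allen–Cahn equation −Δu = u − u³ on ℝ³ with u(x) < 0 whenever x₃ < 0 and with u(x) ≤ H(x₃) for all x ∈ ℝ³. Let A > 0 satisfy tanh(A/√2) ≥ √(2/3). For s > 0 define g(s) = ∫_{x₁²+x₂²<s²} ( |∇u(x₁,x₂,−A)|²/2 + (1 − u(x₁,x₂,−A)²)²/4 − (∂₃u(x₁,x₂,−A))² ) dx₁ dx₂. Then g(s) → 0 as s → +∞. -/
open scoped RealInnerProductSpace

section helpers

open Filter Topology

theorem second_deriv_touch {f w f1 w1 : ℝ → ℝ} {f2 w2 : ℝ}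
    (hle : ∀ᶠ t in 𝓝 (0:ℝ), f t ≤ w t) (h0 : w 0 = f 0)
    (hf1 : ∀ᶠ t in 𝓝 (0:ℝ), HasDerivAt f (f1 t) t) (hf2 : HasDerivAt f1 f2 0)
    (hw1 : ∀ᶠ t in 𝓝 (0:ℝ), HasDerivAt w (w1 t) t) (hw2 : HasDerivAt w1 w2 0) :
    f2 ≤ w2 := by
  by_contra hlt
  push Not at hlt
  set q : ℝ → ℝ := fun t => f t - w t with hq
  have hq1 : ∀ᶠ t in 𝓝 (0:ℝ), HasDerivAt q (f1 t - w1 t) t := by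
    filter_upwards [hf1, hw1] with t a b using a.sub b
  have hdq : deriv q =ᶠ[𝓝 0] fun t => f1 t - w1 t := by
    filter_upwards [hq1] with t a using a.deriv
  have hdd : HasDerivAt (deriv q) (f2 - w2) 0 :=
    (hf2.sub hw2).congr_of_eventuallyEq hdq
  have hq0 : q 0 = 0 := by simp [hq, h0]
  have hmax : IsLocalMax q 0 := by
    filter_upwards [hle] with t ht
    rw [hq0]; simp only [hq]; linarith
  have hd0 : deriv q 0 = 0 := hmax.deriv_eq_zero
  have hmin : IsLocalMin q 0 :=
    isLocalMin_of_deriv_deriv_pos (by rw [hdd.deriv]; linarith) hd0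
      hq1.self_of_nhds.continuousAt
  have hconst : q =ᶠ[𝓝 0] fun _ => (0:ℝ) := by
    filter_upwards [hmax, hmin] with t a b
    rw [hq0] at a b; linarith
  have h3 : deriv q =ᶠ[𝓝 0] fun _ => (0:ℝ) := by
    have := hconst.deriv
    simpa using this
  have h4 : deriv (deriv q) 0 = 0 := by
    rw [h3.deriv_eq]; simp
  rw [hdd.deriv] at h4
  linarith

theorem hasDerivAt_line (x v : EuclideanSpace ℝ (Fin 3)) (t : ℝ) :
    HasDerivAt (fun t : ℝ => x + t • v) v t := by
  simpa using ((hasDerivAt_id t).smul_const v).const_add x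

theorem touch {f : EuclideanSpace ℝ (Fin 3) → ℝ} (hf : ContDiff ℝ 2 f)
    (x : EuclideanSpace ℝ (Fin 3)) (w w1 : Fin 3 → ℝ → ℝ) (w2 : Fin 3 → ℝ)
    (hle : ∀ i, ∀ᶠ t in 𝓝 (0:ℝ), f (x + t • EuclideanSpace.single i (1:ℝ)) ≤ w i t)
    (h0 : ∀ i, w i 0 = f x)
    (h1 : ∀ i, ∀ᶠ t in 𝓝 (0:ℝ), HasDerivAt (w i) (w1 i t) t)
    (h2 : ∀ i, HasDerivAt (w1 i) (w2 i) 0) :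
    laplacian f x ≤ w2 0 + w2 1 + w2 2 := by
  have key : ∀ i : Fin 3, fderiv ℝ (fun y => fderiv ℝ f y (EuclideanSpace.single i 1)) x
      (EuclideanSpace.single i 1) ≤ w2 i := by
    intro i
    have hd : Differentiable ℝ f := hf.differentiable (by norm_num)
    have hd2 : Differentiable ℝ (fun y => fderiv ℝ f y (EuclideanSpace.single i (1:ℝ))) := by
      have : ContDiff ℝ 1 (fderiv ℝ f) := hf.fderiv_right (by norm_num)
      exact (this.differentiable (by norm_num)).clm_apply (differentiable_const _)
    refine second_deriv_touch (f := fun t : ℝ => f (x + t • EuclideanSpace.single i (1:ℝ)))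
      (f1 := fun t : ℝ => fderiv ℝ f (x + t • EuclideanSpace.single i (1:ℝ))
        (EuclideanSpace.single i (1:ℝ))) (hle i) (by simpa using h0 i) ?_ ?_ (h1 i) (h2 i)
    · refine Eventually.of_forall fun t => ?_
      exact (hd _).hasFDerivAt.comp_hasDerivAt t (hasDerivAt_line x _ t)
    · have := (hd2 (x + (0:ℝ) • EuclideanSpace.single i (1:ℝ))).hasFDerivAt.comp_hasDerivAt
        (0:ℝ) (hasDerivAt_line x (EuclideanSpace.single i (1:ℝ)) 0)
      simpa [Function.comp_def] using this
  unfold laplacian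
  rw [Fin.sum_univ_three]
  linarith [key 0, key 1, key 2]

theorem H_eq (t : ℝ) : H t = 1 - 2 / (Real.exp (Real.sqrt 2 * t) + 1) := by
  have h2 : Real.sqrt 2 * t = 2 * (t / Real.sqrt 2) := by
    have : Real.sqrt 2 * Real.sqrt 2 = 2 := Real.mul_self_sqrt (by norm_num)
    field_simp
    rw [sq, this]; ring
  rw [h2, H, Real.tanh_eq]
  set a := t / Real.sqrt 2
  have : Real.exp (2 * a) = Real.exp a * Real.exp a := by rw [← Real.exp_add]; ring_nf
  rw [this, Real.exp_neg]
  have := Real.exp_pos a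
  field_simp
  ring

theorem H_lt_one (t : ℝ) : H t < 1 := by
  rw [H_eq]; have := Real.exp_pos (Real.sqrt 2 * t)
  have : 0 < 2 / (Real.exp (Real.sqrt 2 * t) + 1) := by positivity
  linarith

theorem neg_one_lt_H (t : ℝ) : -1 < H t := by
  rw [H_eq]; have := Real.exp_pos (Real.sqrt 2 * t)
  have : 2 / (Real.exp (Real.sqrt 2 * t) + 1) < 2 := by
    rw [div_lt_iff₀ (by positivity)]; linarith
  linarith

theorem H_hasDerivAt (t : ℝ) : HasDerivAt H ((1 - H t ^ 2) / Real.sqrt 2) t := by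
  have h : HasDerivAt (fun t => 1 - 2 / (Real.exp (Real.sqrt 2 * t) + 1))
      (-((0 * (Real.exp (Real.sqrt 2 * t) + 1) - 2 * (Real.exp (Real.sqrt 2 * t) * (Real.sqrt 2 * 1))) /
        (Real.exp (Real.sqrt 2 * t) + 1) ^ 2)) t := by
    refine HasDerivAt.const_sub 1 ?_
    refine HasDerivAt.div (hasDerivAt_const t (2:ℝ)) ?_ (by positivity)
    exact (((hasDerivAt_id t).const_mul (Real.sqrt 2)).exp).add_const 1
  have he : H = fun t => 1 - 2 / (Real.exp (Real.sqrt 2 * t) + 1) := funext H_eq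
  rw [he]
  convert h using 1
  clear h he
  beta_reduce
  have h2 : Real.sqrt 2 * Real.sqrt 2 = 2 := Real.mul_self_sqrt (by norm_num)
  have : 0 < Real.sqrt 2 := by positivity
  have := Real.exp_pos (Real.sqrt 2 * t)
  generalize Real.exp (Real.sqrt 2 * t) = a at *
  field_simp
  have h3 : Real.sqrt 2 ^ 2 = 2 := by rw [sq]; exact h2
  linear_combination (-2 * a) * h3

theorem H_cont : Continuous H :=
  continuous_iff_continuousAt.2 fun t => (H_hasDerivAt t).continuousAt

theorem H_strictMono : StrictMono H := by
  refine strictMono_of_deriv_pos fun t => ?_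
  rw [(H_hasDerivAt t).deriv]
  have := H_lt_one t
  have := neg_one_lt_H t
  have : 0 < 1 - H t ^ 2 := by nlinarith
  positivity

theorem H_lip {a b : ℝ} (h : a ≤ b) : H b - H a ≤ b - a := by
  have hm : Monotone fun t => t - H t := by
    refine monotone_of_deriv_nonneg
      (fun t => ((hasDerivAt_id t).sub (H_hasDerivAt t)).differentiableAt) fun t => ?_
    have := ((hasDerivAt_id t).sub (H_hasDerivAt t)).deriv
    simp only [Pi.sub_def, id] at this
    rw [this]
    have h2 : 1 ≤ Real.sqrt 2 := by rw [Real.one_le_sqrt]; norm_num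
    have : (1 - H t ^ 2) / Real.sqrt 2 ≤ 1 := by
      rw [div_le_one (by positivity)]; nlinarith [sq_nonneg (H t)]
    linarith
  have := hm h
  simp only at this
  linarith

theorem H_neg (t : ℝ) : H (-t) = - H t := by
  simp [H, neg_div, Real.tanh_neg]

theorem H_zero : H 0 = 0 := by simp [H]

theorem sqrt2_H {t : ℝ} (ht : 7 / 2 ≤ t) : 1 ≤ Real.sqrt 2 * H t := by
  have h1 : (1.414:ℝ) ≤ Real.sqrt 2 := Real.le_sqrt_of_sq_le (by norm_num)
  have h2 : (0.71:ℝ) ≤ H t := by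
    rw [H_eq]
    have := Real.add_one_le_exp (Real.sqrt 2 * t)
    have h3 : (5.9:ℝ) ≤ Real.exp (Real.sqrt 2 * t) := by nlinarith
    have : 2 / (Real.exp (Real.sqrt 2 * t) + 1) ≤ 0.29 := by
      rw [div_le_iff₀ (by positivity)]; linarith
    linarith
  nlinarith

theorem quadDeriv (η d t : ℝ) : HasDerivAt (fun t : ℝ => η - 2 * t * d - t ^ 2)
    (-(2 * d) - 2 * t) t := by
  have := (((hasDerivAt_id' t).const_mul 2).mul_const d).const_sub η
  have := this.fun_sub ((hasDerivAt_id' t).fun_pow 2)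
  refine this.congr_deriv ?_
  norm_num

set_option maxHeartbeats 1000000 in
/-- If `u` lies below `-1`, then it is `-1` (Keller–Osserman). -/
theorem keller_osserman (u : EuclideanSpace ℝ (Fin 3) → ℝ) (hu : IsACSolution u)
    (hle : ∀ x, u x ≤ -1) (x₀ : EuclideanSpace ℝ (Fin 3)) : u x₀ = -1 := by
  by_contra hne
  have hlt : u x₀ < -1 := lt_of_le_of_ne (hle x₀) hne
  set R : ℝ := 3 / (-1 - u x₀) + 1 with hR
  have hwpos : 0 < -1 - u x₀ := by linarith
  have hRpos : 0 < R := by positivity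
  have hRw : 3 < (-1 - u x₀) * R := by
    rw [hR, mul_add, mul_div_cancel₀ _ hwpos.ne']; linarith
  let N : EuclideanSpace ℝ (Fin 3) → ℝ := fun x =>
    (x 0 - x₀ 0) ^ 2 + (x 1 - x₀ 1) ^ 2 + (x 2 - x₀ 2) ^ 2
  have hN : ∀ x, N x = dist x x₀ ^ 2 := by
    intro x
    rw [EuclideanSpace.dist_eq, Real.sq_sqrt (by positivity), Fin.sum_univ_three]
    simp [N, Real.dist_eq, sq_abs]
  have hNc : Continuous N := by fun_prop
  obtain ⟨x, hx, hxmax⟩ := (isCompact_closedBall x₀ R).exists_isMaxOn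
    ⟨x₀, Metric.mem_closedBall_self hRpos.le⟩
    (f := fun x => (-1 - u x) * (R ^ 2 - N x))
    (by have := hu.1.continuous; fun_prop)
  have hM0 := hxmax (Metric.mem_closedBall_self hRpos.le)
  simp only [Set.mem_ofPred_eq] at hM0
  have hN0 : N x₀ = 0 := by simp [N]
  rw [hN0] at hM0
  set K := (-1 - u x) * (R ^ 2 - N x) with hK
  have hK3 : 3 * R < K := by nlinarith
  have hNx0 : 0 ≤ N x := by rw [hN]; positivity
  have hη : 0 < R ^ 2 - N x := by
    by_contra h
    push Not at h
    have := hle x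
    nlinarith
  set η := R ^ 2 - N x with hηd
  have hmaxle : ∀ y, N y < R ^ 2 → -u y ≤ 1 + K / (R ^ 2 - N y) := by
    intro y hy
    have hyb : y ∈ Metric.closedBall x₀ R := by
      rw [Metric.mem_closedBall]
      rw [hN] at hy
      exact (le_abs_self _).trans (abs_le_of_sq_le_sq hy.le hRpos.le)
    have h := hxmax hyb
    simp only [Set.mem_ofPred_eq] at h
    have : -1 - u y ≤ K / (R ^ 2 - N y) := by
      rw [le_div_iff₀ (by linarith)]; exact h
    linarith
  have hNl : ∀ (i : Fin 3) (t : ℝ), N (x + t • EuclideanSpace.single i (1:ℝ))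
      = N x + 2 * t * (x i - x₀ i) + t ^ 2 := by
    intro i t
    fin_cases i <;> simp [N] <;> ring
  have key := touch (f := fun y => - u y) hu.1.neg x
    (fun i t => 1 + K / (η - 2 * t * (x i - x₀ i) - t ^ 2))
    (fun i t => K * (2 * (x i - x₀ i) + 2 * t) / (η - 2 * t * (x i - x₀ i) - t ^ 2) ^ 2)
    (fun i => K * 2 / η ^ 2 + 8 * K * (x i - x₀ i) ^ 2 / η ^ 3)
    ?_ ?_ ?_ ?_
  · have hlap : laplacian (fun y => - u y) x = - laplacian u x := by
      unfold laplacian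
      simp only [fderiv_fun_neg, neg_apply, Finset.sum_neg_distrib]
    rw [hlap, hu.2 x] at key
    have hux : u x = -1 - K / η := by rw [hK]; field_simp; ring
    have hs : K * 2 / η ^ 2 + 8 * K * (x 0 - x₀ 0) ^ 2 / η ^ 3 +
        (K * 2 / η ^ 2 + 8 * K * (x 1 - x₀ 1) ^ 2 / η ^ 3) +
        (K * 2 / η ^ 2 + 8 * K * (x 2 - x₀ 2) ^ 2 / η ^ 3) =
        K * (6 * η + 8 * N x) / η ^ 3 := by
      simp only [N]; field_simp; ring
    rw [hs] at key
    have hb : K * (6 * η + 8 * N x) / η ^ 3 < (K / η) ^ 3 := by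
      rw [div_pow]
      refine div_lt_div_of_pos_right ?_ (by positivity)
      have h1 : 6 * η + 8 * N x ≤ 8 * R ^ 2 := by linarith
      have hKp : 0 < K := by linarith
      have h2 : 8 * R ^ 2 < K ^ 2 := by
        have : (3 * R) ^ 2 < K ^ 2 := pow_lt_pow_left₀ hK3 (by positivity) (by norm_num)
        linarith [sq_nonneg R, mul_pow 3 R 2]
      calc K * (6 * η + 8 * N x) < K * K ^ 2 := by
            apply mul_lt_mul_of_pos_left _ hKp; linarith
        _ = K ^ 3 := by ring
    have hp : 0 < K / η := div_pos (by linarith) hη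
    rw [hux] at key
    generalize K / η = q at *
    have h3 : (-1 - q) - (-1 - q) ^ 3 = 2 * q + 3 * q ^ 2 + q ^ 3 := by ring
    linarith [sq_nonneg q]
  · intro i
    have hc : ContinuousAt (fun t : ℝ => N (x + t • EuclideanSpace.single i (1:ℝ))) 0 := by
      fun_prop
    have := hc.eventually_lt (g := fun _ => R ^ 2) continuousAt_const (by simp; linarith)
    filter_upwards [this] with t ht
    refine (hmaxle _ ht).trans (le_of_eq ?_)
    rw [hNl]; simp only [hηd]; ring_nf
  · intro i
    have h1 : K / η = -1 - u x := by rw [hK, mul_div_cancel_right₀ _ hη.ne']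
    simp only [mul_zero, zero_mul, sub_zero, ne_eq, OfNat.ofNat_ne_zero, not_false_eq_true,
      zero_pow, h1]
    ring
  · intro i
    have hc : ContinuousAt (fun t : ℝ => η - 2 * t * (x i - x₀ i) - t ^ 2) 0 := by
      fun_prop
    have := hc.eventually_ne (y := 0) (by simpa using hη.ne')
    filter_upwards [this] with t ht
    have := ((hasDerivAt_const t K).fun_div (quadDeriv η (x i - x₀ i) t) ht).const_add 1
    refine this.congr_deriv ?_
    ring
  · intro i
    have hn : HasDerivAt (fun t : ℝ => K * (2 * (x i - x₀ i) + 2 * t)) (K * (2 * 1)) 0 :=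
      (((hasDerivAt_id' (0:ℝ)).const_mul 2).const_add (2 * (x i - x₀ i))).const_mul K
    have := hn.fun_div ((quadDeriv η (x i - x₀ i) 0).fun_pow 2) (by simpa using hη.ne')
    refine this.congr_deriv ?_
    norm_num
    field_simp
    ring
theorem H1_hasDerivAt (t : ℝ) :
    HasDerivAt (fun t => (1 - H t ^ 2) / Real.sqrt 2) (-(H t * (1 - H t ^ 2))) t := by
  have := (((H_hasDerivAt t).fun_pow 2).const_sub 1).div_const (Real.sqrt 2)
  refine this.congr_deriv ?_
  have h2 : Real.sqrt 2 ^ 2 = 2 := Real.sq_sqrt (by norm_num)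
  have : 0 < Real.sqrt 2 := by positivity
  norm_num
  field_simp
  rw [h2]; ring

theorem expDeriv (α N d t : ℝ) : HasDerivAt (fun t : ℝ => Real.exp (-α * (N + 2 * t * d + t ^ 2)))
    (Real.exp (-α * (N + 2 * t * d + t ^ 2)) * (-α * (2 * d + 2 * t))) t := by
  have := (((hasDerivAt_id' t).const_mul 2).mul_const d).const_add N
  have := ((this.fun_add ((hasDerivAt_id' t).fun_pow 2)).const_mul (-α)).exp
  refine this.congr_deriv ?_
  norm_num

set_option maxHeartbeats 1000000 in
/-- Strong maximum principle for `u ≤ H(x₃)`. -/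
theorem strong_max (u : EuclideanSpace ℝ (Fin 3) → ℝ) (hu : IsACSolution u)
    (hle : ∀ x, u x ≤ H (x 2)) (y : EuclideanSpace ℝ (Fin 3)) (hy : u y < H (y 2))
    (x₁ : EuclideanSpace ℝ (Fin 3)) : u x₁ < H (x₁ 2) := by
  have huc := hu.1.continuous
  have hHc := H_cont
  have hHz : Continuous fun x : EuclideanSpace ℝ (Fin 3) => H (x 2) := by fun_prop
  let N : EuclideanSpace ℝ (Fin 3) → ℝ := fun x =>
    (x 0 - y 0) ^ 2 + (x 1 - y 1) ^ 2 + (x 2 - y 2) ^ 2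
  have hN : ∀ x, N x = dist x y ^ 2 := by
    intro x
    rw [EuclideanSpace.dist_eq, Real.sq_sqrt (by positivity), Fin.sum_univ_three]
    simp [N, Real.dist_eq, sq_abs]
  have hNc : Continuous N := by fun_prop
  obtain ⟨ρ, hρ, hball⟩ : ∃ ρ > 0, Metric.closedBall y ρ ⊆ {x | u x < H (x 2)} :=
    Metric.nhds_basis_closedBall.mem_iff.1 ((isOpen_lt huc hHz).mem_nhds hy)
  obtain ⟨xm, hxm, hmin⟩ := (isCompact_closedBall y ρ).exists_isMinOn
    ⟨y, Metric.mem_closedBall_self hρ.le⟩ (f := fun x => H (x 2) - u x)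
    (by fun_prop)
  set m := H (xm 2) - u xm with hm
  have hmpos : 0 < m := by have := hball hxm; simp only [Set.mem_ofPred_eq] at this; linarith
  set ε := min m 1 with hε
  have hεpos : 0 < ε := lt_min hmpos one_pos
  have hεm : ε ≤ m := min_le_left _ _
  have hε1 : ε ≤ 1 := min_le_right _ _
  set R := dist x₁ y + 1 with hR
  have hRpos : 0 < R := by positivity
  set α := 3 / ρ ^ 2 + 4 with hα
  have hαpos : 0 < α := by positivity
  have hαρ : α * ρ ^ 2 = 3 + 4 * ρ ^ 2 := by rw [hα]; field_simp
  let E : EuclideanSpace ℝ (Fin 3) → ℝ := fun x => Real.exp (-α * N x) - Real.exp (-α * R ^ 2)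
  have hEc : Continuous E := by fun_prop
  obtain ⟨x, hx, hxmax⟩ := (isCompact_closedBall y R).exists_isMaxOn
    ⟨y, Metric.mem_closedBall_self hRpos.le⟩ (f := fun x => u x - H (x 2) + ε * E x)
    (by fun_prop)
  set M := u x - H (x 2) + ε * E x with hM
  have hMle : M ≤ 0 := by
    by_contra hMpos
    push Not at hMpos
    have hux := hle x
    have hEpos : 0 < E x := by
      have : 0 < ε * E x := by linarith
      exact pos_of_mul_pos_right this hεpos.le
    have hNR : N x < R ^ 2 := by
      have : Real.exp (-α * R ^ 2) < Real.exp (-α * N x) := by simp only [E] at hEpos; linarith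
      rw [Real.exp_lt_exp] at this
      nlinarith
    have hN0 : 0 ≤ N x := by rw [hN]; positivity
    have hexp1 : Real.exp (-α * N x) ≤ 1 := by
      rw [Real.exp_le_one_iff]; nlinarith
    have hER := Real.exp_pos (-α * R ^ 2)
    have hElt : E x < 1 := by simp only [E]; linarith
    have hEle : E x < Real.exp (-α * N x) := by simp only [E]; linarith
    have hNρ : ρ ^ 2 < N x := by
      by_contra h
      push Not at h
      have hxb : x ∈ Metric.closedBall y ρ := by
        rw [Metric.mem_closedBall]
        rw [hN] at h
        exact (le_abs_self _).trans (abs_le_of_sq_le_sq h hρ.le)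
      have h1 := hmin hxb
      simp only [Set.mem_ofPred_eq] at h1
      nlinarith
    have hNl : ∀ (i : Fin 3) (t : ℝ), N (x + t • EuclideanSpace.single i (1:ℝ))
        = N x + 2 * t * (x i - y i) + t ^ 2 := by
      intro i t
      fin_cases i <;> simp [N] <;> ring
    let σ : Fin 3 → ℝ := ![0, 0, 1]
    have hσ : ∀ (i : Fin 3) (t : ℝ), (x + t • EuclideanSpace.single i (1:ℝ)) 2 = x 2 + t * σ i := by
      intro i t
      fin_cases i <;> simp [σ]
    have key := touch (f := u) hu.1 x
      (fun i t => H (x 2 + t * σ i) - ε * (Real.exp (-α * (N x + 2 * t * (x i - y i) + t ^ 2))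
        - Real.exp (-α * R ^ 2)) + M)
      (fun i t => (1 - H (x 2 + t * σ i) ^ 2) / Real.sqrt 2 * (1 * σ i)
        - ε * (Real.exp (-α * (N x + 2 * t * (x i - y i) + t ^ 2))
          * (-α * (2 * (x i - y i) + 2 * t))))
      (fun i => -(H (x 2) * (1 - H (x 2) ^ 2)) * σ i ^ 2
        - ε * (Real.exp (-α * N x) * (4 * α ^ 2 * (x i - y i) ^ 2 - 2 * α)))
      ?_ ?_ ?_ ?_
    · have hlap := hu.2 x
      have hs : (4 * α ^ 2 * (x 0 - y 0) ^ 2 - 2 * α) + (4 * α ^ 2 * (x 1 - y 1) ^ 2 - 2 * α)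
          + (4 * α ^ 2 * (x 2 - y 2) ^ 2 - 2 * α) = 4 * α ^ 2 * N x - 6 * α := by
        simp only [N]; ring
      have h6 : 6 ≤ 4 * α ^ 2 * N x - 6 * α := by
        have h1 : α * ρ ^ 2 ≤ α * N x := by nlinarith
        have h2 : 4 ≤ α := by rw [hα]; linarith [show 0 < 3 / ρ ^ 2 by positivity]
        nlinarith [sq_nonneg ρ]
      simp only [σ, Matrix.cons_val_zero, Matrix.cons_val_one, Matrix.cons_val] at key
      set e := Real.exp (-α * N x)
      set h := H (x 2)
      have key2 : u x ^ 3 - u x ≤ -(h * (1 - h ^ 2)) - ε * (e * (4 * α ^ 2 * N x - 6 * α)) := by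
        rw [← hs]; linarith
      have hep : 0 < e := Real.exp_pos _
      have hφ : h - u x < ε * E x := by linarith
      have hh1 : h < 1 := H_lt_one _
      have hh2 : -1 < h := neg_one_lt_H _
      have hu2 : -2 < u x := by nlinarith
      have hc : h ^ 2 + h * u x + u x ^ 2 - 1 ≤ 6 := by nlinarith
      have h3 : (h - u x) * (h ^ 2 + h * u x + u x ^ 2 - 1) ≤ (h - u x) * 6 :=
        mul_le_mul_of_nonneg_left hc (by linarith)
      have h4 : ε * (e * 6) ≤ ε * (e * (4 * α ^ 2 * N x - 6 * α)) := by gcongr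
      have h5 : ε * E x < ε * e := mul_lt_mul_of_pos_left hEle hεpos
      nlinarith
    · intro i
      have hc : ContinuousAt (fun t : ℝ => N (x + t • EuclideanSpace.single i (1:ℝ))) 0 := by
        fun_prop
      have := hc.eventually_lt (g := fun _ => R ^ 2) continuousAt_const (by simpa using hNR)
      filter_upwards [this] with t ht
      have hyb : (x + t • EuclideanSpace.single i (1:ℝ)) ∈ Metric.closedBall y R := by
        rw [Metric.mem_closedBall]
        rw [hN] at ht
        exact (le_abs_self _).trans (abs_le_of_sq_le_sq ht.le hRpos.le)
      have h1 := hxmax hyb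
      simp only [Set.mem_ofPred_eq, E] at h1
      rw [hNl, hσ] at h1
      linarith
    · intro i
      simp only [zero_mul, mul_zero, add_zero, ne_eq, OfNat.ofNat_ne_zero, not_false_eq_true,
        zero_pow, hM, E]
      ring
    · intro i
      refine Eventually.of_forall fun t => ?_
      have h1 : HasDerivAt (fun t : ℝ => x 2 + t * σ i) (1 * σ i) t :=
        ((hasDerivAt_id' t).mul_const (σ i)).const_add _
      have h2 := (H_hasDerivAt (x 2 + t * σ i)).comp t h1
      exact (h2.fun_sub (((expDeriv α (N x) (x i - y i) t).sub_const _).const_mul ε)).add_const M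
    · intro i
      have h1 : HasDerivAt (fun t : ℝ => x 2 + t * σ i) (1 * σ i) 0 :=
        ((hasDerivAt_id' (0:ℝ)).mul_const (σ i)).const_add _
      have h2 := ((H1_hasDerivAt (x 2 + 0 * σ i)).comp 0 h1).mul_const (1 * σ i)
      have h3 : HasDerivAt (fun t : ℝ => -α * (2 * (x i - y i) + 2 * t)) (-α * (2 * 1)) 0 :=
        (((hasDerivAt_id' (0:ℝ)).const_mul 2).const_add _).const_mul _
      have h4 := h2.fun_sub (((expDeriv α (N x) (x i - y i) 0).fun_mul h3).const_mul ε)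
      refine h4.congr_deriv ?_
      simp only [zero_mul, mul_zero, add_zero, ne_eq, OfNat.ofNat_ne_zero, not_false_eq_true,
        zero_pow]
      ring
  have hx1 : x₁ ∈ Metric.closedBall y R := by rw [Metric.mem_closedBall]; linarith
  have h1 := hxmax hx1
  simp only [Set.mem_ofPred_eq] at h1
  have h2 : 0 < E x₁ := by
    simp only [E]
    have : Real.exp (-α * R ^ 2) < Real.exp (-α * N x₁) := by
      rw [Real.exp_lt_exp, hN]
      have : dist x₁ y ^ 2 < R ^ 2 := by nlinarith [dist_nonneg (x := x₁) (y := y)]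
      nlinarith
    linarith
  have : 0 < ε * E x₁ := by positivity
  linarith
noncomputable def FF (δ κ s : ℝ) : ℝ := δ - Real.log (1 + κ * Real.log s) / 2
noncomputable def FF1 (κ s : ℝ) : ℝ := -(κ / (2 * (s * (1 + κ * Real.log s))))

theorem FF_deriv {δ κ s : ℝ} (hκ : 0 < κ) (hs : 1 < s) :
    HasDerivAt (FF δ κ) (FF1 κ s) s := by
  have hl := Real.log_pos hs
  have hQ : 0 < 1 + κ * Real.log s := by positivity
  have := ((((Real.hasDerivAt_log (by linarith : s ≠ 0)).const_mul κ).const_add 1).log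
    hQ.ne').div_const 2 |>.const_sub δ
  refine this.congr_deriv ?_
  unfold FF1
  field_simp

theorem FF1_deriv {κ s : ℝ} (hκ : 0 < κ) (hs : 1 < s) :
    HasDerivAt (FF1 κ) (-FF1 κ s / s + 2 * FF1 κ s ^ 2) s := by
  have hl := Real.log_pos hs
  have hQ : 0 < 1 + κ * Real.log s := by positivity
  have h1 := (((Real.hasDerivAt_log (by linarith : s ≠ 0)).const_mul κ).const_add 1)
  have h2 := ((hasDerivAt_id' s).fun_mul h1).const_mul 2
  have := ((hasDerivAt_const s κ).fun_div h2 (by positivity)).fun_neg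
  refine this.congr_deriv ?_
  unfold FF1
  field_simp
  ring

theorem line_barrier {δ κ a σ : ℝ} {S S1 : ℝ → ℝ} {S2 : ℝ} (hκ : 0 < κ)
    (hS0 : 1 < S 0) (hS : ∀ t, HasDerivAt S (S1 t) t) (hS1 : HasDerivAt S1 S2 0) :
    ∃ w1 : ℝ → ℝ, (∀ᶠ t in 𝓝 (0:ℝ),
        HasDerivAt (fun t => H (a + t * σ - FF δ κ (S t))) (w1 t) t) ∧
      HasDerivAt w1 ((1 - H (a - FF δ κ (S 0)) ^ 2) / Real.sqrt 2 *
        (-((-FF1 κ (S 0) / S 0 + 2 * FF1 κ (S 0) ^ 2) * S1 0 ^ 2 + FF1 κ (S 0) * S2)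
          - Real.sqrt 2 * H (a - FF δ κ (S 0)) * (σ - FF1 κ (S 0) * S1 0) ^ 2)) 0 := by
  have hk : ∀ t, 1 < S t → HasDerivAt (fun t => a + t * σ - FF δ κ (S t))
      (1 * σ - FF1 κ (S t) * S1 t) t := by
    intro t ht
    exact (((hasDerivAt_id' t).mul_const σ).const_add a).fun_sub ((FF_deriv hκ ht).comp t (hS t))
  refine ⟨fun t => (1 - H (a + t * σ - FF δ κ (S t)) ^ 2) / Real.sqrt 2 *
    (1 * σ - FF1 κ (S t) * S1 t), ?_, ?_⟩
  · have := (hS 0).continuousAt.eventually_const_lt hS0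
    filter_upwards [this] with t ht
    exact (H_hasDerivAt _).comp t (hk t ht)
  · have h1 := (H1_hasDerivAt _).comp 0 (hk 0 hS0)
    have h2 := ((((FF1_deriv hκ hS0).comp 0 (hS 0)).fun_mul hS1).const_sub (1 * σ))
    refine (h1.fun_mul h2).congr_deriv ?_
    have h3 : Real.sqrt 2 ^ 2 = 2 := Real.sq_sqrt (by norm_num)
    have : 0 < Real.sqrt 2 := by positivity
    simp only [zero_mul, add_zero, one_mul, Function.comp_def]
    generalize H (a - FF δ κ (S 0)) = h
    generalize FF1 κ (S 0) = p
    field_simp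
    ring

theorem core_N {ρ z h S : ℝ} (hρ : 0 ≤ ρ) (hSd : S = ρ ^ 2 - 32 * ρ + 16 * z ^ 2) (hS : 1 < S)
    (hc : (|z| ≤ 4 ∧ -(1 / 2) ≤ h * z) ∨ (4 < |z| ∧ |z| ≤ Real.sqrt 2 * h * z)) :
    S * (16 * ρ - 128 + 32 - 64 * (Real.sqrt 2 * h * z))
      < 16 * ρ * (ρ - 16) ^ 2 + 1024 * z ^ 2 := by
  have hN : S * (16 * ρ - 128 + 32 - 64 * (Real.sqrt 2 * h * z))
      - (16 * ρ * (ρ - 16) ^ 2 + 1024 * z ^ 2)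
      = 256 * ρ * (z ^ 2 - 16) - (96 + 64 * (Real.sqrt 2 * h * z)) * S - 1024 * z ^ 2 := by
    rw [hSd]; ring
  have hz2 : |z| ^ 2 = z ^ 2 := sq_abs z
  rcases hc with ⟨h1, h2⟩ | ⟨h1, h2⟩
  · have hE : 0 < 96 + 64 * (Real.sqrt 2 * h * z) := by
      have : Real.sqrt 2 ≤ 2 := Real.sqrt_le_iff.2 ⟨by norm_num, by norm_num⟩
      nlinarith [Real.sqrt_nonneg 2]
    have hz : z ^ 2 ≤ 16 := by rw [← hz2]; nlinarith [abs_nonneg z]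
    have : 256 * ρ * (z ^ 2 - 16) ≤ 0 := by nlinarith
    have : 0 < (96 + 64 * (Real.sqrt 2 * h * z)) * S := by positivity
    nlinarith [sq_nonneg z]
  · have hE : (96 + 64 * |z|) * S ≤ (96 + 64 * (Real.sqrt 2 * h * z)) * S := by
      apply mul_le_mul_of_nonneg_right _ (by linarith); linarith
    have h3 : S = ρ ^ 2 - 32 * ρ + 16 * |z| ^ 2 := by rw [hz2, hSd]
    rw [← hz2] at hN ⊢
    generalize |z| = t at *
    have hq : 256 * (t ^ 2 - 16) + 32 * (96 + 64 * t) ≤ 8 * t * (96 + 64 * t) := by nlinarith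
    have h4 := mul_le_mul_of_nonneg_left hq hρ
    have h5 : 0 ≤ (96 + 64 * t) * (ρ - 4 * t) ^ 2 := by positivity
    rw [h3] at hE hN ⊢
    nlinarith

theorem core_T {ρ z h S g p : ℝ} (hh : -1 ≤ h) (hp : p < 0) (hS : 1 < S)
    (hg : g = 16 * ρ * (ρ - 16) ^ 2 + 1024 * z ^ 2) (hρ : 0 ≤ ρ)
    (hN : S * (16 * ρ - 128 + 32 - 64 * (Real.sqrt 2 * h * z)) < g) :
    0 < (-p / S + 2 * p ^ 2) * g + p * (16 * ρ - 128 + 32)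
      + Real.sqrt 2 * h * (p ^ 2 * g - 2 * p * (32 * z)) := by
  have hg0 : 0 ≤ g := by rw [hg]; positivity
  have h2 : Real.sqrt 2 ≤ 2 := Real.sqrt_le_iff.2 ⟨by norm_num, by norm_num⟩
  have h3 : 0 ≤ 2 + Real.sqrt 2 * h := by nlinarith [Real.sqrt_nonneg 2]
  have h4 : 0 < g / S - (16 * ρ - 128 + 32 - 64 * (Real.sqrt 2 * h * z)) := by
    rw [sub_pos, lt_div_iff₀ (by linarith)]; linarith
  have h5 : 0 < -p * (g / S - (16 * ρ - 128 + 32 - 64 * (Real.sqrt 2 * h * z))) :=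
    mul_pos (by linarith) h4
  have h6 : 0 ≤ (2 + Real.sqrt 2 * h) * (p ^ 2 * g) := by positivity
  have : (-p / S + 2 * p ^ 2) * g + p * (16 * ρ - 128 + 32)
      + Real.sqrt 2 * h * (p ^ 2 * g - 2 * p * (32 * z))
      = -p * (g / S - (16 * ρ - 128 + 32 - 64 * (Real.sqrt 2 * h * z)))
        + (2 + Real.sqrt 2 * h) * (p ^ 2 * g) := by ring
  linarith
noncomputable def SS (x : EuclideanSpace ℝ (Fin 3)) : ℝ :=
  (x 0 ^ 2 + x 1 ^ 2) ^ 2 - 32 * (x 0 ^ 2 + x 1 ^ 2) + 16 * x 2 ^ 2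

theorem SS_cont : Continuous SS := by unfold SS; fun_prop

theorem SS_compact (B : ℝ) : IsCompact {x | SS x ≤ B} := by
  refine (isCompact_closedBall (0 : EuclideanSpace ℝ (Fin 3)) (Real.sqrt (2 * B + 600))).of_isClosed_subset
    (isClosed_le SS_cont continuous_const) ?_
  intro x hx
  simp only [Set.mem_ofPred_eq, SS] at hx
  rw [mem_closedBall_zero_iff, EuclideanSpace.norm_eq, Fin.sum_univ_three]
  simp only [Real.norm_eq_abs, sq_abs]
  apply Real.sqrt_le_sqrt
  nlinarith [sq_nonneg (x 0 ^ 2 + x 1 ^ 2 - 17), sq_nonneg (x 2), sq_nonneg (x 0 ^ 2 + x 1 ^ 2 - 16)]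

theorem poly_deriv (a b d t : ℝ) : HasDerivAt
    (fun t => ((a + t) ^ 2 + b) ^ 2 - 32 * ((a + t) ^ 2 + b) + d)
    ((2 * ((a + t) ^ 2 + b) - 32) * (2 * (a + t))) t := by
  have h1 : HasDerivAt (fun t => (a + t) ^ 2 + b) (2 * (a + t)) t := by
    refine ((((hasDerivAt_id' t).const_add a).fun_pow 2).add_const b).congr_deriv ?_
    norm_num
  refine (((h1.fun_pow 2).fun_sub (h1.const_mul 32)).add_const d).congr_deriv ?_
  norm_num
  ring

theorem poly_deriv1 (a b : ℝ) : HasDerivAt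
    (fun t => (2 * ((a + t) ^ 2 + b) - 32) * (2 * (a + t)))
    (8 * a ^ 2 + (2 * (a ^ 2 + b) - 32) * 2) 0 := by
  have h1 : HasDerivAt (fun t => (a + t) ^ 2 + b) (2 * a) 0 := by
    refine ((((hasDerivAt_id' (0:ℝ)).const_add a).fun_pow 2).add_const b).congr_deriv ?_
    norm_num
  refine (((h1.const_mul 2).sub_const 32).fun_mul
    (((hasDerivAt_id' (0:ℝ)).const_add a).const_mul 2)).congr_deriv ?_
  norm_num
  ring

theorem SS_line (x : EuclideanSpace ℝ (Fin 3)) (i : Fin 3) : ∃ S1 : ℝ → ℝ,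
    (∀ t, HasDerivAt (fun t : ℝ => SS (x + t • EuclideanSpace.single i (1:ℝ))) (S1 t) t) ∧
    S1 0 = (![(2 * (x 0 ^ 2 + x 1 ^ 2) - 32) * (2 * x 0), (2 * (x 0 ^ 2 + x 1 ^ 2) - 32) * (2 * x 1),
      32 * x 2] : Fin 3 → ℝ) i ∧
    HasDerivAt S1 ((![8 * x 0 ^ 2 + (2 * (x 0 ^ 2 + x 1 ^ 2) - 32) * 2,
      8 * x 1 ^ 2 + (2 * (x 0 ^ 2 + x 1 ^ 2) - 32) * 2, 32] : Fin 3 → ℝ) i) 0 := by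
  fin_cases i
  · refine ⟨_, fun t => ?_, ?_, poly_deriv1 (x 0) (x 1 ^ 2)⟩
    · have := poly_deriv (x 0) (x 1 ^ 2) (16 * x 2 ^ 2) t
      refine this.congr_of_eventuallyEq (Eventually.of_forall fun s => ?_)
      simp [SS]
    · simp
  · refine ⟨fun t => (2 * ((x 1 + t) ^ 2 + x 0 ^ 2) - 32) * (2 * (x 1 + t)), fun t => ?_, ?_,
      (poly_deriv1 (x 1) (x 0 ^ 2)).congr_deriv ?_⟩
    · have := poly_deriv (x 1) (x 0 ^ 2) (16 * x 2 ^ 2) t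
      refine this.congr_of_eventuallyEq (Eventually.of_forall fun s => ?_)
      simp [SS]; ring
    · simp; left; ring
    · simp; ring
  · refine ⟨fun t => 32 * (x 2 + t), fun t => ?_, ?_, ?_⟩
    · have : HasDerivAt (fun t => (x 0 ^ 2 + x 1 ^ 2) ^ 2 - 32 * (x 0 ^ 2 + x 1 ^ 2)
          + 16 * (x 2 + t) ^ 2) (32 * (x 2 + t)) t := by
        refine (((((hasDerivAt_id' t).const_add (x 2)).fun_pow 2).const_mul 16).const_add _).congr_deriv ?_
        norm_num; ring
      refine this.congr_of_eventuallyEq (Eventually.of_forall fun s => ?_)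
      simp [SS]
    · simp
    · refine (((hasDerivAt_id' (0:ℝ)).const_add (x 2)).const_mul 32).congr_deriv ?_
      simp

theorem FF_le {δ κ s : ℝ} (hκ : 0 < κ) (hs : 1 ≤ s) : FF δ κ s ≤ δ := by
  unfold FF
  have := Real.log_nonneg hs
  have : 0 ≤ Real.log (1 + κ * Real.log s) := Real.log_nonneg (by nlinarith)
  linarith

theorem FF_ge {δ κ s : ℝ} (hκ : 0 < κ) (hs : 1 ≤ s) : δ - κ * Real.log s / 2 ≤ FF δ κ s := by
  unfold FF
  have := Real.log_nonneg hs
  have := Real.log_le_sub_one_of_pos (show 0 < 1 + κ * Real.log s by positivity)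
  linarith

theorem FF_bound {δ κ s : ℝ} (hκ : 0 < κ) (hs : 1 ≤ s) (h : 0 ≤ FF δ κ s) :
    s ≤ Real.exp ((Real.exp (2 * δ) - 1) / κ) := by
  unfold FF at h
  have hl := Real.log_nonneg hs
  have h1 : Real.log (1 + κ * Real.log s) ≤ 2 * δ := by linarith
  rw [Real.log_le_iff_le_exp (by positivity)] at h1
  rw [← Real.log_le_iff_le_exp (by linarith), le_div_iff₀ hκ]
  linarith

theorem FF_contOn {δ κ : ℝ} (hκ : 0 < κ) : ContinuousOn (FF δ κ) {s | 1 ≤ s} := by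
  intro s hs
  simp only [Set.mem_ofPred_eq] at hs
  have hl := Real.log_nonneg hs
  have h1 : ContinuousAt (fun s => 1 + κ * Real.log s) s :=
    continuousAt_const.add (continuousAt_const.mul (Real.continuousAt_log (by linarith)))
  exact (continuousAt_const.sub ((h1.log (by positivity)).div_const 2)).continuousWithinAt

theorem h_cond {z ψ : ℝ} (h1 : 0 < ψ) (h2 : ψ ≤ 1 / 2) :
    (|z| ≤ 4 ∧ -(1 / 2) ≤ H (z - ψ) * z) ∨ (4 < |z| ∧ |z| ≤ Real.sqrt 2 * H (z - ψ) * z) := by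
  have hm := H_strictMono
  have hl := neg_one_lt_H (z - ψ)
  rcases le_or_gt |z| 4 with hz | hz
  · left
    refine ⟨hz, ?_⟩
    rcases le_or_gt z 0 with h | h
    · have : H (z - ψ) ≤ H 0 := hm.monotone (by linarith)
      rw [H_zero] at this
      nlinarith
    · rcases le_or_gt ψ z with h' | h'
      · have : H 0 ≤ H (z - ψ) := hm.monotone (by linarith)
        rw [H_zero] at this
        nlinarith
      · nlinarith
  · right
    refine ⟨hz, ?_⟩
    rcases le_or_gt 0 z with h | h
    · rw [abs_of_nonneg h] at *
      have := sqrt2_H (t := z - ψ) (by linarith)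
      nlinarith
    · rw [abs_of_neg h] at *
      have := sqrt2_H (t := -(z - ψ)) (by linarith)
      rw [H_neg] at this
      nlinarith

/-- No contact with the barrier at points where it is active. -/
theorem no_touch (u : EuclideanSpace ℝ (Fin 3) → ℝ) (hu : IsACSolution u) {δ κ c : ℝ}
    (hκ : 0 < κ) (hδ : δ ≤ 1 / 2) (hc : 0 ≤ c)
    (hle : ∀ x, 1 ≤ SS x → u x ≤ H (x 2 + c - FF δ κ (SS x)))
    (x : EuclideanSpace ℝ (Fin 3)) (hS : 1 < SS x) (hψ : 0 < FF δ κ (SS x) - c)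
    (heq : u x = H (x 2 + c - FF δ κ (SS x))) : False := by
  let σ : Fin 3 → ℝ := ![0, 0, 1]
  have hσ : ∀ (i : Fin 3) (t : ℝ), (x + t • EuclideanSpace.single i (1:ℝ)) 2 = x 2 + t * σ i := by
    intro i t
    fin_cases i <;> simp [σ]
  set g : Fin 3 → ℝ := ![(2 * (x 0 ^ 2 + x 1 ^ 2) - 32) * (2 * x 0),
    (2 * (x 0 ^ 2 + x 1 ^ 2) - 32) * (2 * x 1), 32 * x 2] with hg
  set q : Fin 3 → ℝ := ![8 * x 0 ^ 2 + (2 * (x 0 ^ 2 + x 1 ^ 2) - 32) * 2,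
      8 * x 1 ^ 2 + (2 * (x 0 ^ 2 + x 1 ^ 2) - 32) * 2, 32] with hq
  set p := FF1 κ (SS x) with hp
  set h := H (x 2 + c - FF δ κ (SS x)) with hh
  have hex : ∀ i : Fin 3, ∃ w1 : ℝ → ℝ, (∀ᶠ t in 𝓝 (0:ℝ),
        HasDerivAt (fun t => H (x 2 + c + t * σ i
          - FF δ κ (SS (x + t • EuclideanSpace.single i (1:ℝ))))) (w1 t) t) ∧
      HasDerivAt w1 ((1 - h ^ 2) / Real.sqrt 2 *
        (-((-p / SS x + 2 * p ^ 2) * g i ^ 2 + p * q i)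
          - Real.sqrt 2 * h * (σ i - p * g i) ^ 2)) 0 := by
    intro i
    obtain ⟨S1, hS1, h10, hS2⟩ := SS_line x i
    have := line_barrier (δ := δ) (a := x 2 + c) (σ := σ i) hκ
      (S := fun t : ℝ => SS (x + t • EuclideanSpace.single i (1:ℝ))) (by simpa using hS) hS1 hS2
    simp only [zero_smul, add_zero, h10] at this
    exact this
  choose w1 hw1 hw2 using hex
  have key := touch hu.1 x _ w1 _ ?_ ?_ hw1 hw2
  · have hlap := hu.2 x
    rw [heq] at hlap
    have hρ : 0 ≤ x 0 ^ 2 + x 1 ^ 2 := by positivity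
    have hpneg : p < 0 := by
      have := Real.log_pos hS
      rw [hp, FF1, neg_lt_zero]
      positivity
    have hψ2 : FF δ κ (SS x) - c ≤ 1 / 2 := by linarith [FF_le (δ := δ) hκ hS.le]
    have hcond := h_cond (z := x 2) hψ hψ2
    rw [show x 2 - (FF δ κ (SS x) - c) = x 2 + c - FF δ κ (SS x) by ring, ← hh] at hcond
    have hN := core_N hρ (z := x 2) (S := SS x) rfl hS hcond
    have hT := core_T (z := x 2) (neg_one_lt_H _).le hpneg hS rfl hρ hN
    have hP : 0 < (1 - h ^ 2) / Real.sqrt 2 := by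
      have := neg_one_lt_H (x 2 + c - FF δ κ (SS x))
      have := H_lt_one (x 2 + c - FF δ κ (SS x))
      have : 0 < 1 - h ^ 2 := by nlinarith
      positivity
    have hP2 : h - h ^ 3 = (1 - h ^ 2) / Real.sqrt 2 * (Real.sqrt 2 * h) := by
      field_simp
    set P := (1 - h ^ 2) / Real.sqrt 2
    have h1 : laplacian u x = - (P * (Real.sqrt 2 * h)) := by linarith
    rw [h1, ← mul_add, ← mul_add, ← mul_neg] at key
    have key2 := le_of_mul_le_mul_left key hP
    simp only [g, q, σ, Matrix.cons_val_zero, Matrix.cons_val_one, Matrix.cons_val] at key2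
    linarith
  · intro i
    have hc : ContinuousAt (fun t : ℝ => SS (x + t • EuclideanSpace.single i (1:ℝ))) 0 := by
      have := SS_cont
      fun_prop
    have := hc.eventually_const_lt (u := 1) (by simpa using hS)
    filter_upwards [this] with t ht
    have := hle _ ht.le
    rw [hσ] at this
    refine this.trans (le_of_eq ?_)
    congr 1; ring
  · intro i
    simp only [zero_smul, add_zero, zero_mul]
    exact heq.symm

theorem barrier (u : EuclideanSpace ℝ (Fin 3) → ℝ) (hu : IsACSolution u) {δ κ : ℝ}
    (hlt : ∀ x, u x < H (x 2))
    (hκ : 0 < κ) (hδ0 : 0 < δ) (hδ : δ ≤ 1 / 2)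
    (hin : ∀ x, SS x ≤ 1 → u x ≤ H (x 2 - δ))
    (x : EuclideanSpace ℝ (Fin 3)) (hx : 1 ≤ SS x) : u x ≤ H (x 2 - FF δ κ (SS x)) := by
  have hm := H_strictMono.monotone
  let A : Set ℝ := {c | 0 ≤ c ∧ ∀ x, 1 ≤ SS x → u x ≤ H (x 2 + c - FF δ κ (SS x))}
  have hδA : δ ∈ A := by
    refine ⟨hδ0.le, fun y hy => (hlt y).le.trans (hm ?_)⟩
    linarith [FF_le (δ := δ) hκ hy]
  have hbdd : BddBelow A := ⟨0, fun c hc => hc.1⟩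
  set c := sInf A with hc
  have hc0 : 0 ≤ c := le_csInf ⟨δ, hδA⟩ fun c hc => hc.1
  have hcA : ∀ x, 1 ≤ SS x → u x ≤ H (x 2 + c - FF δ κ (SS x)) := by
    intro y hy
    refine le_of_forall_pos_le_add fun η hη => ?_
    obtain ⟨c', hc', hlt'⟩ := exists_lt_of_csInf_lt ⟨δ, hδA⟩ (show sInf A < c + η by linarith)
    have h1 := hc'.2 y hy
    have h2 : H (y 2 + c' - FF δ κ (SS y)) ≤ H (y 2 + c - FF δ κ (SS y) + η) := hm (by linarith)
    have h3 := H_lip (show y 2 + c - FF δ κ (SS y) ≤ y 2 + c - FF δ κ (SS y) + η by linarith)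
    linarith
  rcases hc0.eq_or_lt with h0 | hcpos
  · have := hcA x hx
    rw [← h0, add_zero] at this
    exact this
  exfalso
  set B := Real.exp ((Real.exp (2 * δ) - 1) / κ) with hB
  have hB1 : 1 ≤ B := by
    have : 1 ≤ Real.exp (2 * δ) := Real.one_le_exp (by linarith)
    exact Real.one_le_exp (div_nonneg (by linarith) hκ.le)
  have hD : IsCompact ({x | SS x ≤ B} ∩ {x | 1 ≤ SS x}) :=
    (SS_compact B).inter_right (isClosed_le continuous_const SS_cont)
  have hcont : ContinuousOn (fun x : EuclideanSpace ℝ (Fin 3) =>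
      H (x 2 + c - FF δ κ (SS x)) - u x) ({x | SS x ≤ B} ∩ {x | 1 ≤ SS x}) := by
    have h1 : ContinuousOn (fun x => FF δ κ (SS x)) ({x | SS x ≤ B} ∩ {x | 1 ≤ SS x}) :=
      (FF_contOn hκ).comp SS_cont.continuousOn fun x hx => hx.2
    have h2 : Continuous fun x : EuclideanSpace ℝ (Fin 3) => x 2 + c := by fun_prop
    exact (H_cont.comp_continuousOn (h2.continuousOn.sub h1)).sub hu.1.continuous.continuousOn
  have hne : ({x | SS x ≤ B} ∩ {x | 1 ≤ SS x}).Nonempty := by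
    refine ⟨EuclideanSpace.single 2 (1/4), ?_⟩
    have : SS (EuclideanSpace.single 2 (1/4)) = 1 := by simp [SS]; norm_num
    exact ⟨this.le.trans hB1, this.ge⟩
  obtain ⟨y, hy, hmin⟩ := hD.exists_isMinOn hne hcont
  have hy1 : 1 ≤ SS y := hy.2
  set m := H (y 2 + c - FF δ κ (SS y)) - u y with hmd
  have hm0 : 0 ≤ m := by have := hcA y hy1; linarith
  rcases hm0.eq_or_lt with hm00 | hmpos
  · have heq : u y = H (y 2 + c - FF δ κ (SS y)) := by linarith
    have hψ : 0 < FF δ κ (SS y) - c := by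
      by_contra h
      push Not at h
      have := hm (show y 2 ≤ y 2 + c - FF δ κ (SS y) by linarith)
      linarith [hlt y]
    have hS : 1 < SS y := by
      rcases hy1.eq_or_lt with h | h
      · exfalso
        have h1 := hin y h.ge
        have h2 : FF δ κ (SS y) = δ := by rw [← h]; simp [FF]
        rw [h2] at heq
        have := H_strictMono (show y 2 - δ < y 2 + c - δ by linarith)
        linarith
      · exact h
    exact no_touch u hu hκ hδ hc0 hcA y hS hψ heq
  · have hmem : c - min m c ∈ A := by
      refine ⟨by linarith [min_le_right m c], fun z hz => ?_⟩
      by_cases hzB : SS z ≤ B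
      · have h1 := hmin (show z ∈ {x | SS x ≤ B} ∩ {x | 1 ≤ SS x} from ⟨hzB, hz⟩)
        simp only [Set.mem_ofPred_eq] at h1
        have h2 := H_lip (show z 2 + (c - min m c) - FF δ κ (SS z) ≤ z 2 + c - FF δ κ (SS z) by
          linarith [le_min hmpos.le hcpos.le])
        linarith [min_le_left m c]
      · have : FF δ κ (SS z) < 0 := by
          by_contra h
          push Not at h
          exact hzB (FF_bound hκ hz h)
        exact (hlt z).le.trans (hm (by linarith [min_le_right m c]))
    have := csInf_le hbdd hmem
    linarith [lt_min hmpos hcpos]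

theorem improve (u : EuclideanSpace ℝ (Fin 3) → ℝ) (hu : IsACSolution u)
    (hlt : ∀ x, u x < H (x 2)) : ∃ δ > 0, ∀ x, u x ≤ H (x 2 - δ) := by
  have hm := H_strictMono.monotone
  have hcont : Continuous (fun x : EuclideanSpace ℝ (Fin 3) => H (x 2) - u x) := by
    have := H_cont
    have := hu.1.continuous
    fun_prop
  obtain ⟨y, hy, hmin⟩ := (SS_compact 1).exists_isMinOn ⟨0, by simp [SS]⟩ hcont.continuousOn
  set m := H (y 2) - u y with hmd
  have hmpos : 0 < m := by linarith [hlt y]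
  set δ := min m (1 / 2) with hδ
  have hδ0 : 0 < δ := lt_min hmpos (by norm_num)
  have hin : ∀ x, SS x ≤ 1 → u x ≤ H (x 2 - δ) := by
    intro x hx
    have h1 := hmin hx
    simp only [Set.mem_ofPred_eq] at h1
    have := H_lip (show x 2 - δ ≤ x 2 by linarith)
    linarith [min_le_left m (1 / 2)]
  refine ⟨δ, hδ0, fun x => ?_⟩
  rcases le_total (SS x) 1 with hx | hx
  · exact hin x hx
  · refine le_of_forall_pos_le_add fun ε hε => ?_
    have hl := Real.log_nonneg hx
    have hκ : 0 < ε / (Real.log (SS x) + 1) := by positivity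
    have h1 := barrier u hu hlt hκ hδ0 (min_le_right _ _) hin x hx
    have h2 := FF_ge (δ := δ) hκ hx
    have h3 := FF_le (δ := δ) hκ hx
    have h4 : ε / (Real.log (SS x) + 1) * Real.log (SS x) ≤ ε := by
      rw [div_mul_eq_mul_div, div_le_iff₀ (by positivity)]
      nlinarith
    have h5 := H_lip (show x 2 - δ ≤ x 2 - FF δ (ε / (Real.log (SS x) + 1)) (SS x) by linarith)
    linarith

theorem half_space (u : EuclideanSpace ℝ (Fin 3) → ℝ) (hu : IsACSolution u)
    (hnc : ¬ ∃ c : ℝ, ∀ x, u x = c) (hle : ∀ x, u x ≤ H (x 2)) :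
    ∃ c : ℝ, ∀ x, u x = H (x 2 - c) := by
  have hm := H_strictMono.monotone
  let A : Set ℝ := {c | ∀ x, u x ≤ H (x 2 - c)}
  have h0A : (0:ℝ) ∈ A := fun x => by simpa using hle x
  have hbdd : BddAbove A := by
    by_contra hnb
    apply hnc
    refine ⟨-1, keller_osserman u hu fun x => ?_⟩
    refine le_of_forall_pos_le_add fun η hη => ?_
    rw [not_bddAbove_iff] at hnb
    obtain ⟨c, hcA, hc⟩ := hnb (x 2 - Real.log (η / 2) / Real.sqrt 2)
    have h1 := hcA x
    have h2 := hm (show x 2 - c ≤ Real.log (η / 2) / Real.sqrt 2 by linarith)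
    rw [H_eq (Real.log (η / 2) / Real.sqrt 2), mul_div_cancel₀ _ (by positivity),
      Real.exp_log (by positivity)] at h2
    have h3 : 1 - 2 / (η / 2 + 1) ≤ -1 + η := by
      have : 2 - η ≤ 2 / (η / 2 + 1) := by
        rw [le_div_iff₀ (by positivity)]; nlinarith
      linarith
    linarith
  set c := sSup A with hc
  have hcA : ∀ x, u x ≤ H (x 2 - c) := by
    intro x
    refine le_of_forall_pos_le_add fun η hη => ?_
    obtain ⟨c', hc', hlt'⟩ := exists_lt_of_lt_csSup ⟨0, h0A⟩ (show c - η < sSup A by linarith)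
    have h1 := hc' x
    have h2 : H (x 2 - c') ≤ H (x 2 - c + η) := hm (by linarith)
    have h3 := H_lip (show x 2 - c ≤ x 2 - c + η by linarith)
    linarith
  refine ⟨c, ?_⟩
  set e : EuclideanSpace ℝ (Fin 3) := EuclideanSpace.single 2 c with he
  have hv : IsACSolution (fun x => u (x + e)) := by
    refine ⟨hu.1.comp (contDiff_id.add contDiff_const), fun x => ?_⟩
    have : laplacian (fun x => u (x + e)) x = laplacian u (x + e) := by
      unfold laplacian
      refine Finset.sum_congr rfl fun i _ => ?_
      simp only [fderiv_comp_add_right]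
      rw [fderiv_comp_add_right (f := fun y => fderiv ℝ u y (EuclideanSpace.single i (1:ℝ)))]
    rw [this]
    exact hu.2 _
  have hvle : ∀ x, u (x + e) ≤ H (x 2) := by
    intro x
    have := hcA (x + e)
    simpa [he] using this
  by_cases hall : ∀ x, u (x + e) < H (x 2)
  · exfalso
    obtain ⟨δ, hδ, h⟩ := improve _ hv hall
    have : c + δ ∈ A := by
      intro x
      have := h (x - e)
      simp only [sub_add_cancel] at this
      refine this.trans (le_of_eq ?_)
      congr 1
      simp [he]; ring
    have := le_csSup hbdd this
    linarith
  · push Not at hall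
    obtain ⟨y, hy⟩ := hall
    have hge : ∀ x, H (x 2) ≤ u (x + e) := by
      intro x
      by_contra h
      push Not at h
      have := strong_max _ hv hvle x h y
      linarith
    intro x
    have := le_antisymm (hvle (x - e)) (hge (x - e))
    simpa [he] using this

end helpers

theorem discrepancy_tendsto_zero (u : EuclideanSpace ℝ (Fin 3) → ℝ)
    (hu : IsACSolution u) (hnc : ¬ ∃ c : ℝ, ∀ x, u x = c)
    (hneg : ∀ x : EuclideanSpace ℝ (Fin 3), x 2 < 0 → u x < 0)
    (hH : ∀ x : EuclideanSpace ℝ (Fin 3), u x ≤ H (x 2))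
    (A : ℝ) (hA : 0 < A) (htanh : Real.sqrt (2 / 3) ≤ Real.tanh (A / Real.sqrt 2))
    (g : ℝ → ℝ)
    (hg : ∀ s : ℝ, g s = ∫ p in {p : ℝ × ℝ | p.1 ^ 2 + p.2 ^ 2 < s ^ 2},
      (‖gradient u (pt p.1 p.2 (-A))‖ ^ 2 / 2
        + (1 - (u (pt p.1 p.2 (-A))) ^ 2) ^ 2 / 4
        - (pd u 2 (pt p.1 p.2 (-A))) ^ 2)) :
    Filter.Tendsto g Filter.atTop (nhds 0) := by
  obtain ⟨c, hc⟩ := half_space u hu hnc hH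
  have hz : ∀ s, g s = 0 := by
    intro s
    rw [hg s]
    have hzero : ∀ x : EuclideanSpace ℝ (Fin 3), ‖gradient u x‖ ^ 2 / 2
        + (1 - u x ^ 2) ^ 2 / 4 - pd u 2 x ^ 2 = 0 := by
      intro x
      have hue : u = fun x : EuclideanSpace ℝ (Fin 3) => H (x 2 - c) := funext hc
      set d := (1 - H (x 2 - c) ^ 2) / Real.sqrt 2 with hd
      have hf : HasFDerivAt u (d • (EuclideanSpace.proj 2 : EuclideanSpace ℝ (Fin 3) →L[ℝ] ℝ)) x := by
        rw [hue]
        have h1 : HasFDerivAt (fun x : EuclideanSpace ℝ (Fin 3) => x 2 - c)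
            (EuclideanSpace.proj 2 : EuclideanSpace ℝ (Fin 3) →L[ℝ] ℝ) x :=
          (EuclideanSpace.proj 2 : EuclideanSpace ℝ (Fin 3) →L[ℝ] ℝ).hasFDerivAt.sub_const c
        have h4 := HasDerivAt.comp_hasFDerivAt (h₂ := H) (f := fun x : EuclideanSpace ℝ (Fin 3) => x 2 - c) x
          (H_hasDerivAt (x 2 - c)) h1
        exact h4
      have hg1 : gradient u x = d • EuclideanSpace.single 2 (1:ℝ) := by
        apply HasGradientAt.gradient
        rw [hasGradientAt_iff_hasFDerivAt]
        have e : InnerProductSpace.toDual ℝ _ (d • EuclideanSpace.single 2 (1:ℝ))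
            = d • (EuclideanSpace.proj 2 : EuclideanSpace ℝ (Fin 3) →L[ℝ] ℝ) := by
          ext y
          simp [inner_smul_left, EuclideanSpace.inner_single_left]
        rw [e]; exact hf
      have hp : pd u 2 x = d := by
        rw [pd, hf.fderiv]; simp
      rw [hg1, hp, norm_smul, mul_pow, hc x]
      have h2 : Real.sqrt 2 ^ 2 = 2 := Real.sq_sqrt (by norm_num)
      have h3 : d ^ 2 = (1 - H (x 2 - c) ^ 2) ^ 2 / 2 := by rw [hd, div_pow, h2]
      simp only [PiLp.norm_single, norm_one, Real.norm_eq_abs, sq_abs, one_pow, mul_one]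
      rw [h3]; ring
    simp only [hzero, MeasureTheory.integral_zero]
  have : g = fun _ => 0 := funext hz
  rw [this]
  exact tendsto_const_nhds
end

section
/- Let u₁ and u₂ be two solutions of the Allen–Cahn equation −Δu = u − u³ on ℝ² with −1 ≤ u₁(x) < u₂(x) ≤ 1 for all x ∈ ℝ². Then there exists a stable solution u₃ of the Allen–Cahn equation on ℝ² with u₁(x) ≤ u₃(x) ≤ u₂(x) for all x ∈ ℝ², where stability means that for every smooth compactly supported function φ : ℝ² → ℝ one has ∫_{ℝ²} ( |∇φ(x)|² + (3·u₃(x)² − 1)·φ(x)² ) dx ≥ 0. -/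
open scoped RealInnerProductSpace

namespace AC
open MeasureTheory Set Filter Topology
open scoped NNReal

abbrev E2 := EuclideanSpace ℝ (Fin 2)

/-! ### The two measures -/

noncomputable def dα (s : ℝ) : ℝ≥0 := ⟨Real.exp (-s ^ 2), (Real.exp_pos _).le⟩

noncomputable def cβ : ℝ := (∫ z : E2, Real.exp (-(1/2) * ‖z‖ ^ 2))⁻¹

theorem int_gauss_pos : 0 < ∫ z : E2, Real.exp (-(1/2) * ‖z‖ ^ 2) := by
  rw [GaussianFourier.integral_rexp_neg_mul_sq_norm (by norm_num)]
  positivity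

theorem cβ_pos : 0 < cβ := inv_pos.2 int_gauss_pos

theorem integrable_gauss {b : ℝ} (hb : 0 < b) :
    Integrable (fun z : E2 => Real.exp (-b * ‖z‖ ^ 2)) := by
  apply Integrable.of_integral_ne_zero
  rw [GaussianFourier.integral_rexp_neg_mul_sq_norm hb]
  positivity

theorem integrable_norm_gauss :
    Integrable (fun z : E2 => ‖z‖ * Real.exp (-(1/2) * ‖z‖ ^ 2)) := by
  refine (integrable_gauss (b := 1/4) (by norm_num)).mono' (by fun_prop) ?_
  refine Eventually.of_forall fun z => ?_
  rw [Real.norm_of_nonneg (by positivity)]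
  have h1 : ‖z‖ ≤ Real.exp (1/4 * ‖z‖ ^ 2) := by
    have := Real.add_one_le_exp (1/4 * ‖z‖ ^ 2)
    nlinarith [sq_nonneg (1 - ‖z‖ / 2)]
  calc ‖z‖ * Real.exp (-(1/2) * ‖z‖ ^ 2)
      ≤ Real.exp (1/4 * ‖z‖ ^ 2) * Real.exp (-(1/2) * ‖z‖ ^ 2) := by gcongr
    _ = _ := by rw [← Real.exp_add]; congr 1; ring

noncomputable def dβ (z : E2) : ℝ≥0 :=
  ⟨cβ * Real.exp (-(1/2) * ‖z‖ ^ 2), (mul_pos cβ_pos (Real.exp_pos _)).le⟩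

theorem measurable_dα : Measurable dα := by
  apply Measurable.subtype_mk; fun_prop

theorem measurable_dβ : Measurable dβ := by
  apply Measurable.subtype_mk; fun_prop

noncomputable def α : Measure ℝ := (volume.restrict (Ioi 0)).withDensity (fun s => (dα s : ENNReal))
noncomputable def β : Measure E2 := volume.withDensity (fun z => (dβ z : ENNReal))

theorem integral_α (h : ℝ → ℝ) : ∫ s, h s ∂α = ∫ s in Ioi 0, Real.exp (-s ^ 2) * h s := by
  rw [α, integral_withDensity_eq_integral_smul measurable_dα]
  rfl

theorem integral_β (h : E2 → ℝ) :
    ∫ s, h s ∂β = ∫ z, cβ * Real.exp (-(1/2) * ‖z‖ ^ 2) * h z := by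
  rw [β, integral_withDensity_eq_integral_smul measurable_dβ]
  rfl

theorem integrable_α {h : ℝ → ℝ} :
    Integrable h α ↔ IntegrableOn (fun s => Real.exp (-s ^ 2) * h s) (Ioi 0) := by
  rw [α, integrable_withDensity_iff_integrable_smul measurable_dα]
  rfl

theorem integrable_β {h : E2 → ℝ} :
    Integrable h β ↔ Integrable (fun z => cβ * Real.exp (-(1/2) * ‖z‖ ^ 2) * h z) := by
  rw [β, integrable_withDensity_iff_integrable_smul measurable_dβ]
  rfl

instance : IsFiniteMeasure α := by
  have h : Integrable (fun _ : ℝ => (1:ℝ)) α := by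
    rw [integrable_α]
    have := (integrable_exp_neg_mul_sq (b := 1) one_pos).integrableOn (s := Ioi 0)
    simpa using this
  exact (integrable_const_iff_isFiniteMeasure one_ne_zero).1 h

instance : IsFiniteMeasure β := by
  have h : Integrable (fun _ : E2 => (1:ℝ)) β := by
    rw [integrable_β]
    have := (integrable_gauss (b := 1/2) (by norm_num)).const_mul cβ
    simpa using this
  exact (integrable_const_iff_isFiniteMeasure one_ne_zero).1 h

theorem integral_one_β (c : ℝ) : ∫ _, c ∂β = c := by
  rw [integral_β, integral_mul_const, integral_const_mul, cβ, inv_mul_cancel₀ int_gauss_pos.ne', one_mul]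

theorem integrable_id_α : Integrable (fun s : ℝ => s) α := by
  rw [integrable_α]
  have := (integrable_mul_exp_neg_mul_sq (b := 1) one_pos).integrableOn (s := Ioi 0)
  simpa [mul_comm] using this

theorem integrable_norm_β : Integrable (fun z : E2 => ‖z‖) β := by
  rw [integrable_β]
  convert integrable_norm_gauss.const_mul cβ using 2
  ring

theorem ae_α_pos : ∀ᵐ s ∂α, 0 < s := by
  have h1 : ∀ᵐ s ∂(volume.restrict (Ioi (0:ℝ))), s ∈ Ioi (0:ℝ) := ae_restrict_mem measurableSet_Ioi
  exact (withDensity_absolutelyContinuous _ _).ae_le h1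

/-- Gaussian integration by parts. -/
theorem ibp_β {h : E2 → ℝ} (hd : ContDiff ℝ 1 h) {B C : ℝ} (hB : ∀ z, |h z| ≤ B)
    (hC : ∀ z, ‖fderiv ℝ h z‖ ≤ C) (e : E2) :
    ∫ z, fderiv ℝ h z e ∂β = ∫ z, h z * ⟪z, e⟫ ∂β := by
  rw [integral_β, integral_β]
  have hw : ∀ z : E2, HasFDerivAt (fun z : E2 => cβ * Real.exp (-(1/2) * ‖z‖ ^ 2))
      ((-(cβ * Real.exp (-(1/2) * ‖z‖ ^ 2))) • innerSL ℝ z) z := by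
    intro z
    have h1 : HasFDerivAt (fun z : E2 => ‖z‖ ^ 2) (2 • innerSL ℝ z) z :=
      (hasStrictFDerivAt_norm_sq z).hasFDerivAt
    refine (((h1.const_mul (-(1/2))).exp).const_mul cβ).congr_fderiv ?_
    ext v
    simp
    ring
  have hcont : Continuous (fderiv ℝ h) := hd.continuous_fderiv (by norm_num)
  have hce : Continuous (fun z => fderiv ℝ h z e) := hcont.clm_apply continuous_const
  have hh := hd.continuous
  have hbd : ∀ z, |fderiv ℝ h z e| ≤ C * ‖e‖ := fun z => by
    calc |fderiv ℝ h z e| ≤ ‖fderiv ℝ h z‖ * ‖e‖ := (fderiv ℝ h z).le_opNorm e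
      _ ≤ _ := by gcongr; exact hC z
  have hw' : ∀ z : E2, fderiv ℝ (fun z : E2 => cβ * Real.exp (-(1/2) * ‖z‖ ^ 2)) z e
      = -(cβ * Real.exp (-(1/2) * ‖z‖ ^ 2)) * ⟪z, e⟫ := by
    intro z; rw [(hw z).fderiv]; simp
  rw [integral_mul_fderiv_eq_neg_fderiv_mul_of_integrable]
  · rw [← integral_neg]
    congr 1; ext z; rw [hw']; ring
  · simp_rw [hw']
    have : Integrable (fun z : E2 => (cβ * B * ‖e‖) * (‖z‖ * Real.exp (-(1/2) * ‖z‖ ^ 2))) :=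
      integrable_norm_gauss.const_mul _
    refine this.mono' (by fun_prop) (Eventually.of_forall fun z => ?_)
    have h2 : |⟪z, e⟫| ≤ ‖z‖ * ‖e‖ := abs_real_inner_le_norm z e
    have h3 := hB z
    have := cβ_pos
    have hB0 : 0 ≤ B := (abs_nonneg _).trans h3
    rw [Real.norm_eq_abs, abs_mul, abs_mul, abs_neg, abs_of_pos (mul_pos this (Real.exp_pos _))]
    calc _ ≤ cβ * Real.exp (-(1/2) * ‖z‖ ^ 2) * (‖z‖ * ‖e‖) * B := by gcongr
      _ = _ := by ring
  · have : Integrable (fun z : E2 => (cβ * (C * ‖e‖)) * (Real.exp (-(1/2) * ‖z‖ ^ 2))) :=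
      (integrable_gauss (by norm_num)).const_mul _
    refine this.mono' (by fun_prop) (Eventually.of_forall fun z => ?_)
    have h3 := hbd z
    have := cβ_pos
    rw [Real.norm_eq_abs, abs_mul, abs_of_pos (mul_pos this (Real.exp_pos _))]
    calc _ ≤ cβ * Real.exp (-(1/2) * ‖z‖ ^ 2) * (C * ‖e‖) := by gcongr
      _ = _ := by ring
  · have : Integrable (fun z : E2 => (cβ * B) * (Real.exp (-(1/2) * ‖z‖ ^ 2))) :=
      (integrable_gauss (by norm_num)).const_mul _
    refine this.mono' (by fun_prop) (Eventually.of_forall fun z => ?_)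
    have h3 := hB z
    have := cβ_pos
    rw [Real.norm_eq_abs, abs_mul, abs_of_pos (mul_pos this (Real.exp_pos _))]
    calc _ ≤ cβ * Real.exp (-(1/2) * ‖z‖ ^ 2) * B := by gcongr
      _ = _ := by ring
  · intro z _; exact (hw z).differentiableAt
  · intro z _; exact (hd.differentiable (by norm_num)) z

theorem ibp_α {q q' : ℝ → ℝ} (hd : ∀ s, HasDerivAt q (q' s) s) (hq' : Continuous q') {B C : ℝ}
    (hB : ∀ z, |q z| ≤ B) (hC : ∀ z, |q' z| ≤ C) :
    ∫ s, q' s ∂α = - q 0 + 2 * ∫ s, s * q s ∂α := by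
  have hqc : Continuous q := continuous_iff_continuousAt.2 fun s => (hd s).continuousAt
  have i1 : Integrable q' α := Integrable.of_bound (by fun_prop) C (Eventually.of_forall hC)
  have i2 : Integrable (fun s => s * q s) α := by
    refine (integrable_id_α.norm.mul_const B).mono' (by fun_prop) (Eventually.of_forall fun z => ?_)
    rw [norm_mul]
    gcongr
    exact hB z
  have hder : ∀ s, HasDerivAt (fun s => Real.exp (-s ^ 2) * q s)
      (Real.exp (-s ^ 2) * (q' s - 2 * (s * q s))) s := by
    intro s
    have h1 : HasDerivAt (fun s : ℝ => Real.exp (-s ^ 2)) (Real.exp (-s ^ 2) * (-(2 * s))) s := by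
      have := ((hasDerivAt_pow 2 s).neg).exp
      simpa using this
    refine (h1.mul (hd s)).congr_deriv ?_
    ring
  have hlim : Tendsto (fun s => Real.exp (-s ^ 2) * q s) atTop (𝓝 0) := by
    have : Tendsto (fun s : ℝ => Real.exp (-s ^ 2) * B) atTop (𝓝 0) := by
      have h1 : Tendsto (fun s : ℝ => Real.exp (-s ^ 2)) atTop (𝓝 0) :=
        Real.tendsto_exp_neg_atTop_nhds_zero.comp (tendsto_pow_atTop two_ne_zero)
      simpa using h1.mul_const B
    refine squeeze_zero_norm (fun s => ?_) this
    rw [norm_mul, Real.norm_of_nonneg (Real.exp_pos _).le]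
    gcongr
    exact hB s
  have i3 : Integrable (fun s => q' s - 2 * (s * q s)) α := i1.sub (i2.const_mul 2)
  have key := integral_Ioi_of_hasDerivAt_of_tendsto' (a := 0) (fun s _ => hder s)
    (integrable_α.1 i3) hlim
  rw [← integral_α, integral_sub i1 (i2.const_mul 2), integral_const_mul] at key
  simp at key
  linarith

theorem integral_id_α : ∫ s, s ∂α = 1/2 := by
  have := ibp_α (q := fun _ => 1) (q' := fun _ => 0) (fun s => hasDerivAt_const s 1) continuous_const
    (B := 1) (C := 0) (by simp) (by simp)
  simp at this
  linarith

end AC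

open scoped RealInnerProductSpace
namespace AC
open MeasureTheory Set Filter Topology
open scoped NNReal

/-! ### The resolvent `(2 - Δ)⁻¹` and its gradient -/

noncomputable def π : Measure (ℝ × E2) := α.prod β

instance : IsFiniteMeasure π := by unfold π; infer_instance

noncomputable def G (f : E2 → ℝ) (x : E2) : ℝ := ∫ p, p.1 * f (x + p.1 • p.2) ∂π

noncomputable def D (f : E2 → ℝ) (x : E2) : E2 →L[ℝ] ℝ :=
  ∫ p, f (x + p.1 • p.2) • innerSL ℝ p.2 ∂π

theorem ae_π_pos : ∀ᵐ p ∂π, 0 < p.1 :=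
  Measure.quasiMeasurePreserving_fst.ae ae_α_pos

theorem int_fst : Integrable (fun p : ℝ × E2 => p.1) π := integrable_id_α.comp_fst β

theorem int_snd : Integrable (fun p : ℝ × E2 => ‖p.2‖) π := integrable_norm_β.comp_snd α

theorem bound_fst {f : E2 → ℝ} {B : ℝ} (hB : ∀ x, |f x| ≤ B) (x : E2) (p : ℝ × E2) :
    ‖p.1 * f (x + p.1 • p.2)‖ ≤ ‖p.1‖ * B := by
  rw [norm_mul]; gcongr; exact hB _

theorem bound_snd {f : E2 → ℝ} {B : ℝ} (hB : ∀ x, |f x| ≤ B) (x : E2) (p : ℝ × E2) :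
    ‖f (x + p.1 • p.2) • innerSL ℝ p.2‖ ≤ B * ‖p.2‖ := by
  rw [norm_smul, innerSL_apply_norm]; gcongr; exact hB _

theorem G_integrable {f : E2 → ℝ} (hf : Continuous f) {B : ℝ} (hB : ∀ x, |f x| ≤ B) (x : E2) :
    Integrable (fun p : ℝ × E2 => p.1 * f (x + p.1 • p.2)) π :=
  (int_fst.norm.mul_const B).mono' (by fun_prop) (Eventually.of_forall (bound_fst hB x))

theorem D_cont {f : E2 → ℝ} (hf : Continuous f) :
    Continuous (fun q : E2 × (ℝ × E2) => f (q.1 + q.2.1 • q.2.2) • innerSL ℝ q.2.2) := by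
  have : Continuous (fun q : E2 × (ℝ × E2) => innerSL ℝ q.2.2) :=
    (innerSL ℝ (E := E2)).continuous.comp (by fun_prop)
  fun_prop

theorem D_cont' {f : E2 → ℝ} (hf : Continuous f) (x : E2) :
    Continuous (fun p : (ℝ × E2) => f (x + p.1 • p.2) • innerSL ℝ p.2) :=
  (D_cont hf).comp (by fun_prop : Continuous (fun p : ℝ × E2 => (x, p)))

theorem D_integrable {f : E2 → ℝ} (hf : Continuous f) {B : ℝ} (hB : ∀ x, |f x| ≤ B) (x : E2) :
    Integrable (fun p : ℝ × E2 => f (x + p.1 • p.2) • innerSL ℝ p.2) π :=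
  (int_snd.const_mul B).mono' (D_cont' hf x).aestronglyMeasurable
    (Eventually.of_forall (bound_snd hB x))

theorem D_continuous {f : E2 → ℝ} (hf : Continuous f) {B : ℝ} (hB : ∀ x, |f x| ≤ B) :
    Continuous (D f) := by
  unfold D
  refine continuous_of_dominated (fun x => (D_cont' hf x).aestronglyMeasurable)
    (fun x => Eventually.of_forall (bound_snd hB x)) (int_snd.const_mul B) ?_
  refine Eventually.of_forall fun p => ?_
  exact (D_cont hf).comp (by fun_prop : Continuous (fun x : E2 => (x, p)))

noncomputable def CD : ℝ := ∫ p, ‖p.2‖ ∂π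

theorem D_bound {f : E2 → ℝ} {B : ℝ} (hB : ∀ x, |f x| ≤ B) (x : E2) :
    ‖D f x‖ ≤ B * CD := by
  rw [CD, ← integral_const_mul]
  exact norm_integral_le_of_norm_le (int_snd.const_mul B) (Eventually.of_forall (bound_snd hB x))

theorem D_apply {f : E2 → ℝ} (hf : Continuous f) {B : ℝ} (hB : ∀ x, |f x| ≤ B) (x e : E2) :
    D f x e = ∫ p, f (x + p.1 • p.2) * ⟪p.2, e⟫ ∂π := by
  rw [D, ContinuousLinearMap.integral_apply (D_integrable hf hB x)]
  rfl

theorem G_tendsto {f : ℕ → E2 → ℝ} {g : E2 → ℝ} (hf : ∀ n, Continuous (f n)) {B : ℝ}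
    (hB : ∀ n x, |f n x| ≤ B) (h : ∀ x, Tendsto (fun n => f n x) atTop (𝓝 (g x))) (x : E2) :
    Tendsto (fun n => G (f n) x) atTop (𝓝 (G g x)) := by
  refine tendsto_integral_of_dominated_convergence (fun p => ‖p.1‖ * B)
    (fun n => by have := hf n; fun_prop) (int_fst.norm.mul_const B)
    (fun n => Eventually.of_forall (bound_fst (hB n) x)) ?_
  exact Eventually.of_forall fun p => (h _).const_mul _

theorem D_tendsto {f : ℕ → E2 → ℝ} {g : E2 → ℝ} (hf : ∀ n, Continuous (f n)) {B : ℝ}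
    (hB : ∀ n x, |f n x| ≤ B) (h : ∀ x, Tendsto (fun n => f n x) atTop (𝓝 (g x))) (x : E2) :
    Tendsto (fun n => D (f n) x) atTop (𝓝 (D g x)) := by
  refine tendsto_integral_of_dominated_convergence (fun p => B * ‖p.2‖)
    (fun n => (D_cont' (hf n) x).aestronglyMeasurable) (int_snd.const_mul B)
    (fun n => Eventually.of_forall (bound_snd (hB n) x)) ?_
  exact Eventually.of_forall fun p => (h _).smul_const _

theorem G_sub {f g : E2 → ℝ} (hf : Continuous f) {B : ℝ} (hB : ∀ x, |f x| ≤ B)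
    (hg : Continuous g) {C : ℝ} (hC : ∀ x, |g x| ≤ C) (x : E2) :
    G (fun y => f y - g y) x = G f x - G g x := by
  unfold G
  rw [← integral_sub (G_integrable hf hB x) (G_integrable hg hC x)]
  congr 1; ext p; ring

theorem G_neg (f : E2 → ℝ) (x : E2) : G (fun y => - f y) x = - G f x := by
  unfold G
  rw [← integral_neg]
  congr 1; ext p; ring

theorem G_nonneg {f : E2 → ℝ} (h : ∀ x, 0 ≤ f x) (x : E2) : 0 ≤ G f x := by
  refine integral_nonneg_of_ae ?_
  filter_upwards [ae_π_pos] with p hp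
  exact mul_nonneg hp.le (h _)

theorem G_mono {f g : E2 → ℝ} (hf : Continuous f) {B : ℝ} (hB : ∀ x, |f x| ≤ B)
    (hg : Continuous g) {C : ℝ} (hC : ∀ x, |g x| ≤ C) (h : ∀ x, f x ≤ g x) (x : E2) :
    G f x ≤ G g x := by
  have := G_nonneg (f := fun y => g y - f y) (fun y => sub_nonneg.2 (h y)) x
  rw [G_sub hg hC hf hB] at this
  linarith

theorem integral_fst : ∫ p : ℝ × E2, p.1 ∂π = 1/2 := by
  rw [π, integral_prod _ int_fst]
  simp_rw [integral_one_β]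
  exact integral_id_α

theorem G_bound {f : E2 → ℝ} {B : ℝ} (hB : ∀ x, |f x| ≤ B) (x : E2) : |G f x| ≤ B / 2 := by
  have h1 : ‖G f x‖ ≤ ∫ p : ℝ × E2, p.1 * B ∂π := by
    refine norm_integral_le_of_norm_le (int_fst.mul_const B) ?_
    filter_upwards [ae_π_pos] with p hp
    have := bound_fst hB x p
    rwa [Real.norm_of_nonneg hp.le] at this
  rw [integral_mul_const, integral_fst, Real.norm_eq_abs] at h1
  linarith

theorem α_open_pos {U : Set ℝ} (hU : IsOpen U) (hpos : U ⊆ Ioi 0) (hne : U.Nonempty) : α U ≠ 0 := by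
  intro h
  rw [α, withDensity_apply_eq_zero (by exact (measurable_dα.coe_nnreal_ennreal))] at h
  have : {x | (dα x : ENNReal) ≠ 0} ∩ U = U := by
    ext x; simp only [mem_inter_iff, mem_ofPred_eq, and_iff_right_iff_imp]
    intro _
    rw [ENNReal.coe_ne_zero]
    intro h0
    have := congrArg NNReal.toReal h0
    exact (Real.exp_pos _).ne' this
  rw [this, Measure.restrict_apply hU.measurableSet, inter_eq_self_of_subset_left hpos] at h
  exact hU.measure_ne_zero volume hne h

theorem β_open_pos {U : Set E2} (hU : IsOpen U) (hne : U.Nonempty) : β U ≠ 0 := by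
  intro h
  rw [β, withDensity_apply_eq_zero (by exact (measurable_dβ.coe_nnreal_ennreal))] at h
  have : {x | (dβ x : ENNReal) ≠ 0} ∩ U = U := by
    ext x; simp only [mem_inter_iff, mem_ofPred_eq, and_iff_right_iff_imp]
    intro _
    rw [ENNReal.coe_ne_zero]
    intro h0
    have := congrArg NNReal.toReal h0
    exact (mul_pos cβ_pos (Real.exp_pos _)).ne' this
  rw [this] at h
  exact hU.measure_ne_zero volume hne h

theorem G_pos {f : E2 → ℝ} (hf : Continuous f) {B : ℝ} (hB : ∀ x, |f x| ≤ B)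
    (h : ∀ x, 0 ≤ f x) {y : E2} (hy : 0 < f y) (x : E2) : 0 < G f x := by
  unfold G
  rw [integral_pos_iff_support_of_nonneg_ae _ (G_integrable hf hB x)]
  · rw [pos_iff_ne_zero]
    have hop : IsOpen {p : ℝ × E2 | 0 < p.1 ∧ 0 < f (x + p.1 • p.2)} := by
      have o1 : IsOpen {p : ℝ × E2 | 0 < p.1} := isOpen_lt continuous_const continuous_fst
      have o2 : IsOpen {p : ℝ × E2 | 0 < f (x + p.1 • p.2)} :=
        isOpen_lt continuous_const (by fun_prop)
      exact o1.inter o2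
    have hmem : ((1:ℝ), y - x) ∈ {p : ℝ × E2 | 0 < p.1 ∧ 0 < f (x + p.1 • p.2)} := by
      simp [hy]
    obtain ⟨U, V, hU, hV, h1, h2, hUV⟩ := isOpen_prod_iff.1 hop _ _ hmem
    intro h0
    have hsub : U ×ˢ V ⊆ Function.support (fun p : ℝ × E2 => p.1 * f (x + p.1 • p.2)) := by
      intro p hp
      have := hUV hp
      exact (mul_pos this.1 this.2).ne'
    have h3 := measure_mono_null hsub h0
    rw [π, Measure.prod_prod, mul_eq_zero] at h3
    rcases h3 with h3 | h3
    · refine α_open_pos hU ?_ ⟨_, h1⟩ h3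
      intro s hs
      exact (hUV (mk_mem_prod hs h2)).1
    · exact β_open_pos hV ⟨_, h2⟩ h3
  · filter_upwards [ae_π_pos] with p hp
    exact mul_nonneg hp.le (h _)

end AC

open scoped RealInnerProductSpace
namespace AC
open MeasureTheory Set Filter Topology
open scoped NNReal

/-! ### Mollification -/

noncomputable def bump (n : ℕ) : ContDiffBump (0 : E2) where
  rIn := 1 / ((n : ℝ) + 1) / 2
  rOut := 1 / ((n : ℝ) + 1)
  rIn_pos := by positivity
  rIn_lt_rOut := half_lt_self (by positivity)

open scoped Convolution in
theorem mollify {f : E2 → ℝ} (hf : Continuous f) {B : ℝ} (hB : ∀ x, |f x| ≤ B) :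
    ∃ g : ℕ → E2 → ℝ, (∀ n, ContDiff ℝ 1 (g n)) ∧ (∀ n x, |g n x| ≤ B) ∧
      (∀ n, ∃ C, ∀ x, ‖fderiv ℝ (g n) x‖ ≤ C) ∧
      ((∀ x, 0 ≤ f x) → ∀ n x, 0 ≤ g n x) ∧
      ∀ x, Tendsto (fun n => g n x) atTop (𝓝 (f x)) := by
  have hcs : ∀ n, HasCompactSupport ((bump n).normed volume) := fun n => (bump n).hasCompactSupport_normed
  have hsm : ∀ n, ContDiff ℝ 1 ((bump n).normed volume) := fun n => (bump n).contDiff_normed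
  refine ⟨fun n => ((bump n).normed volume) ⋆[ContinuousLinearMap.lsmul ℝ ℝ, volume] f,
    fun n => ?_, fun n x => ?_, fun n => ?_, fun h n x => ?_, fun x => ?_⟩
  · exact (hcs n).contDiff_convolution_left _ (hsm n) hf.locallyIntegrable
  · have h1 : ‖∫ t, ((bump n).normed volume t) * f (x - t)‖ ≤ ∫ t, (bump n).normed volume t * B := by
      refine norm_integral_le_of_norm_le ((bump n).integrable_normed.mul_const B)
        (Eventually.of_forall fun t => ?_)
      rw [norm_mul, Real.norm_of_nonneg ((bump n).nonneg_normed t)]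
      gcongr
      · exact (bump n).nonneg_normed t
      · exact hB _
    rw [integral_mul_const, (bump n).integral_normed, one_mul] at h1
    exact h1
  · have hi : Integrable (fderiv ℝ ((bump n).normed volume)) :=
      ((hsm n).continuous_fderiv (by norm_num)).integrable_of_hasCompactSupport ((hcs n).fderiv ℝ)
    refine ⟨∫ t, ‖fderiv ℝ ((bump n).normed volume) t‖ * B, fun x => ?_⟩
    rw [((hcs n).hasFDerivAt_convolution_left (ContinuousLinearMap.lsmul ℝ ℝ) (hsm n)
      hf.locallyIntegrable x).fderiv]
    refine norm_integral_le_of_norm_le (hi.norm.mul_const B) (Eventually.of_forall fun t => ?_)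
    refine ContinuousLinearMap.opNorm_le_bound _ (mul_nonneg (norm_nonneg _) ((abs_nonneg _).trans (hB x))) fun v => ?_
    have : ((ContinuousLinearMap.precompL E2 (ContinuousLinearMap.lsmul ℝ ℝ))
        (fderiv ℝ ((bump n).normed volume) t) (f (x - t))) v
        = fderiv ℝ ((bump n).normed volume) t v * f (x - t) := by
      simp
    rw [this, norm_mul]
    calc _ ≤ (‖fderiv ℝ ((bump n).normed volume) t‖ * ‖v‖) * B := by
          gcongr
          · exact ContinuousLinearMap.le_opNorm _ _
          · exact hB _
      _ = _ := by ring
  · exact integral_nonneg fun t => mul_nonneg ((bump n).nonneg_normed t) (h _)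
  · exact ContDiffBump.convolution_tendsto_right_of_continuous
      (φ := bump) tendsto_one_div_add_atTop_nhds_zero_nat hf x

/-! ### Differentiating `G` -/

theorem hasFDerivAt_G_aux {f : E2 → ℝ} (hf : ContDiff ℝ 1 f) {B C : ℝ} (hB : ∀ x, |f x| ≤ B)
    (hC : ∀ x, ‖fderiv ℝ f x‖ ≤ C) (x : E2) :
    HasFDerivAt (G f) (∫ p : ℝ × E2, p.1 • fderiv ℝ f (x + p.1 • p.2) ∂π) x := by
  have hfc := hf.continuous
  have hf' : Continuous (fderiv ℝ f) := hf.continuous_fderiv (by norm_num)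
  refine hasFDerivAt_integral_of_dominated_of_fderiv_le (s := univ)
    (F' := fun x p => p.1 • fderiv ℝ f (x + p.1 • p.2))
    (bound := fun p => ‖p.1‖ * C) univ_mem
    (Eventually.of_forall fun x => (G_integrable hfc hB x).1) (G_integrable hfc hB x)
    (Continuous.aestronglyMeasurable (by fun_prop)) ?_ (int_fst.norm.mul_const C) ?_
  · refine Eventually.of_forall fun p x _ => ?_
    rw [norm_smul]; gcongr; exact hC _
  · refine Eventually.of_forall fun p x _ => ?_
    have h1 : HasFDerivAt (fun y : E2 => y + p.1 • p.2) (ContinuousLinearMap.id ℝ E2) x :=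
      (hasFDerivAt_id x).add_const _
    have h2 := ((hf.differentiable (by norm_num)) (x + p.1 • p.2)).hasFDerivAt
    have h3 := (h2.comp x h1).const_mul p.1
    simpa using h3

theorem fderiv_integrable {f : E2 → ℝ} (hf : ContDiff ℝ 1 f) {C : ℝ}
    (hC : ∀ x, ‖fderiv ℝ f x‖ ≤ C) (x : E2) :
    Integrable (fun p : ℝ × E2 => p.1 • fderiv ℝ f (x + p.1 • p.2)) π := by
  have hf' : Continuous (fderiv ℝ f) := hf.continuous_fderiv (by norm_num)
  refine (int_fst.norm.mul_const C).mono' (Continuous.aestronglyMeasurable (by fun_prop))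
    (Eventually.of_forall fun p => ?_)
  rw [norm_smul]; gcongr; exact hC _

theorem partial_bound {f : E2 → ℝ} {C : ℝ} (hC : ∀ x, ‖fderiv ℝ f x‖ ≤ C) (e x : E2) :
    |fderiv ℝ f x e| ≤ C * ‖e‖ :=
  ((fderiv ℝ f x).le_opNorm e).trans (by gcongr; exact hC x)

theorem partial_cont {f : E2 → ℝ} (hf : ContDiff ℝ 1 f) (e : E2) :
    Continuous (fun x => fderiv ℝ f x e) :=
  (hf.continuous_fderiv (by norm_num)).clm_apply continuous_const

theorem fderiv_G_apply {f : E2 → ℝ} (hf : ContDiff ℝ 1 f) {B C : ℝ} (hB : ∀ x, |f x| ≤ B)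
    (hC : ∀ x, ‖fderiv ℝ f x‖ ≤ C) (x e : E2) :
    fderiv ℝ (G f) x e = G (fun y => fderiv ℝ f y e) x := by
  rw [(hasFDerivAt_G_aux hf hB hC x).fderiv,
    ContinuousLinearMap.integral_apply (fderiv_integrable hf hC x)]
  rfl

theorem D_eq_aux {f : E2 → ℝ} (hf : ContDiff ℝ 1 f) {B C : ℝ} (hB : ∀ x, |f x| ≤ B)
    (hC : ∀ x, ‖fderiv ℝ f x‖ ≤ C) (x e : E2) :
    G (fun y => fderiv ℝ f y e) x = D f x e := by
  have i1 := G_integrable (partial_cont hf e) (partial_bound hC e) x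
  have i2 : Integrable (fun p : ℝ × E2 => f (x + p.1 • p.2) * ⟪p.2, e⟫) π :=
    (D_integrable hf.continuous hB x).apply_continuousLinearMap e
  rw [D_apply hf.continuous hB, G]
  rw [π] at i1 i2 ⊢
  rw [integral_prod _ i1, integral_prod _ i2]
  congr 1; ext s
  have hd : ∀ z : E2, HasFDerivAt (fun z : E2 => f (x + s • z)) (s • fderiv ℝ f (x + s • z)) z := by
    intro z
    have h1 : HasFDerivAt (fun y : E2 => x + s • y) (s • ContinuousLinearMap.id ℝ E2) z :=
      ((hasFDerivAt_id z).const_smul s).const_add x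
    have h2 := ((hf.differentiable (by norm_num)) (x + s • z)).hasFDerivAt
    have h3 := (h2.comp z h1)
    refine h3.congr_fderiv ?_
    ext v; simp
  have := ibp_β (h := fun z => f (x + s • z)) (hf.comp (by fun_prop)) (B := B) (C := |s| * C)
    (fun z => hB _) (fun z => by
      rw [(hd z).fderiv, norm_smul, Real.norm_eq_abs]; gcongr; exact hC _) e
  rw [← this]
  congr 1; ext z
  rw [(hd z).fderiv]; rfl

theorem hasFDerivAt_G_C1 {f : E2 → ℝ} (hf : ContDiff ℝ 1 f) {B C : ℝ} (hB : ∀ x, |f x| ≤ B)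
    (hC : ∀ x, ‖fderiv ℝ f x‖ ≤ C) (x : E2) : HasFDerivAt (G f) (D f x) x := by
  have h1 := hasFDerivAt_G_aux hf hB hC x
  convert h1 using 1
  ext e
  rw [← h1.fderiv, fderiv_G_apply hf hB hC, D_eq_aux hf hB hC]

theorem G_ftc {f : E2 → ℝ} (hf : Continuous f) {B : ℝ} (hB : ∀ x, |f x| ≤ B) (x h : E2) :
    G f (x + h) - G f x = ∫ t in (0:ℝ)..1, D f (x + t • h) h := by
  obtain ⟨g, hg, hgB, hgC, -, hlim⟩ := mollify hf hB
  have h1 : ∀ n, ∫ t in (0:ℝ)..1, D (g n) (x + t • h) h = G (g n) (x + h) - G (g n) x := by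
    intro n
    obtain ⟨C, hC⟩ := hgC n
    have hc := D_continuous (hg n).continuous (hgB n)
    have := intervalIntegral.integral_eq_sub_of_hasDerivAt (a := (0:ℝ)) (b := 1)
      (f := fun t : ℝ => G (g n) (x + t • h)) (f' := fun t => D (g n) (x + t • h) h)
      (fun t _ => by
        have h1 : HasDerivAt (fun t : ℝ => x + t • h) h t := by
          simpa using ((hasDerivAt_id t).smul_const h).const_add x
        exact (hasFDerivAt_G_C1 (hg n) (hgB n) hC (x + t • h)).comp_hasDerivAt t h1)
      (Continuous.intervalIntegrable (by fun_prop) _ _)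
    simpa using this
  have l1 : Tendsto (fun n => G (g n) (x + h) - G (g n) x) atTop (𝓝 (G f (x + h) - G f x)) :=
    (G_tendsto (fun n => (hg n).continuous) hgB hlim _).sub
      (G_tendsto (fun n => (hg n).continuous) hgB hlim _)
  refine tendsto_nhds_unique l1 ?_
  simp_rw [← h1]
  refine intervalIntegral.tendsto_integral_filter_of_dominated_convergence (fun _ => B * CD * ‖h‖)
    (Eventually.of_forall fun n => ?_) (Eventually.of_forall fun n => Eventually.of_forall fun t _ => ?_)
    (by simp) (Eventually.of_forall fun t _ => ?_)
  · have hc := D_continuous (hg n).continuous (hgB n)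
    exact Continuous.aestronglyMeasurable (by fun_prop)
  · exact (ContinuousLinearMap.le_opNorm _ _).trans (by gcongr; exact D_bound (hgB n) _)
  · have := D_tendsto (fun n => (hg n).continuous) hgB hlim (x + t • h)
    exact ((ContinuousLinearMap.apply ℝ ℝ h).continuous.tendsto _).comp this

theorem hasFDerivAt_G {f : E2 → ℝ} (hf : Continuous f) {B : ℝ} (hB : ∀ x, |f x| ≤ B) (x : E2) :
    HasFDerivAt (G f) (D f x) x := by
  have hc := D_continuous hf hB
  rw [hasFDerivAt_iff_isLittleO_nhds_zero, Asymptotics.isLittleO_iff]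
  intro ε hε
  obtain ⟨δ, hδ, h⟩ := Metric.continuousAt_iff.1 (hc.continuousAt (x := x)) ε hε
  filter_upwards [Metric.ball_mem_nhds (0 : E2) hδ] with v hv
  rw [G_ftc hf hB]
  have hci : IntervalIntegrable (fun t : ℝ => D f (x + t • v) v) volume 0 1 :=
    Continuous.intervalIntegrable (by fun_prop) _ _
  have h2 : (∫ t in (0:ℝ)..1, D f (x + t • v) v) - D f x v
      = ∫ t in (0:ℝ)..1, (D f (x + t • v) v - D f x v) := by
    rw [intervalIntegral.integral_sub hci (by simp)]
    simp
  rw [h2]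
  have := intervalIntegral.norm_integral_le_of_norm_le_const (a := (0:ℝ)) (b := 1)
    (f := fun t => D f (x + t • v) v - D f x v) (C := ε * ‖v‖) (fun t ht => ?_)
  · simpa using this
  · rw [uIoc_of_le zero_le_one] at ht
    rw [← sub_apply]
    refine (ContinuousLinearMap.le_opNorm _ _).trans ?_
    gcongr
    rw [← dist_eq_norm]
    apply le_of_lt
    apply h
    rw [dist_eq_norm, add_sub_cancel_left, norm_smul, Real.norm_of_nonneg ht.1.le]
    rw [mem_ball_zero_iff] at hv
    nlinarith [norm_nonneg v, ht.2]

theorem G_contDiff_one {f : E2 → ℝ} (hf : Continuous f) {B : ℝ} (hB : ∀ x, |f x| ≤ B) :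
    ContDiff ℝ 1 (G f) := by
  rw [contDiff_one_iff_hasFDerivAt]
  exact ⟨D f, D_continuous hf hB, hasFDerivAt_G hf hB⟩

theorem G_fderiv_bound {f : E2 → ℝ} (hf : Continuous f) {B : ℝ} (hB : ∀ x, |f x| ≤ B) (x : E2) :
    ‖fderiv ℝ (G f) x‖ ≤ B * CD := by
  rw [(hasFDerivAt_G hf hB x).fderiv]; exact D_bound hB x

theorem G_contDiff_two {f : E2 → ℝ} (hf : ContDiff ℝ 1 f) {B C : ℝ} (hB : ∀ x, |f x| ≤ B)
    (hC : ∀ x, ‖fderiv ℝ f x‖ ≤ C) : ContDiff ℝ 2 (G f) := by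
  have h1 : ContDiff ℝ (1 + 1) (G f) := by
    rw [contDiff_succ_iff_fderiv_apply]
    refine ⟨(G_contDiff_one hf.continuous hB).differentiable (by norm_num), by simp, fun e => ?_⟩
    simp_rw [fderiv_G_apply hf hB hC]
    exact G_contDiff_one (partial_cont hf e) (partial_bound hC e)
  exact h1

theorem sum_coord (L : E2 →L[ℝ] ℝ) (z : E2) :
    ∑ i : Fin 2, L (EuclideanSpace.single i 1) * ⟪z, EuclideanSpace.single i (1:ℝ)⟫ = L z := by
  have : z = ∑ i : Fin 2, z i • EuclideanSpace.single i (1:ℝ) := by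
    ext j; fin_cases j <;> simp
  conv_rhs => rw [this]
  rw [map_sum]
  refine Finset.sum_congr rfl fun i _ => ?_
  rw [map_smul, EuclideanSpace.inner_single_right]
  simp [mul_comm]

theorem laplacian_G {f : E2 → ℝ} (hf : ContDiff ℝ 1 f) {B C : ℝ} (hB : ∀ x, |f x| ≤ B)
    (hC : ∀ x, ‖fderiv ℝ f x‖ ≤ C) (x : E2) : laplacian (G f) x = 2 * G f x - f x := by
  have hf' : Continuous (fderiv ℝ f) := hf.continuous_fderiv (by norm_num)
  unfold laplacian
  simp_rw [fderiv_G_apply hf hB hC]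
  have h1 : ∀ i : Fin 2, fderiv ℝ (G fun z => fderiv ℝ f z (EuclideanSpace.single i 1)) x
      (EuclideanSpace.single i 1) = ∫ p : ℝ × E2, fderiv ℝ f (x + p.1 • p.2) (EuclideanSpace.single i 1)
        * ⟪p.2, EuclideanSpace.single i (1:ℝ)⟫ ∂π := by
    intro i
    rw [(hasFDerivAt_G (partial_cont hf _) (partial_bound hC _) x).fderiv,
      D_apply (partial_cont hf _) (partial_bound hC _)]
  have h2 : ∀ i : Fin 2, Integrable (fun p : ℝ × E2 => fderiv ℝ f (x + p.1 • p.2)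
      (EuclideanSpace.single i 1) * ⟪p.2, EuclideanSpace.single i (1:ℝ)⟫) π := fun i =>
    (D_integrable (partial_cont hf (EuclideanSpace.single i 1))
      (partial_bound hC _) x).apply_continuousLinearMap (EuclideanSpace.single i 1)
  simp_rw [h1]
  rw [← integral_finsetSum _ (fun i _ => h2 i)]
  simp_rw [sum_coord]
  have i1 : Integrable (fun p : ℝ × E2 => fderiv ℝ f (x + p.1 • p.2) p.2) π := by
    refine (int_snd.const_mul C).mono' (Continuous.aestronglyMeasurable (by fun_prop))
      (Eventually.of_forall fun p => ?_)
    exact (ContinuousLinearMap.le_opNorm _ _).trans (by gcongr; exact hC _)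
  have i2 := G_integrable hf.continuous hB x
  rw [G]
  rw [π] at i1 i2 ⊢
  rw [integral_prod_symm _ i1, integral_prod_symm _ i2]
  have h3 : ∀ z : E2, ∫ s : ℝ, fderiv ℝ f (x + s • z) z ∂α
      = - f x + 2 * ∫ s, s * f (x + s • z) ∂α := by
    intro z
    have hd : ∀ s : ℝ, HasDerivAt (fun s : ℝ => f (x + s • z)) (fderiv ℝ f (x + s • z) z) s := by
      intro s
      have h1 : HasDerivAt (fun t : ℝ => x + t • z) z s := by
        simpa using ((hasDerivAt_id s).smul_const z).const_add x
      exact ((hf.differentiable (by norm_num)) (x + s • z)).hasFDerivAt.comp_hasDerivAt s h1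
    have := ibp_α hd (by fun_prop) (B := B) (C := C * ‖z‖) (fun _ => hB _)
      (fun s => partial_bound hC z _)
    simpa using this
  simp_rw [h3]
  rw [integral_add (integrable_const _) (i2.integral_prod_right.const_mul 2), integral_one_β,
    integral_const_mul]
  ring

end AC

open scoped RealInnerProductSpace
namespace AC
open MeasureTheory Set Filter Topology
open scoped NNReal

def F (t : ℝ) : ℝ := 3 * t - t ^ 3

theorem F_neg (t : ℝ) : F (-t) = - F t := by unfold F; ring

theorem F_cont : Continuous F := by unfold F; fun_prop

theorem F_bound {t : ℝ} (h : |t| ≤ 1) : |F t| ≤ 2 := by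
  obtain ⟨h1, h2⟩ := abs_le.1 h
  unfold F
  rw [abs_le]
  constructor
  · nlinarith [mul_nonneg (sub_nonneg.2 h2) (sq_nonneg (1 - t)), mul_nonneg (by linarith : 0 ≤ 2 - t) (sq_nonneg (1 + t))]
  · nlinarith [mul_nonneg (by linarith : 0 ≤ 2 + t) (sq_nonneg (1 - t))]

noncomputable def T (v : E2 → ℝ) (x : E2) : ℝ := G (fun y => F (v y)) x

theorem isAC_of_fixed {u : E2 → ℝ} (hu : Continuous u) (hb : ∀ x, |u x| ≤ 1)
    (hT : ∀ x, u x = T u x) : IsACSolution u := by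
  have hg : Continuous (fun y => F (u y)) := F_cont.comp hu
  have hgB : ∀ x, |F (u x)| ≤ 2 := fun x => F_bound (hb x)
  have hfun : u = G (fun y => F (u y)) := funext hT
  have hu1 : ContDiff ℝ 1 u := by rw [hfun]; exact G_contDiff_one hg hgB
  have huC : ∀ x, ‖fderiv ℝ u x‖ ≤ 2 * CD := fun x => by
    have := G_fderiv_bound hg hgB x
    rwa [← hfun] at this
  have hCD : 0 ≤ 2 * CD := (norm_nonneg _).trans (huC 0)
  have hg1 : ContDiff ℝ 1 (fun y => F (u y)) := by unfold F; fun_prop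
  have hgC : ∀ x, ‖fderiv ℝ (fun y => F (u y)) x‖ ≤ 3 * (2 * CD) := fun x => by
    have hd : HasDerivAt F (3 - 3 * (u x) ^ 2) (u x) := by
      have := ((hasDerivAt_id (u x)).const_mul 3).sub (hasDerivAt_pow 3 (u x))
      exact this.congr_deriv (by simp)
    have h2 := hd.comp_hasFDerivAt x ((hu1.differentiable (by norm_num)) x).hasFDerivAt
    have h3 : fderiv ℝ (fun y => F (u y)) x = (3 - 3 * (u x) ^ 2) • fderiv ℝ u x := h2.fderiv
    rw [h3, norm_smul]
    have h4 : ‖3 - 3 * (u x) ^ 2‖ ≤ 3 := by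
      obtain ⟨h5, h6⟩ := abs_le.1 (hb x)
      rw [Real.norm_eq_abs, abs_le]; constructor <;> nlinarith
    gcongr
    exact huC x
  refine ⟨?_, fun x => ?_⟩
  · rw [hfun]; exact G_contDiff_two hg1 hgB hgC
  · have := laplacian_G hg1 hgB hgC x
    rw [← hfun] at this
    rw [this]; unfold F; ring

/-! ### Maximum principle -/

theorem second_deriv_test {q q' : ℝ → ℝ} {c : ℝ} (h1 : ∀ t, HasDerivAt q (q' t) t)
    (h2 : HasDerivAt q' c 0) (hmax : ∀ t, q t ≤ q 0) : c ≤ 0 := by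
  by_contra hc
  push Not at hc
  have hq : deriv q = q' := funext fun t => (h1 t).deriv
  have hl : IsLocalMax q 0 := Eventually.of_forall hmax
  have hm : IsLocalMin q 0 := isLocalMin_of_deriv_deriv_pos (by rw [hq, h2.deriv]; exact hc)
    hl.deriv_eq_zero (h1 0).continuousAt
  have he : ∀ᶠ t in 𝓝 0, q t = q 0 := by
    filter_upwards [hm] with t ht
    exact le_antisymm (hmax t) ht
  have he2 : ∀ᶠ t in 𝓝 0, q' t = 0 := by
    filter_upwards [he.eventually_nhds] with t ht
    have h3 : HasDerivAt q 0 t := (hasDerivAt_const t (q 0)).congr_of_eventuallyEq ht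
    exact (h1 t).unique h3
  have h4 : HasDerivAt q' 0 0 := (hasDerivAt_const 0 (0:ℝ)).congr_of_eventuallyEq he2
  have := h2.unique h4
  linarith

theorem partial_contDiff {h : E2 → ℝ} (hh : ContDiff ℝ 2 h) (e : E2) :
    ContDiff ℝ 1 (fun y => fderiv ℝ h y e) :=
  (hh.fderiv_right (m := 1) (by norm_num)).clm_apply contDiff_const

theorem laplacian_le_of_max {h : E2 → ℝ} (hh : ContDiff ℝ 2 h) {δ : ℝ} {x₀ x : E2}
    (hmax : ∀ y, h y - δ * ‖y - x₀‖ ^ 2 ≤ h x - δ * ‖x - x₀‖ ^ 2) : laplacian h x ≤ 4 * δ := by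
  have key : ∀ e : E2, ‖e‖ = 1 → fderiv ℝ (fun y => fderiv ℝ h y e) x e ≤ 2 * δ := by
    intro e he
    have hline : ∀ t : ℝ, HasDerivAt (fun t : ℝ => x + t • e) e t := fun t => by
      simpa using ((hasDerivAt_id t).smul_const e).const_add x
    have hline' : ∀ t : ℝ, HasDerivAt (fun t : ℝ => x + t • e - x₀) e t := fun t =>
      (hline t).sub_const _
    have := second_deriv_test (q := fun t => h (x + t • e) - δ * ‖x + t • e - x₀‖ ^ 2)
      (q' := fun t => fderiv ℝ h (x + t • e) e - δ * (2 * ⟪x + t • e - x₀, e⟫))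
      (c := fderiv ℝ (fun y => fderiv ℝ h y e) x e - δ * (2 * ⟪e, e⟫))
      (fun t => by
        refine HasDerivAt.sub ?_ ?_
        · exact ((hh.differentiable (by norm_num)) _).hasFDerivAt.comp_hasDerivAt t (hline t)
        · exact ((hline' t).norm_sq).const_mul δ)
      (by
        refine HasDerivAt.sub ?_ ?_
        · have h1 := (((partial_contDiff hh e).differentiable (by norm_num)) (x + (0:ℝ) • e)).hasFDerivAt.comp_hasDerivAt 0 (hline 0)
          rw [zero_smul, add_zero] at h1
          exact h1
        · have h1 := (hline' 0).inner ℝ (hasDerivAt_const (0:ℝ) e)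
          simp only [inner_zero_right, zero_add] at h1
          exact (h1.const_mul 2).const_mul δ)
      (fun t => by simpa using hmax (x + t • e))
    rw [real_inner_self_eq_norm_sq, he] at this
    linarith
  unfold laplacian
  rw [Fin.sum_univ_two]
  have h0 := key (EuclideanSpace.single 0 1) (by simp)
  have h1 := key (EuclideanSpace.single 1 1) (by simp)
  linarith

theorem laplacian_sub {f g : E2 → ℝ} (hf : ContDiff ℝ 2 f) (hg : ContDiff ℝ 2 g) (x : E2) :
    laplacian (fun y => f y - g y) x = laplacian f x - laplacian g x := by
  unfold laplacian
  rw [← Finset.sum_sub_distrib]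
  refine Finset.sum_congr rfl fun i _ => ?_
  have h1 : ∀ y, fderiv ℝ (fun y => f y - g y) y = fderiv ℝ f y - fderiv ℝ g y := fun y =>
    fderiv_fun_sub (hf.differentiable (by norm_num) y) (hg.differentiable (by norm_num) y)
  simp_rw [h1, sub_apply]
  rw [fderiv_fun_sub ((partial_contDiff hf _).differentiable (by norm_num) x)
    ((partial_contDiff hg _).differentiable (by norm_num) x)]
  rfl

theorem laplacian_neg (f : E2 → ℝ) (x : E2) :
    laplacian (fun y => - f y) x = - laplacian f x := by
  unfold laplacian
  rw [← Finset.sum_neg_distrib]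
  refine Finset.sum_congr rfl fun i _ => ?_
  have h1 : ∀ y, fderiv ℝ (fun y => - f y) y = - fderiv ℝ f y := fun y => fderiv_fun_neg
  simp_rw [h1, neg_apply]
  rw [fderiv_fun_neg]
  rfl

theorem isAC_neg {u : E2 → ℝ} (hu : IsACSolution u) : IsACSolution (fun y => - u y) := by
  refine ⟨hu.1.neg, fun x => ?_⟩
  have := hu.2 x
  rw [laplacian_neg]
  linarith [this, show (-u x)^3 = -(u x)^3 by ring]

noncomputable def cut (x₀ : E2) (n : ℕ) : ContDiffBump x₀ where
  rIn := 3 * ((n : ℝ) + 1)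
  rOut := 3 * ((n : ℝ) + 1) + 1
  rIn_pos := by positivity
  rIn_lt_rOut := by linarith

theorem le_T {u : E2 → ℝ} (hu : IsACSolution u) (hb : ∀ x, |u x| ≤ 1) (x₀ : E2) :
    u x₀ ≤ T u x₀ := by
  have huc := hu.1.continuous
  have hg2 : ContDiff ℝ 2 (fun y => F (u y)) := by have := hu.1; unfold F; fun_prop
  set g : ℕ → E2 → ℝ := fun n y => cut x₀ n y * F (u y) with hg
  have hgd : ∀ n, ContDiff ℝ 1 (g n) := fun n =>
    ((cut x₀ n).contDiff.mul (hg2.of_le (by norm_num)))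
  have hgB : ∀ n x, |g n x| ≤ 2 := fun n x => by
    rw [hg]; simp only [abs_mul]
    have h1 := (cut x₀ n).nonneg (x := x)
    have h2 := (cut x₀ n).le_one (x := x)
    have h3 := F_bound (hb x)
    rw [abs_of_nonneg h1]
    nlinarith [abs_nonneg (F (u x))]
  have hgcs : ∀ n, HasCompactSupport (g n) := fun n =>
    (cut x₀ n).hasCompactSupport.mul_right
  have hgC : ∀ n, ∃ C, ∀ x, ‖fderiv ℝ (g n) x‖ ≤ C := fun n => by
    obtain ⟨C, hC⟩ := ((hgcs n).fderiv ℝ).exists_bound_of_continuous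
      ((hgd n).continuous_fderiv (by norm_num))
    exact ⟨C, hC⟩
  have hlim : Tendsto (fun n => G (g n) x₀) atTop (𝓝 (T u x₀)) := by
    refine G_tendsto (fun n => (hgd n).continuous) hgB (fun x => ?_) x₀
    refine tendsto_const_nhds.congr' ?_
    obtain ⟨N, hN⟩ := exists_nat_ge (dist x x₀)
    filter_upwards [eventually_ge_atTop N] with n hn
    have : (cut x₀ n) x = 1 := by
      apply (cut x₀ n).one_of_mem_closedBall
      have : (N:ℝ) ≤ n := by exact_mod_cast hn
      simp only [Metric.mem_closedBall, cut]
      linarith [(Nat.cast_nonneg n : (0:ℝ) ≤ n)]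
    simp [hg, this]
  have hmain : ∀ n : ℕ, u x₀ - G (g n) x₀ ≤ 2 * (1 / ((n:ℝ) + 1)) := by
    intro n
    obtain ⟨C, hC⟩ := hgC n
    have hG2 := G_contDiff_two (hgd n) (hgB n) hC
    set δ : ℝ := 1 / ((n:ℝ) + 1) with hδ
    have hn : (0:ℝ) < (n:ℝ) + 1 := by positivity
    have hδp : 0 < δ := by positivity
    set h : E2 → ℝ := fun y => u y - G (g n) y with hh
    have hh2 : ContDiff ℝ 2 h := hu.1.sub hG2
    have hhb : ∀ y, |h y| ≤ 2 := fun y => by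
      have h1 := abs_le.1 (hb y)
      have h2 := abs_le.1 (G_bound (hgB n) y)
      rw [hh, abs_le]; constructor <;> simp only <;> linarith [h1.1, h1.2, h2.1, h2.2]
    have hhc := hh2.continuous
    obtain ⟨x, hx, hxm⟩ := (isCompact_closedBall x₀ (3 * ((n:ℝ) + 1))).exists_isMaxOn
      (f := fun y => h y - δ * ‖y - x₀‖ ^ 2) ⟨x₀, by simp; positivity⟩ (by fun_prop)
    have hx0 : h x₀ ≤ h x - δ * ‖x - x₀‖ ^ 2 := by
      have := hxm (show x₀ ∈ Metric.closedBall x₀ (3 * ((n:ℝ) + 1)) by simp; positivity)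
      simpa using this
    have hmax : ∀ y, h y - δ * ‖y - x₀‖ ^ 2 ≤ h x - δ * ‖x - x₀‖ ^ 2 := by
      intro y
      by_cases hy : y ∈ Metric.closedBall x₀ (3 * ((n:ℝ) + 1))
      · exact hxm hy
      · rw [Metric.mem_closedBall, not_le, dist_eq_norm] at hy
        have h1 : (3 * ((n:ℝ) + 1)) ^ 2 ≤ ‖y - x₀‖ ^ 2 := by gcongr
        have h2 : δ * (3 * ((n:ℝ) + 1)) ^ 2 = 9 * ((n:ℝ) + 1) := by rw [hδ]; field_simp; ring
        have h3 : δ * (3 * ((n:ℝ) + 1)) ^ 2 ≤ δ * ‖y - x₀‖ ^ 2 := by gcongr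
        have h4 := abs_le.1 (hhb y)
        have h5 := abs_le.1 (hhb x₀)
        have h6 : (0:ℝ) ≤ n := Nat.cast_nonneg n
        linarith [h4.2, h5.1]
    have hlap := laplacian_le_of_max hh2 hmax
    have hcut : (cut x₀ n) x = 1 := (cut x₀ n).one_of_mem_closedBall hx
    have e1 : laplacian h x = 2 * h x := by
      rw [hh, laplacian_sub hu.1 hG2, laplacian_G (hgd n) (hgB n) hC]
      have := hu.2 x
      have e2 : g n x = F (u x) := by simp [hg, hcut]
      rw [e2]; unfold F; simp only; linarith
    have : 0 ≤ δ * ‖x - x₀‖ ^ 2 := by positivity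
    linarith
  have l1 : Tendsto (fun n : ℕ => u x₀ - G (g n) x₀) atTop (𝓝 (u x₀ - T u x₀)) :=
    tendsto_const_nhds.sub hlim
  have l2 : Tendsto (fun n : ℕ => 2 * (1 / ((n:ℝ) + 1))) atTop (𝓝 (2 * 0)) :=
    tendsto_one_div_add_atTop_nhds_zero_nat.const_mul 2
  have := le_of_tendsto_of_tendsto' l1 l2 hmain
  linarith

theorem T_neg (v : E2 → ℝ) (x : E2) : T (fun y => - v y) x = - T v x := by
  unfold T
  simp_rw [F_neg]
  exact G_neg _ x

theorem eq_T {u : E2 → ℝ} (hu : IsACSolution u) (hb : ∀ x, |u x| ≤ 1) (x : E2) :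
    u x = T u x := by
  refine le_antisymm (le_T hu hb x) ?_
  have := le_T (isAC_neg hu) (fun x => by simpa using hb x) x
  rw [T_neg] at this
  linarith

end AC

open scoped RealInnerProductSpace
namespace AC
open MeasureTheory Set Filter Topology
open scoped NNReal

/-! ### Picone's inequality and stability -/

theorem picone_coord {w φ : E2 → ℝ} (hw : ContDiff ℝ 2 w) (hpos : ∀ x, 0 < w x)
    (hφ : ContDiff ℝ (⊤ : ℕ∞) φ) (hcs : HasCompactSupport φ) (e : E2) :
    - ∫ x, (fderiv ℝ φ x e) ^ 2 ≤ ∫ x, φ x ^ 2 * (fderiv ℝ (fun y => fderiv ℝ w y e) x e / w x) := by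
  have hφ1 : ContDiff ℝ 1 φ := hφ.of_le (by exact_mod_cast le_top)
  have hw1 := partial_contDiff hw e
  have hwc := hw.continuous
  have hφc := hφ1.continuous
  have hφ'c := partial_cont hφ1 e
  have hw'c := hw1.continuous
  have hw''c := partial_cont hw1 e
  have hne : ∀ x, w x ≠ 0 := fun x => (hpos x).ne'
  have hpc : Continuous (fun x => fderiv ℝ w x e / w x) := hw'c.div hwc hne
  have hrc : Continuous (fun x => fderiv ℝ (fun y => fderiv ℝ w y e) x e / w x) := hw''c.div hwc hne
  have hcs' : HasCompactSupport (fun x => fderiv ℝ φ x e) := hcs.fderiv_apply ℝ e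
  have hsq : HasCompactSupport (fun x => φ x ^ 2) := by
    have := hcs.mul_right (f' := φ)
    simpa [pow_two, Pi.mul_def] using this
  have hp' : ∀ x, HasFDerivAt (fun x => fderiv ℝ w x e / w x)
      ((w x ^ 2)⁻¹ • (w x • fderiv ℝ (fun y => fderiv ℝ w y e) x - fderiv ℝ w x e • fderiv ℝ w x)) x := by
    intro x
    have h1 := (hw1.differentiable (by norm_num) x).hasFDerivAt
    have h2 := (hw.differentiable (by norm_num) x).hasFDerivAt
    have h3 := h1.mul ((hasDerivAt_inv (hne x)).comp_hasFDerivAt x h2)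
    have h4 : (fun x => fderiv ℝ w x e / w x) = (fun x => fderiv ℝ w x e) * (Inv.inv ∘ w) := by
      ext z; simp [div_eq_mul_inv]
    rw [h4]
    refine h3.congr_fderiv ?_
    ext z
    have := hne x
    simp
    field_simp
    ring
  have hp : ∀ x, fderiv ℝ (fun x => fderiv ℝ w x e / w x) x e
      = fderiv ℝ (fun y => fderiv ℝ w y e) x e / w x - (fderiv ℝ w x e / w x) ^ 2 := by
    intro x
    rw [(hp' x).fderiv]
    simp
    have := hne x
    field_simp
  have hs : ∀ x, fderiv ℝ (fun x => φ x ^ 2) x e = 2 * φ x * fderiv ℝ φ x e := by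
    intro x
    have h1 := (hφ1.differentiable (by norm_num) x).hasFDerivAt.pow 2
    rw [h1.fderiv]
    simp
  have j1 : Integrable (fun x => φ x ^ 2 * (fderiv ℝ (fun y => fderiv ℝ w y e) x e / w x)) :=
    Continuous.integrable_of_hasCompactSupport (by fun_prop) hsq.mul_right
  have j2 : Integrable (fun x => φ x ^ 2 * (fderiv ℝ w x e / w x) ^ 2) :=
    Continuous.integrable_of_hasCompactSupport (by fun_prop) hsq.mul_right
  have j3 : Integrable (fun x => 2 * φ x * fderiv ℝ φ x e * (fderiv ℝ w x e / w x)) :=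
    Continuous.integrable_of_hasCompactSupport (by fun_prop)
      (HasCompactSupport.mul_right (HasCompactSupport.mul_left hcs'))
  have j4 : Integrable (fun x => (fderiv ℝ φ x e) ^ 2) := by
    refine Continuous.integrable_of_hasCompactSupport (by fun_prop) ?_
    have := hcs'.mul_right (f' := fun x => fderiv ℝ φ x e)
    simpa [pow_two, Pi.mul_def] using this
  have ibp := integral_mul_fderiv_eq_neg_fderiv_mul_of_integrable (μ := volume)
    (f := fun x => φ x ^ 2) (g := fun x => fderiv ℝ w x e / w x) (v := e)
    (by simp_rw [hs]; exact j3)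
    (by simp_rw [hp, mul_sub]; exact j1.sub j2)
    (Continuous.integrable_of_hasCompactSupport (by fun_prop) hsq.mul_right)
    (fun x _ => ((hφ1.differentiable (by norm_num) x).pow 2))
    (fun x _ => (hp' x).differentiableAt)
  simp_rw [hs, hp, mul_sub] at ibp
  rw [integral_sub j1 j2] at ibp
  have hfin : - ∫ x, (fderiv ℝ φ x e) ^ 2 ≤ (∫ x, φ x ^ 2 * (fderiv ℝ w x e / w x) ^ 2)
      - ∫ x, 2 * φ x * fderiv ℝ φ x e * (fderiv ℝ w x e / w x) := by
    rw [← integral_neg, ← integral_sub j2 j3]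
    refine integral_mono j4.neg (j2.sub j3) fun x => ?_
    simp only
    nlinarith [sq_nonneg (φ x * (fderiv ℝ w x e / w x) - fderiv ℝ φ x e)]
  linarith

theorem norm_gradient_sq (φ : E2 → ℝ) (x : E2) :
    ‖gradient φ x‖ ^ 2 = ∑ i : Fin 2, (fderiv ℝ φ x (EuclideanSpace.single i 1)) ^ 2 := by
  rw [EuclideanSpace.real_norm_sq_eq]
  refine Finset.sum_congr rfl fun i _ => ?_
  congr 1
  have h1 : ⟪gradient φ x, EuclideanSpace.single i (1:ℝ)⟫ = fderiv ℝ φ x (EuclideanSpace.single i 1) := by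
    unfold gradient
    exact InnerProductSpace.toDual_symm_apply
  rw [← h1, EuclideanSpace.inner_single_right]
  simp

theorem hcs_sq {φ : E2 → ℝ} (hcs : HasCompactSupport φ) : HasCompactSupport (fun x => φ x ^ 2) := by
  have := hcs.mul_right (f' := φ)
  simpa [pow_two, Pi.mul_def] using this

theorem grad_integrable {φ : E2 → ℝ} (hφ : ContDiff ℝ (⊤ : ℕ∞) φ) (hcs : HasCompactSupport φ)
    (i : Fin 2) : Integrable (fun x => (fderiv ℝ φ x (EuclideanSpace.single i 1)) ^ 2) := by
  have hφ1 : ContDiff ℝ 1 φ := hφ.of_le (by exact_mod_cast le_top)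
  have := partial_cont hφ1 (EuclideanSpace.single i 1)
  exact Continuous.integrable_of_hasCompactSupport (by fun_prop)
    (hcs_sq (hcs.fderiv_apply ℝ (EuclideanSpace.single i 1)))

theorem picone_C1 {f φ : E2 → ℝ} (hf : ContDiff ℝ 1 f) {B C : ℝ} (hB : ∀ x, |f x| ≤ B)
    (hC : ∀ x, ‖fderiv ℝ f x‖ ≤ C) (hf0 : ∀ x, 0 ≤ f x) {δ : ℝ} (hδ : 0 < δ)
    (hφ : ContDiff ℝ (⊤ : ℕ∞) φ) (hcs : HasCompactSupport φ) :
    ∫ x, φ x ^ 2 * (f x / (G f x + δ)) ≤ ∫ x, (‖gradient φ x‖ ^ 2 + 2 * φ x ^ 2) := by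
  have hφc := hφ.continuous
  have hG2 := G_contDiff_two hf hB hC
  have hG0 : ∀ x, 0 ≤ G f x := G_nonneg hf0
  have hpos : ∀ x, 0 < G f x + δ := fun x => by linarith [hG0 x]
  have hw : ContDiff ℝ 2 (fun x => G f x + δ) := hG2.add contDiff_const
  have hwc := hw.continuous
  have hfc := hf.continuous
  have hne : ∀ x, G f x + δ ≠ 0 := fun x => (hpos x).ne'
  have hfd : ∀ y, fderiv ℝ (fun x => G f x + δ) y = fderiv ℝ (G f) y := fun y => fderiv_add_const δ
  have k := fun i : Fin 2 => picone_coord hw hpos hφ hcs (EuclideanSpace.single i 1)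
  simp_rw [hfd] at k
  have hsq := hcs_sq hcs
  have i1 : ∀ i : Fin 2, Integrable (fun x => φ x ^ 2 * (fderiv ℝ (fun y => fderiv ℝ (G f) y
      (EuclideanSpace.single i 1)) x (EuclideanSpace.single i 1) / (G f x + δ))) := by
    intro i
    have := partial_cont (partial_contDiff hG2 (EuclideanSpace.single i 1)) (EuclideanSpace.single i 1)
    have := this.div hwc hne
    exact Continuous.integrable_of_hasCompactSupport (by fun_prop) hsq.mul_right
  have hsum := Finset.sum_le_sum (fun (i : Fin 2) (_ : i ∈ Finset.univ) => k i)
  rw [Finset.sum_neg_distrib, ← integral_finsetSum _ (fun i _ => grad_integrable hφ hcs i),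
    ← integral_finsetSum _ (fun i _ => i1 i)] at hsum
  simp_rw [← norm_gradient_sq, ← Finset.mul_sum, ← Finset.sum_div] at hsum
  have hlap : ∀ x, ∑ i : Fin 2, fderiv ℝ (fun y => fderiv ℝ (G f) y
      (EuclideanSpace.single i 1)) x (EuclideanSpace.single i 1) = 2 * G f x - f x :=
    fun x => laplacian_G hf hB hC x
  simp_rw [hlap] at hsum
  have hGc := hG2.continuous
  have c1 : Continuous (fun x => (2 * G f x - f x) / (G f x + δ)) := by
    exact Continuous.div (by fun_prop) hwc hne
  have c2 : Continuous (fun x => f x / (G f x + δ)) := hfc.div hwc hne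
  have ia : Integrable (fun x => φ x ^ 2 * ((2 * G f x - f x) / (G f x + δ))) :=
    Continuous.integrable_of_hasCompactSupport (by fun_prop) hsq.mul_right
  have ib : Integrable (fun x => φ x ^ 2 * (f x / (G f x + δ))) :=
    Continuous.integrable_of_hasCompactSupport (by fun_prop) hsq.mul_right
  have ic : Integrable (fun x => 2 * φ x ^ 2) :=
    Continuous.integrable_of_hasCompactSupport (by fun_prop) hsq.mul_left
  have id : Integrable (fun x => ‖gradient φ x‖ ^ 2) := by
    simp_rw [norm_gradient_sq]
    exact integrable_finsetSum _ (fun i _ => grad_integrable hφ hcs i)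
  rw [integral_add id ic]
  have : ∫ x, φ x ^ 2 * ((2 * G f x - f x) / (G f x + δ)) ≤
      (∫ x, 2 * φ x ^ 2) - ∫ x, φ x ^ 2 * (f x / (G f x + δ)) := by
    rw [← integral_sub ic ib]
    refine integral_mono ia (ic.sub ib) fun x => ?_
    simp only
    have h1 : (2 * G f x - f x) / (G f x + δ) ≤ 2 - f x / (G f x + δ) := by
      have := hpos x
      rw [div_le_iff₀ this, sub_mul, div_mul_cancel₀ _ this.ne']
      linarith
    nlinarith [sq_nonneg (φ x)]
  linarith

theorem picone {f φ : E2 → ℝ} (hf : Continuous f) {B : ℝ} (hB : ∀ x, |f x| ≤ B)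
    (hf0 : ∀ x, 0 ≤ f x) {δ : ℝ} (hδ : 0 < δ)
    (hφ : ContDiff ℝ (⊤ : ℕ∞) φ) (hcs : HasCompactSupport φ) :
    ∫ x, φ x ^ 2 * (f x / (G f x + δ)) ≤ ∫ x, (‖gradient φ x‖ ^ 2 + 2 * φ x ^ 2) := by
  obtain ⟨g, hg, hgB, hgC, hg0, hlim⟩ := mollify hf hB
  have hφc := hφ.continuous
  have hi : Integrable (fun x => φ x ^ 2 * (B / δ)) :=
    Continuous.integrable_of_hasCompactSupport (by fun_prop) (hcs_sq hcs).mul_right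
  have hlim2 : Tendsto (fun n => ∫ x, φ x ^ 2 * (g n x / (G (g n) x + δ))) atTop
      (𝓝 (∫ x, φ x ^ 2 * (f x / (G f x + δ)))) := by
    refine tendsto_integral_of_dominated_convergence _ (fun n => ?_) hi
      (fun n => Eventually.of_forall fun x => ?_) (Eventually.of_forall fun x => ?_)
    · have h1 := (hg n).continuous
      have h2 := (G_contDiff_one h1 (hgB n)).continuous
      refine Continuous.aestronglyMeasurable ?_
      refine (hφc.pow 2).mul (h1.div (by fun_prop) fun x => ?_)
      linarith [G_nonneg (hg0 hf0 n) x]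
    · have h0 := G_nonneg (hg0 hf0 n) x
      rw [norm_mul, Real.norm_of_nonneg (sq_nonneg _), norm_div, Real.norm_of_nonneg (by linarith : 0 ≤ G (g n) x + δ)]
      have h3 : |g n x| ≤ B := hgB n x
      have : 0 ≤ B := (abs_nonneg _).trans h3
      rw [Real.norm_eq_abs]
      gcongr
      linarith
    · have h1 := G_tendsto (fun n => (hg n).continuous) hgB hlim x
      refine ((hlim x).div (h1.add_const δ) ?_).const_mul _
      linarith [G_nonneg hf0 x]
  refine le_of_tendsto' hlim2 fun n => ?_
  obtain ⟨C, hC⟩ := hgC n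
  exact picone_C1 (hg n) (hgB n) hC (hg0 hf0 n) hδ hφ hcs

/-- Comparison with a positive supersolution. -/
theorem picone' {f b φ : E2 → ℝ} (hf : Continuous f) {B : ℝ} (hB : ∀ x, |f x| ≤ B)
    (hf0 : ∀ x, 0 ≤ f x) (hb : Continuous b) (hbb : ∀ x, |b x| ≤ 3)
    (hφ : ContDiff ℝ (⊤ : ℕ∞) φ) (hcs : HasCompactSupport φ)
    (hpos : ∀ x ∈ tsupport φ, 0 < G f x)
    (h : ∀ x ∈ tsupport φ, b x * G f x ≤ f x) :
    ∫ x, φ x ^ 2 * b x ≤ ∫ x, (‖gradient φ x‖ ^ 2 + 2 * φ x ^ 2) := by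
  have hφc := hφ.continuous
  have hGc := (G_contDiff_one hf hB).continuous
  have hG0 := G_nonneg hf0
  have hi : Integrable (fun x => φ x ^ 2 * 3) :=
    Continuous.integrable_of_hasCompactSupport (by fun_prop) (hcs_sq hcs).mul_right
  have hd : ∀ n : ℕ, (0:ℝ) < 1 / ((n:ℝ) + 1) := fun n => by positivity
  have hcont : ∀ n : ℕ, Continuous (fun x => φ x ^ 2 * (b x * G f x / (G f x + 1 / ((n:ℝ) + 1)))) := by
    intro n
    refine (hφc.pow 2).mul ((hb.mul hGc).div (by fun_prop) fun x => ?_)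
    linarith [hG0 x, hd n]
  have hlim2 : Tendsto (fun n : ℕ => ∫ x, φ x ^ 2 * (b x * G f x / (G f x + 1 / ((n:ℝ) + 1)))) atTop
      (𝓝 (∫ x, φ x ^ 2 * b x)) := by
    refine tendsto_integral_of_dominated_convergence _ (fun n => ?_) hi
      (fun n => Eventually.of_forall fun x => ?_) (Eventually.of_forall fun x => ?_)
    · exact (hcont n).aestronglyMeasurable
    · have h0 := hG0 x
      have h1 := hd n
      rw [norm_mul, Real.norm_of_nonneg (sq_nonneg _), norm_div, Real.norm_of_nonneg (by linarith : 0 ≤ G f x + 1 / ((n:ℝ) + 1)), norm_mul, Real.norm_of_nonneg h0]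
      gcongr
      rw [div_le_iff₀ (by linarith)]
      have h3 : ‖b x‖ ≤ 3 := hbb x
      nlinarith
    · by_cases hx : x ∈ tsupport φ
      · refine Tendsto.const_mul _ ?_
        have l1 : Tendsto (fun n : ℕ => G f x + 1 / ((n:ℝ) + 1)) atTop (𝓝 (G f x + 0)) :=
          tendsto_one_div_add_atTop_nhds_zero_nat.const_add _
        have := hpos x hx
        have l2 := (tendsto_const_nhds (x := b x * G f x)).div l1 (by rw [add_zero]; exact this.ne')
        rw [add_zero, mul_div_assoc, div_self this.ne', mul_one] at l2
        exact l2
      · have : φ x = 0 := image_eq_zero_of_notMem_tsupport hx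
        simp [this]
  refine le_of_tendsto' hlim2 fun n => ?_
  refine le_trans (integral_mono ?_ ?_ fun x => ?_) (picone hf hB hf0 (hd n) hφ hcs)
  · exact (hcont n).integrable_of_hasCompactSupport (hcs_sq hcs).mul_right
  · refine Continuous.integrable_of_hasCompactSupport ?_ (hcs_sq hcs).mul_right
    refine (hφc.pow 2).mul (hf.div (by fun_prop) fun x => ?_)
    linarith [hG0 x, hd n]
  · simp only
    by_cases hx : x ∈ tsupport φ
    · have h0 := hG0 x
      have h1 := hd n
      gcongr
      exact h x hx
    · have : φ x = 0 := image_eq_zero_of_notMem_tsupport hx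
      simp [this]

end AC

open scoped RealInnerProductSpace
namespace AC
open MeasureTheory Set Filter Topology
open scoped NNReal

/-! ### Properties of the monotone map -/

/-- Continuous functions with values in the unit interval. -/
def Nice (v : E2 → ℝ) : Prop := Continuous v ∧ ∀ x, |v x| ≤ 1

theorem Nice.F_c {v : E2 → ℝ} (h : Nice v) : Continuous (fun x => F (v x)) := F_cont.comp h.1

theorem Nice.F_b {v : E2 → ℝ} (h : Nice v) (x : E2) : |F (v x)| ≤ 2 := F_bound (h.2 x)

theorem Nice.neg {v : E2 → ℝ} (h : Nice v) : Nice (fun x => - v x) :=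
  ⟨h.1.neg, fun x => by rw [abs_neg]; exact h.2 x⟩

theorem Nice.T {v : E2 → ℝ} (h : Nice v) : Nice (T v) := by
  refine ⟨(G_contDiff_one h.F_c h.F_b).continuous, fun x => ?_⟩
  have := G_bound h.F_b x
  unfold AC.T
  linarith

theorem Nice.max {v w : E2 → ℝ} (h : Nice v) (h' : Nice w) : Nice (fun x => max (v x) (w x)) := by
  refine ⟨h.1.max h'.1, fun x => ?_⟩
  rcases max_choice (v x) (w x) with e | e <;> simp only [e]
  · exact h.2 x
  · exact h'.2 x

theorem F_sub (s t : ℝ) : F t - F s = (3 - (t ^ 2 + t * s + s ^ 2)) * (t - s) := by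
  unfold F; ring

theorem coef_nonneg {s t : ℝ} (hs : |s| ≤ 1) (ht : |t| ≤ 1) : 0 ≤ 3 - (t ^ 2 + t * s + s ^ 2) := by
  obtain ⟨h1, h2⟩ := abs_le.1 hs
  obtain ⟨h3, h4⟩ := abs_le.1 ht
  nlinarith [sq_nonneg (t - s), sq_nonneg (t + s)]

theorem coef_le {s t : ℝ} : 3 - (t ^ 2 + t * s + s ^ 2) ≤ 3 := by
  nlinarith [sq_nonneg (t + s), sq_nonneg t, sq_nonneg s]

theorem F_mono {s t : ℝ} (hs : |s| ≤ 1) (ht : |t| ≤ 1) (h : s ≤ t) : F s ≤ F t := by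
  have := mul_nonneg (coef_nonneg hs ht) (sub_nonneg.2 h)
  rw [← F_sub] at this; linarith

theorem F_strict {s t : ℝ} (hs : |s| ≤ 1) (ht : |t| ≤ 1) (h : s < t) : F s < F t := by
  have : 0 < (3 - (t ^ 2 + t * s + s ^ 2)) := by
    obtain ⟨h1, h2⟩ := abs_le.1 hs
    obtain ⟨h3, h4⟩ := abs_le.1 ht
    nlinarith [sq_nonneg (t - s), sq_nonneg (t + s), mul_pos (sub_pos.2 h) (sub_pos.2 h)]
  have := mul_pos this (sub_pos.2 h)
  rw [← F_sub] at this; linarith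

theorem T_mono {v w : E2 → ℝ} (hv : Nice v) (hw : Nice w) (h : ∀ x, v x ≤ w x) (x : E2) :
    T v x ≤ T w x :=
  G_mono hv.F_c hv.F_b hw.F_c hw.F_b (fun y => F_mono (hv.2 y) (hw.2 y) (h y)) x

theorem T_strict {v w : E2 → ℝ} (hv : Nice v) (hw : Nice w) (h : ∀ x, v x ≤ w x) {y : E2}
    (hy : v y < w y) (x : E2) : T v x < T w x := by
  have := G_pos (f := fun y => F (w y) - F (v y)) (B := 4) (hw.F_c.sub hv.F_c)
    (fun z => by
      have h1 := abs_le.1 (hw.F_b z)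
      have h2 := abs_le.1 (hv.F_b z)
      rw [abs_le]; constructor <;> linarith [h1.1, h1.2, h2.1, h2.2])
    (fun z => sub_nonneg.2 (F_mono (hv.2 z) (hw.2 z) (h z))) (y := y)
    (sub_pos.2 (F_strict (hv.2 y) (hw.2 y) hy)) x
  rw [G_sub hw.F_c hw.F_b hv.F_c hv.F_b] at this
  unfold T
  linarith

theorem T_lip {v : E2 → ℝ} (hv : Nice v) (x y : E2) : |T v x - T v y| ≤ 2 * CD * ‖x - y‖ := by
  have h := Convex.norm_image_sub_le_of_norm_fderiv_le (𝕜 := ℝ) (f := G (fun y => F (v y)))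
    (s := Set.univ) (C := 2 * CD) (x := y) (y := x)
    (fun z _ => (G_contDiff_one hv.F_c hv.F_b).differentiable (by norm_num) z)
    (fun z _ => G_fderiv_bound hv.F_c hv.F_b z) convex_univ (mem_univ _) (mem_univ _)
  exact h

theorem T_tendsto {v : ℕ → E2 → ℝ} {u : E2 → ℝ} (hv : ∀ n, Nice (v n))
    (h : ∀ x, Tendsto (fun n => v n x) atTop (𝓝 (u x))) (x : E2) :
    Tendsto (fun n => T (v n) x) atTop (𝓝 (T u x)) :=
  G_tendsto (fun n => (hv n).F_c) (fun n => (hv n).F_b)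
    (fun y => (F_cont.tendsto _).comp (h y)) x

theorem T_lim_cont {v : ℕ → E2 → ℝ} {u : E2 → ℝ} (hv : ∀ n, Nice (v n))
    (h : ∀ x, Tendsto (fun n => v n x) atTop (𝓝 (u x))) : Continuous (T u) := by
  have hl : ∀ x y, |T u x - T u y| ≤ 2 * CD * ‖x - y‖ := fun x y =>
    le_of_tendsto ((T_tendsto hv h x).sub (T_tendsto hv h y)).abs
      (Eventually.of_forall fun n => T_lip (hv n) x y)
  have : LipschitzWith (Real.toNNReal (2 * CD)) (T u) := by
    refine LipschitzWith.of_dist_le_mul fun x y => ?_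
    rw [Real.dist_eq, dist_eq_norm]
    refine (hl x y).trans ?_
    gcongr
    exact Real.le_coe_toNNReal _
  exact this.continuous

theorem lim_abs {v : ℕ → E2 → ℝ} {u : E2 → ℝ} (hv : ∀ n, Nice (v n))
    (h : ∀ x, Tendsto (fun n => v n x) atTop (𝓝 (u x))) (x : E2) : |u x| ≤ 1 :=
  le_of_tendsto (h x).abs (Eventually.of_forall fun n => (hv n).2 x)

/-! ### Stability -/

def Stable (u : E2 → ℝ) : Prop :=
  ∀ φ : E2 → ℝ, ContDiff ℝ (⊤ : ℕ∞) φ → HasCompactSupport φ →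
    0 ≤ ∫ x : E2, (‖gradient φ x‖ ^ 2 + (3 * (u x) ^ 2 - 1) * (φ x) ^ 2)

theorem stable_of_below {u : E2 → ℝ} (hu : Nice u) (hT : ∀ x, u x = T u x) {v : ℕ → E2 → ℝ}
    (hv : ∀ k, Nice (v k)) (hvu : ∀ k x, v k x ≤ u x)
    (hlim : ∀ x, Tendsto (fun k => v k x) atTop (𝓝 (u x)))
    (hs : ∀ k x, T (v k) x < u x)
    (hsub : ∀ K : Set E2, IsCompact K → ∀ᶠ k in atTop, ∀ x ∈ K, v k x ≤ T (v k) x) :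
    Stable u := by
  intro φ hφ hcs
  have hφc : Continuous φ := hφ.continuous
  have key : ∀ᶠ k in atTop, ∫ x, φ x ^ 2 * (3 - (u x ^ 2 + u x * v k x + v k x ^ 2))
      ≤ ∫ x, (‖gradient φ x‖ ^ 2 + 2 * φ x ^ 2) := by
    filter_upwards [hsub (tsupport φ) hcs] with k hk
    have hG : ∀ x, G (fun y => F (u y) - F (v k y)) x = u x - T (v k) x := fun x => by
      rw [G_sub hu.F_c hu.F_b (hv k).F_c (hv k).F_b]
      rw [hT x]; rfl
    have c1 := hu.1
    have c2 := (hv k).1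
    refine picone' (f := fun y => F (u y) - F (v k y)) (B := 4) (hu.F_c.sub (hv k).F_c)
      (fun z => ?_) (fun z => ?_) (by fun_prop) (fun z => ?_) hφ hcs (fun x _ => ?_) (fun x hx => ?_)
    · have h1 := abs_le.1 (hu.F_b z)
      have h2 := abs_le.1 ((hv k).F_b z)
      rw [abs_le]; constructor <;> linarith [h1.1, h1.2, h2.1, h2.2]
    · exact sub_nonneg.2 (F_mono ((hv k).2 z) (hu.2 z) (hvu k z))
    · rw [abs_of_nonneg (coef_nonneg ((hv k).2 z) (hu.2 z))]; exact coef_le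
    · rw [hG]; linarith [hs k x]
    · rw [hG, F_sub]
      exact mul_le_mul_of_nonneg_left (by linarith [hk x hx]) (coef_nonneg ((hv k).2 x) (hu.2 x))
  have i2 : Integrable (fun x => φ x ^ 2) :=
    Continuous.integrable_of_hasCompactSupport (by fun_prop) (hcs_sq hcs)
  have lim : Tendsto (fun k => ∫ x, φ x ^ 2 * (3 - (u x ^ 2 + u x * v k x + v k x ^ 2))) atTop
      (𝓝 (∫ x, φ x ^ 2 * (3 - (u x ^ 2 + u x * u x + u x ^ 2)))) := by
    refine tendsto_integral_of_dominated_convergence (fun x => φ x ^ 2 * 3) (fun k => ?_)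
      (i2.mul_const 3) (fun k => Eventually.of_forall fun x => ?_)
      (Eventually.of_forall fun x => ?_)
    · have c1 := hu.1
      have c2 := (hv k).1
      exact (by fun_prop : Continuous fun x => φ x ^ 2 * (3 - (u x ^ 2 + u x * v k x + v k x ^ 2))).aestronglyMeasurable
    · rw [Real.norm_of_nonneg (mul_nonneg (sq_nonneg _) (coef_nonneg ((hv k).2 x) (hu.2 x)))]
      exact mul_le_mul_of_nonneg_left coef_le (sq_nonneg _)
    · exact (((tendsto_const_nhds.add ((hlim x).const_mul (u x))).add ((hlim x).pow 2)).const_sub 3).const_mul _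
  have fin := le_of_tendsto lim key
  have c1 := hu.1
  have ig : Integrable (fun x => ‖gradient φ x‖ ^ 2) := by
    simp_rw [norm_gradient_sq, Fin.sum_univ_two]
    exact (grad_integrable hφ hcs 0).add (grad_integrable hφ hcs 1)
  have i3 : Integrable (fun x => φ x ^ 2 * (3 - (u x ^ 2 + u x * u x + u x ^ 2))) :=
    Continuous.integrable_of_hasCompactSupport (by fun_prop) (hcs_sq hcs).mul_right
  have e : (∫ x : E2, (‖gradient φ x‖ ^ 2 + (3 * (u x) ^ 2 - 1) * (φ x) ^ 2))
      = (∫ x, (‖gradient φ x‖ ^ 2 + 2 * φ x ^ 2))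
        - ∫ x, φ x ^ 2 * (3 - (u x ^ 2 + u x * u x + u x ^ 2)) := by
    rw [← integral_sub _ i3]
    · congr 1; ext x; ring
    · exact ig.add (i2.const_mul 2)
  rw [e]; linarith

theorem stable_of_above {u : E2 → ℝ} (hu : Nice u) (hT : ∀ x, u x = T u x) {v : ℕ → E2 → ℝ}
    (hv : ∀ k, Nice (v k)) (hvu : ∀ k x, u x ≤ v k x)
    (hlim : ∀ x, Tendsto (fun k => v k x) atTop (𝓝 (u x)))
    (hs : ∀ k x, u x < T (v k) x) (hsub : ∀ k x, T (v k) x ≤ v k x) :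
    Stable u := by
  have h : Stable (fun x => - u x) := by
    refine stable_of_below hu.neg (fun x => ?_) (v := fun k x => - v k x) (fun k => (hv k).neg)
      (fun k x => neg_le_neg (hvu k x)) (fun x => (hlim x).neg) (fun k x => ?_)
      (fun K _ => Eventually.of_forall fun k x _ => ?_)
    · rw [T_neg, ← hT x]
    · rw [T_neg]; exact neg_lt_neg (hs k x)
    · rw [T_neg]; exact neg_le_neg (hsub k x)
  intro φ hφ hcs
  have := h φ hφ hcs
  simpa using this

/-! ### Decreasing iteration from a supersolution -/

theorem decreasing_iteration {u₁ V : E2 → ℝ} (hu₁ : Nice u₁) (hT₁ : ∀ x, u₁ x = T u₁ x)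
    (hV : Nice V) (hTV : ∀ x, T V x ≤ V x) {y : E2} (hy : T V y < V y) (hle : ∀ x, u₁ x ≤ V x) :
    ∃ u, Nice u ∧ (∀ x, u x = T u x) ∧ Stable u ∧ ∀ x, u₁ x ≤ u x ∧ u x ≤ V x := by
  let w : ℕ → E2 → ℝ := fun k => T^[k] V
  have hw0 : w 0 = V := rfl
  have hws : ∀ k, w (k + 1) = T (w k) := fun k => Function.iterate_succ_apply' T k V
  have hn : ∀ k, Nice (w k) := by
    intro k
    induction k with
    | zero => exact hV
    | succ k ih => rw [hws]; exact ih.T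
  have hdec : ∀ k x, w (k + 1) x ≤ w k x := by
    intro k
    induction k with
    | zero => intro x; rw [hws]; exact hTV x
    | succ k ih =>
      intro x
      rw [hws (k + 1)]
      nth_rewrite 2 [hws k]
      exact T_mono (hn _) (hn _) ih x
  have hstr : ∀ k, ∃ z, w (k + 1) z < w k z := by
    intro k
    induction k with
    | zero => exact ⟨y, by rw [hws]; exact hy⟩
    | succ k ih =>
      obtain ⟨z, hz⟩ := ih
      refine ⟨z, ?_⟩
      rw [hws (k + 1)]
      nth_rewrite 2 [hws k]
      exact T_strict (hn _) (hn _) (hdec k) hz z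
  have hstr' : ∀ k x, w (k + 2) x < w (k + 1) x := by
    intro k x
    obtain ⟨z, hz⟩ := hstr k
    rw [hws (k + 1), hws k]
    have := T_strict (hn _) (hn _) (hdec k) hz x
    rwa [hws k] at this
  have hge : ∀ k x, u₁ x ≤ w k x := by
    intro k
    induction k with
    | zero => exact hle
    | succ k ih => intro x; rw [hws, hT₁ x]; exact T_mono hu₁ (hn k) ih x
  have hanti : ∀ x, Antitone (fun k => w k x) := fun x => antitone_nat_of_succ_le fun k => hdec k x
  have hbdd : ∀ x, BddBelow (range fun k => w k x) := fun x =>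
    ⟨u₁ x, by rintro _ ⟨k, rfl⟩; exact hge k x⟩
  let u : E2 → ℝ := fun x => ⨅ k, w k x
  have hlim : ∀ x, Tendsto (fun k => w k x) atTop (𝓝 (u x)) := fun x =>
    tendsto_atTop_ciInf (hanti x) (hbdd x)
  have hule : ∀ k x, u x ≤ w k x := fun k x => ciInf_le (hbdd x) k
  have huT : ∀ x, u x = T u x := by
    intro x
    have h1 := T_tendsto hn hlim x
    have h2 := (hlim x).comp (tendsto_add_atTop_nat 1)
    refine tendsto_nhds_unique h2 (h1.congr fun k => ?_)
    simp [hws]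
  have hun : Nice u := by
    refine ⟨?_, lim_abs hn hlim⟩
    rw [funext huT]
    exact T_lim_cont hn hlim
  refine ⟨u, hun, huT, ?_, fun x => ⟨le_ciInf fun k => hge k x, hule 0 x⟩⟩
  refine stable_of_above hun huT (v := fun k => w (k + 1)) (fun k => hn _) (fun k => hule _)
    (fun x => (hlim x).comp (tendsto_add_atTop_nat 1)) (fun k x => ?_) (fun k x => ?_)
  · rw [← hws (k + 1)]
    exact (hule (k + 3) x).trans_lt (hstr' (k + 1) x)
  · rw [← hws (k + 1)]
    exact hdec (k + 1) x

/-! ### Obstacle problem -/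

theorem obstacle {u₂ o : E2 → ℝ} (hu₂ : Nice u₂) (hT₂ : ∀ x, u₂ x = T u₂ x)
    (ho : Nice o) (hlt : ∀ x, o x < u₂ x) :
    ∃ V, Nice V ∧ (∀ x, V x = max (o x) (T V x)) ∧ (∀ x, V x ≤ u₂ x) ∧
      ((∀ x, V x = u₂ x) → Stable u₂) := by
  let S : (E2 → ℝ) → E2 → ℝ := fun v x => max (o x) (T v x)
  let v : ℕ → E2 → ℝ := fun k => S^[k] o
  have hv0 : v 0 = o := rfl
  have hvs : ∀ k x, v (k + 1) x = max (o x) (T (v k) x) := fun k x => by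
    have := Function.iterate_succ_apply' S k o
    exact congrFun this x
  have hvs' : ∀ k, v (k + 1) = fun x => max (o x) (T (v k) x) := fun k => funext (hvs k)
  have hn : ∀ k, Nice (v k) := by
    intro k
    induction k with
    | zero => exact ho
    | succ k ih => rw [hvs']; exact ho.max ih.T
  have hinc : ∀ k x, v k x ≤ v (k + 1) x := by
    intro k
    induction k with
    | zero => intro x; rw [hvs]; exact le_max_left _ _
    | succ k ih =>
      intro x
      rw [hvs (k + 1), hvs k]
      exact max_le_max le_rfl (T_mono (hn _) (hn _) ih x)
  have hltk : ∀ k x, v k x < u₂ x := by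
    intro k
    induction k with
    | zero => exact hlt
    | succ k ih =>
      intro x
      rw [hvs]
      refine max_lt (hlt x) ?_
      rw [hT₂ x]
      exact T_strict (hn k) hu₂ (fun z => (ih z).le) (ih x) x
  have hmono : ∀ x, Monotone (fun k => v k x) := fun x => monotone_nat_of_le_succ fun k => hinc k x
  have hbdd : ∀ x, BddAbove (range fun k => v k x) := fun x =>
    ⟨u₂ x, by rintro _ ⟨k, rfl⟩; exact (hltk k x).le⟩
  let V : E2 → ℝ := fun x => ⨆ k, v k x
  have hlim : ∀ x, Tendsto (fun k => v k x) atTop (𝓝 (V x)) := fun x =>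
    tendsto_atTop_ciSup (hmono x) (hbdd x)
  have hVT : ∀ x, V x = max (o x) (T V x) := by
    intro x
    have h1 := (tendsto_const_nhds (x := o x)).max (T_tendsto hn hlim x)
    have h2 := (hlim x).comp (tendsto_add_atTop_nat 1)
    refine tendsto_nhds_unique h2 (h1.congr fun k => ?_)
    simp [hvs]
  have hVn : Nice V := by
    refine ⟨?_, lim_abs hn hlim⟩
    rw [funext hVT]
    exact ho.1.max (T_lim_cont hn hlim)
  refine ⟨V, hVn, hVT, fun x => ciSup_le fun k => (hltk k x).le, fun hV => ?_⟩
  have hlim2 : ∀ x, Tendsto (fun k => v k x) atTop (𝓝 (u₂ x)) := fun x => hV x ▸ hlim x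
  refine stable_of_below hu₂ hT₂ hn (fun k x => (hltk k x).le) hlim2 (fun k x => ?_) (fun K hK => ?_)
  · rw [hT₂ x]
    exact T_strict (hn k) hu₂ (fun z => (hltk k z).le) (hltk k x) x
  · have hop : ∀ k, IsOpen {x | o x < v (k + 1) x} := fun k => isOpen_lt ho.1 (hn _).1
    have hcov : K ⊆ ⋃ k, {x | o x < v (k + 1) x} := by
      intro x _
      have h2 := (hlim2 x).comp (tendsto_add_atTop_nat 1)
      obtain ⟨k, hk⟩ := (h2.eventually (lt_mem_nhds (hlt x))).exists
      exact mem_iUnion.2 ⟨k, hk⟩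
    have hdir : Directed (· ⊆ ·) (fun k => {x | o x < v (k + 1) x}) :=
      Monotone.directed_le (f := fun k => {x | o x < v (k + 1) x})
        (fun i j hij x hx => lt_of_lt_of_le hx (hmono x (Nat.succ_le_succ hij)))
    obtain ⟨k0, hk0⟩ := hK.elim_directed_cover _ hop hcov hdir
    filter_upwards [eventually_ge_atTop k0] with k hk x hx
    have h1 : o x < v (k + 1) x := lt_of_lt_of_le (hk0 hx) (hmono x (Nat.succ_le_succ hk))
    have h2 : v k x ≤ v (k + 1) x := hinc k x
    rw [hvs] at h1 h2
    rcases lt_max_iff.1 h1 with h | h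
    · exact absurd h (lt_irrefl _)
    · rwa [max_eq_right h.le] at h2

theorem main {u₁ u₂ : E2 → ℝ} (hu₁ : Nice u₁) (hT₁ : ∀ x, u₁ x = T u₁ x)
    (hu₂ : Nice u₂) (hT₂ : ∀ x, u₂ x = T u₂ x) (hlt : ∀ x, u₁ x < u₂ x) :
    ∃ u, Nice u ∧ (∀ x, u x = T u x) ∧ Stable u ∧ ∀ x, u₁ x ≤ u x ∧ u x ≤ u₂ x := by
  let o : ℕ → E2 → ℝ := fun n x => u₂ x - (1 / ((n : ℝ) + 1)) * (u₂ x - u₁ x)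
  have hpos : ∀ n : ℕ, 0 < 1 / ((n : ℝ) + 1) := fun n => Nat.one_div_pos_of_nat
  have hle1 : ∀ n : ℕ, 1 / ((n : ℝ) + 1) ≤ 1 := fun n => by
    rw [div_le_one (by positivity)]; linarith [(Nat.cast_nonneg n : (0 : ℝ) ≤ n)]
  have hou : ∀ n x, o n x < u₂ x := fun n x => by
    have := mul_pos (hpos n) (sub_pos.2 (hlt x))
    simp only [o]; linarith
  have hou1 : ∀ n x, u₁ x ≤ o n x := fun n x => by
    have := mul_le_mul_of_nonneg_right (hle1 n) (sub_pos.2 (hlt x)).le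
    simp only [o]; linarith
  have hon : ∀ n, Nice (o n) := fun n => by
    refine ⟨?_, fun x => ?_⟩
    · have c1 := hu₁.1
      have c2 := hu₂.1
      simp only [o]; fun_prop
    · rw [abs_le]
      exact ⟨(abs_le.1 (hu₁.2 x)).1.trans (hou1 n x), (hou n x).le.trans (abs_le.1 (hu₂.2 x)).2⟩
  choose V hVn hVT hVu hVs using fun n => obstacle hu₂ hT₂ (hon n) (hou n)
  have hoV : ∀ n x, o n x ≤ V n x := fun n x => by rw [hVT n x]; exact le_max_left _ _
  have hTV : ∀ n x, T (V n) x ≤ V n x := fun n x => by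
    conv_rhs => rw [hVT n x]
    exact le_max_right _ _
  by_cases hA : ∃ n y, T (V n) y < V n y
  · obtain ⟨n, y, hy⟩ := hA
    obtain ⟨u, h1, h2, h3, h4⟩ := decreasing_iteration hu₁ hT₁ (hVn n) (hTV n) hy
      (fun x => (hou1 n x).trans (hoV n x))
    exact ⟨u, h1, h2, h3, fun x => ⟨(h4 x).1, (h4 x).2.trans (hVu n x)⟩⟩
  push Not at hA
  refine ⟨u₂, hu₂, hT₂, ?_, fun x => ⟨(hlt x).le, le_rfl⟩⟩
  by_cases hB : ∃ n, ∀ x, V n x = u₂ x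
  · obtain ⟨n, hn⟩ := hB
    exact hVs n hn
  push Not at hB
  refine stable_of_below hu₂ hT₂ hVn hVu (fun x => ?_) (fun k x => ?_)
    (fun K _ => Eventually.of_forall fun k x _ => hA k x)
  · refine tendsto_of_tendsto_of_tendsto_of_le_of_le (g := fun n => o n x) ?_ tendsto_const_nhds
      (fun n => hoV n x) (fun n => hVu n x)
    have := (tendsto_one_div_add_atTop_nhds_zero_nat (𝕜 := ℝ)).mul_const (u₂ x - u₁ x)
    have := this.const_sub (u₂ x)
    simpa [o] using this
  · obtain ⟨z, hz⟩ := hB k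
    rw [hT₂ x]
    exact T_strict (hVn k) hu₂ (hVu k) (lt_of_le_of_ne (hVu k z) hz) x

end AC

theorem stable_solution_between (u₁ u₂ : EuclideanSpace ℝ (Fin 2) → ℝ)
    (hu₁ : IsACSolution u₁) (hu₂ : IsACSolution u₂)
    (hrange : ∀ x, -1 ≤ u₁ x ∧ u₁ x < u₂ x ∧ u₂ x ≤ 1) :
    ∃ u₃ : EuclideanSpace ℝ (Fin 2) → ℝ, IsACSolution u₃ ∧
      (∀ x, u₁ x ≤ u₃ x ∧ u₃ x ≤ u₂ x) ∧
      ∀ φ : EuclideanSpace ℝ (Fin 2) → ℝ, ContDiff ℝ (⊤ : ℕ∞) φ → HasCompactSupport φ →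
        0 ≤ ∫ x : EuclideanSpace ℝ (Fin 2),
          (‖gradient φ x‖ ^ 2 + (3 * (u₃ x) ^ 2 - 1) * (φ x) ^ 2) := by
  have b1 : ∀ x, |u₁ x| ≤ 1 := fun x => abs_le.2
    ⟨(hrange x).1, (hrange x).2.1.le.trans (hrange x).2.2⟩
  have b2 : ∀ x, |u₂ x| ≤ 1 := fun x => abs_le.2
    ⟨(hrange x).1.trans (hrange x).2.1.le, (hrange x).2.2⟩
  obtain ⟨u, h1, h2, h3, h4⟩ := AC.main ⟨hu₁.1.continuous, b1⟩ (AC.eq_T hu₁ b1)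
    ⟨hu₂.1.continuous, b2⟩ (AC.eq_T hu₂ b2) (fun x => (hrange x).2.1)
  exact ⟨u, AC.isAC_of_fixed h1.1 h1.2 h2, h4, h3⟩
end
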